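/- Suppose Assumptions (A1) and (A2) hold and fix ε > 0. Let Λ = { λ ∈ [0,1] : there exists a classical solution (u_λ, m_λ) with m_λ > 0 of the discounted MFG system with potential λV }. Then Λ is relatively open in [0,1]: for every λ ∈ Λ there exists δ > 0 such that every λ' ∈ [0,1] with |λ' − λ| < δ belongs to Λ. -/

import Mathlib

open MeasureTheory Set

noncomputable def pd (d : ℕ) (i : Fin d) (f : (Fin d → ℝ) → ℝ) : (Fin d → ℝ) → ℝ :=
  fun x => fderiv ℝ f x (Pi.single i 1)

noncomputable def gradSq (d : ℕ) (u : (Fin d → ℝ) → ℝ) (x : Fin d → ℝ) : ℝ :=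
  ∑ i, pd d i u x ^ 2

noncomputable def divUp (d : ℕ) (m u : (Fin d → ℝ) → ℝ) (x : Fin d → ℝ) : ℝ :=
  ∑ i, pd d i (fun y => m y * pd d i u y) x

/-- `f` is `ℤ^d`-periodic, i.e. a function on the flat torus `T^d`. -/
def ZPer (d : ℕ) (f : (Fin d → ℝ) → ℝ) : Prop :=
  ∀ (x : Fin d → ℝ) (k : Fin d → ℤ), f (x + fun i => (k i : ℝ)) = f x

/-- `f` has finite `α`-Hölder seminorm. -/
def HolderSemi (α : ℝ) {E : Type*} [PseudoMetricSpace E] (f : E → ℝ) : Prop :=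
  ∃ C : ℝ, 0 ≤ C ∧ ∀ x y, |f x - f y| ≤ C * dist x y ^ α

/-- `f` is of class `C^{1,α}`. -/
def C1Hold (d : ℕ) (α : ℝ) (f : (Fin d → ℝ) → ℝ) : Prop :=
  ContDiff ℝ 1 f ∧ ∀ i, HolderSemi α (pd d i f)

/-- `f` is of class `C^{2,α}`. -/
def C2Hold (d : ℕ) (α : ℝ) (f : (Fin d → ℝ) → ℝ) : Prop :=
  ContDiff ℝ 2 f ∧ ∀ i j, HolderSemi α (pd d i (pd d j f))

/-- `f` is locally `α`-Hölder on `s`. -/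
def LocHolderOn (α : ℝ) (f : ℝ → ℝ) (s : Set ℝ) : Prop :=
  ∀ K : Set ℝ, IsCompact K → K ⊆ s →
    ∃ C : ℝ, 0 ≤ C ∧ ∀ x ∈ K, ∀ y ∈ K, |f x - f y| ≤ C * dist x y ^ α

/-- Standing hypotheses on `g`: strictly increasing and continuous on `[0,∞)`,
of class `C^{1,α}` on `(0,∞)`. -/
def Ghyp (α : ℝ) (g : ℝ → ℝ) : Prop :=
  StrictMonoOn g (Ici 0) ∧ ContinuousOn g (Ici 0) ∧
    DifferentiableOn ℝ g (Ioi 0) ∧ LocHolderOn α (deriv g) (Ioi 0)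

/-- Standing hypotheses on `V`: a `C^{1,α}` function on the torus. -/
def Vhyp (d : ℕ) (α : ℝ) (V : (Fin d → ℝ) → ℝ) : Prop :=
  ZPer d V ∧ C1Hold d α V

/-- The oscillation of `V` over the torus. -/
noncomputable def oscV (d : ℕ) (V : (Fin d → ℝ) → ℝ) : ℝ :=
  sSup (V '' Icc (0 : Fin d → ℝ) 1) - sInf (V '' Icc (0 : Fin d → ℝ) 1)

/-- Assumption (A1): `g⁻¹(g(1) − osc V) > 0`, i.e. `g(1) − osc V` is attained by `g` on `(0,∞)`. -/
def A1 (d : ℕ) (g : ℝ → ℝ) (V : (Fin d → ℝ) → ℝ) : Prop :=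
  g 1 - oscV d V ∈ g '' Ioi (0 : ℝ)

/-- Assumption (A2). -/
def A2 (g : ℝ → ℝ) : Prop :=
  ∃ C₁ C₂ β : ℝ, 0 < C₁ ∧ 0 < C₂ ∧
    (∀ z : ℝ, 0 < z → C₁ * z ^ β ≤ deriv g z) ∧
    (∀ z : ℝ, 0 ≤ z → g z ≤ C₂ + z * g z)

/-- A classical solution `(u, m)` of the discounted MFG system
`ε u + |Du|²/2 + V = g(m)`, `ε m − div(m Du) = ε` on `T^d`. -/
structure DiscSol (d : ℕ) (α : ℝ) (g : ℝ → ℝ) (V : (Fin d → ℝ) → ℝ) (ε : ℝ)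
    (u m : (Fin d → ℝ) → ℝ) : Prop where
  per_u : ZPer d u
  per_m : ZPer d m
  reg_u : C2Hold d α u
  reg_m : C1Hold d α m
  m_nonneg : ∀ x, 0 ≤ m x
  hj : ∀ x, ε * u x + (1 / 2) * gradSq d u x + V x = g (m x)
  fp : ∀ x, ε * m x - divUp d m u x = ε

/-- A classical solution `(u, m, H̄)` of the ergodic MFG system
`|Du|²/2 + V = g(m) + H̄`, `−div(m Du) = 0`, `m ≥ 0`, `∫ m = 1` on `T^d`. -/
structure ErgSol (d : ℕ) (α : ℝ) (g : ℝ → ℝ) (V : (Fin d → ℝ) → ℝ)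
    (u m : (Fin d → ℝ) → ℝ) (H : ℝ) : Prop where
  per_u : ZPer d u
  per_m : ZPer d m
  reg_u : C2Hold d α u
  reg_m : C1Hold d α m
  m_nonneg : ∀ x, 0 ≤ m x
  m_mass : (∫ x in Icc (0 : Fin d → ℝ) 1, m x) = 1
  hj : ∀ x, (1 / 2) * gradSq d u x + V x = g (m x) + H
  fp : ∀ x, divUp d m u x = 0

/-- `lam` belongs to the continuation set `Λ`: the discounted MFG system with
potential `lam • V` has a classical solution with positive density. -/
def InLambda (d : ℕ) (α : ℝ) (g : ℝ → ℝ) (V : (Fin d → ℝ) → ℝ) (ε lam : ℝ) : Prop :=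
  ∃ u m : (Fin d → ℝ) → ℝ,
    DiscSol d α g (fun x => lam * V x) ε u m ∧ ∀ x, 0 < m x

open Filter Topology

/-- Hölder bound with an explicit constant. -/
def Hol {d : ℕ} (α C : ℝ) (f : (Fin d → ℝ) → ℝ) : Prop :=
  ∀ x y, |f x - f y| ≤ C * dist x y ^ α

/-- Sup bound with an explicit constant. -/
def Bd {d : ℕ} (C : ℝ) (f : (Fin d → ℝ) → ℝ) : Prop := ∀ x, |f x| ≤ C

lemma fderiv_eq_sum_pd {d : ℕ} (f : (Fin d → ℝ) → ℝ) (x v : Fin d → ℝ) :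
    fderiv ℝ f x v = ∑ i, v i * pd d i f x := by
  have hv : v = ∑ i, v i • (Pi.single i (1:ℝ) : Fin d → ℝ) := by
    ext j
    simp [Finset.sum_apply, Pi.single_apply]
  conv_lhs => rw [hv]
  rw [map_sum]
  simp [pd]

lemma pd_of_hasFDerivAt {d : ℕ} {f : (Fin d → ℝ) → ℝ} {f' : (Fin d → ℝ) →L[ℝ] ℝ} {x : Fin d → ℝ}
    (h : HasFDerivAt f f' x) (i : Fin d) : pd d i f x = f' (Pi.single i 1) := by
  simp [pd, h.fderiv]

lemma pd_const {d : ℕ} (i : Fin d) (c : ℝ) : pd d i (fun _ => c) = fun _ => 0 := by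
  ext x; simp [pd]

lemma pd_add {d : ℕ} {f g : (Fin d → ℝ) → ℝ} (hf : Differentiable ℝ f) (hg : Differentiable ℝ g)
    (i : Fin d) : pd d i (fun x => f x + g x) = fun x => pd d i f x + pd d i g x := by
  ext x; simp [pd, fderiv_fun_add (hf x) (hg x)]

lemma pd_sub {d : ℕ} {f g : (Fin d → ℝ) → ℝ} (hf : Differentiable ℝ f) (hg : Differentiable ℝ g)
    (i : Fin d) : pd d i (fun x => f x - g x) = fun x => pd d i f x - pd d i g x := by
  ext x; simp [pd, fderiv_fun_sub (hf x) (hg x)]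

lemma pd_neg {d : ℕ} {f : (Fin d → ℝ) → ℝ} (i : Fin d) :
    pd d i (fun x => - f x) = fun x => - pd d i f x := by
  ext x; simp [pd, fderiv_fun_neg]

lemma pd_mul {d : ℕ} {f g : (Fin d → ℝ) → ℝ} (hf : Differentiable ℝ f) (hg : Differentiable ℝ g)
    (i : Fin d) :
    pd d i (fun x => f x * g x) = fun x => pd d i f x * g x + f x * pd d i g x := by
  ext x
  simp [pd, fderiv_fun_mul (hf x) (hg x)]
  ring

lemma pd_const_mul {d : ℕ} {f : (Fin d → ℝ) → ℝ} (hf : Differentiable ℝ f) (c : ℝ)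
    (i : Fin d) : pd d i (fun x => c * f x) = fun x => c * pd d i f x := by
  ext x; simp [pd, fderiv_const_mul (hf x)]

lemma pd_sum {d : ℕ} {ι : Type*} (s : Finset ι) {f : ι → (Fin d → ℝ) → ℝ}
    (hf : ∀ k ∈ s, Differentiable ℝ (f k)) (i : Fin d) :
    pd d i (fun x => ∑ k ∈ s, f k x) = fun x => ∑ k ∈ s, pd d i (f k) x := by
  ext x
  simp [pd, fderiv_fun_sum (fun k hk => hf k hk x)]

lemma contDiff_pd {d : ℕ} {f : (Fin d → ℝ) → ℝ} {n m : WithTop ℕ∞} (hf : ContDiff ℝ n f)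
    (hmn : m + 1 ≤ n) (i : Fin d) : ContDiff ℝ m (pd d i f) := by
  have := hf.fderiv_right (m := m) hmn
  exact this.clm_apply contDiff_const

lemma c1_pd {d : ℕ} {f : (Fin d → ℝ) → ℝ} (hf : ContDiff ℝ 2 f) (i : Fin d) :
    ContDiff ℝ 1 (pd d i f) := contDiff_pd hf (by norm_num [one_add_one_eq_two]) i

lemma c0_pd {d : ℕ} {f : (Fin d → ℝ) → ℝ} (hf : ContDiff ℝ 1 f) (i : Fin d) :
    Continuous (pd d i f) :=
  contDiff_zero.1 (contDiff_pd hf (by norm_num) i)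

lemma ContDiff.dif1 {d : ℕ} {f : (Fin d → ℝ) → ℝ} (hf : ContDiff ℝ 1 f) : Differentiable ℝ f :=
  hf.differentiable (by norm_num)

lemma ContDiff.dif2 {d : ℕ} {f : (Fin d → ℝ) → ℝ} (hf : ContDiff ℝ 2 f) : Differentiable ℝ f :=
  hf.differentiable (by norm_num)

lemma ContDiff.of21 {d : ℕ} {f : (Fin d → ℝ) → ℝ} (hf : ContDiff ℝ 2 f) : ContDiff ℝ 1 f :=
  hf.of_le (by norm_num)

lemma fderiv_eq_sum_proj {d : ℕ} (f : (Fin d → ℝ) → ℝ) (x : Fin d → ℝ) :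
    fderiv ℝ f x = ∑ i, pd d i f x • (ContinuousLinearMap.proj (R := ℝ) (φ := fun _ : Fin d => ℝ) i) := by
  ext v
  rw [fderiv_eq_sum_pd]
  simp [mul_comm]

lemma contDiff_one_of_pd {d : ℕ} {f : (Fin d → ℝ) → ℝ} (hf : Differentiable ℝ f)
    (h : ∀ i, Continuous (pd d i f)) : ContDiff ℝ 1 f := by
  rw [contDiff_one_iff_fderiv]
  refine ⟨hf, ?_⟩
  have : fderiv ℝ f = fun x => ∑ i, pd d i f x • (ContinuousLinearMap.proj (R := ℝ) (φ := fun _ : Fin d => ℝ) i) :=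
    funext (fderiv_eq_sum_proj f)
  rw [this]
  exact continuous_finsetSum _ fun i _ => (h i).smul continuous_const

lemma contDiff_two_of_pd {d : ℕ} {f : (Fin d → ℝ) → ℝ} (hf : Differentiable ℝ f)
    (h : ∀ i, ContDiff ℝ 1 (pd d i f)) : ContDiff ℝ 2 f := by
  have h2 : (2 : WithTop ℕ∞) = 1 + 1 := by norm_num [one_add_one_eq_two]
  rw [h2, contDiff_succ_iff_fderiv]
  refine ⟨hf, by simp, ?_⟩
  have : fderiv ℝ f = fun x => ∑ i, pd d i f x • (ContinuousLinearMap.proj (R := ℝ) (φ := fun _ : Fin d => ℝ) i) :=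
    funext (fderiv_eq_sum_proj f)
  rw [this]
  exact ContDiff.sum fun i _ => (h i).smul contDiff_const

lemma ZPer.pd {d : ℕ} {f : (Fin d → ℝ) → ℝ} (hf : ZPer d f) (i : Fin d) : ZPer d (pd d i f) := by
  intro x k
  have : f = fun y => f (y + fun i => (k i : ℝ)) := by ext y; rw [hf]
  have h2 : fderiv ℝ (fun y => f (y + fun i => (k i : ℝ))) x = fderiv ℝ f (x + fun i => (k i : ℝ)) := by
    rw [fderiv_comp_add_right]
  simp only [_root_.pd]
  rw [← h2, ← this]

/-- every point is a lattice translate of a point in the unit cube -/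
lemma exists_cube {d : ℕ} (x : Fin d → ℝ) :
    ∃ k : Fin d → ℤ, (x + fun i => (k i : ℝ)) ∈ Icc (0 : Fin d → ℝ) 1 := by
  refine ⟨fun i => -⌊x i⌋, ?_, ?_⟩
  · intro i
    have := Int.floor_le (x i)
    simp; linarith
  · intro i
    have := Int.lt_floor_add_one (x i)
    simp; linarith

lemma ZPer.bounded {d : ℕ} {f : (Fin d → ℝ) → ℝ} (hf : ZPer d f) (hc : Continuous f) :
    ∃ C, 0 ≤ C ∧ Bd C f := by
  obtain ⟨C, hC⟩ := (isCompact_Icc (a := (0 : Fin d → ℝ)) (b := 1)).exists_bound_of_continuousOn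
    hc.continuousOn
  refine ⟨max C 0, le_max_right _ _, fun x => ?_⟩
  obtain ⟨k, hk⟩ := exists_cube x
  rw [← hf x k]
  exact (hC _ hk).trans (le_max_left _ _)

lemma Bd.nonneg {d : ℕ} {C : ℝ} {f : (Fin d → ℝ) → ℝ} (h : Bd C f) : 0 ≤ C :=
  (abs_nonneg _).trans (h 0)

lemma Bd.mono {d : ℕ} {C C' : ℝ} {f : (Fin d → ℝ) → ℝ} (h : Bd C f) (hc : C ≤ C') : Bd C' f :=
  fun x => (h x).trans hc

lemma Hol.mono {d : ℕ} {α C C' : ℝ} {f : (Fin d → ℝ) → ℝ} (h : Hol α C f) (hc : C ≤ C') :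
    Hol α C' f := fun x y => (h x y).trans (by gcongr)

lemma Hol.continuous {d : ℕ} {α C : ℝ} (hα : 0 < α) {f : (Fin d → ℝ) → ℝ} (h : Hol α C f) :
    Continuous f := by
  rw [continuous_iff_continuousAt]
  intro x
  rw [ContinuousAt, tendsto_iff_dist_tendsto_zero]
  have h1 : Tendsto (fun y => C * dist y x ^ α) (𝓝 x) (𝓝 0) := by
    have : ContinuousAt (fun y => C * dist y x ^ α) x := by
      refine ContinuousAt.mul continuousAt_const ?_
      exact ContinuousAt.rpow_const (by fun_prop) (Or.inr hα.le)
    have h0 := this.tendsto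
    simpa [Real.zero_rpow hα.ne'] using h0
  exact squeeze_zero (fun _ => dist_nonneg) (fun y => by rw [Real.dist_eq]; exact h y x) h1

/-- Lipschitz bound from partial derivatives -/
lemma lip_of_pd {d : ℕ} {M : ℝ} {f : (Fin d → ℝ) → ℝ} (hf : Differentiable ℝ f)
    (h : ∀ i, Bd M (pd d i f)) (x y : Fin d → ℝ) : |f x - f y| ≤ d * M * dist x y := by
  have := Convex.norm_image_sub_le_of_norm_fderiv_le (𝕜 := ℝ) (f := f) (s := univ) (C := d * M)
    (fun x _ => hf x) (fun x _ => ?_) convex_univ (mem_univ y) (mem_univ x)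
  · rw [dist_eq_norm]; simpa [Real.norm_eq_abs] using this
  · refine ContinuousLinearMap.opNorm_le_bound' _ ?_ fun v _ => ?_
    · rcases Nat.eq_zero_or_pos d with h0 | h0
      · subst h0; simp
      · exact mul_nonneg (by positivity) (h ⟨0, h0⟩).nonneg
    · rw [fderiv_eq_sum_pd, Real.norm_eq_abs]
      calc |∑ i, v i * pd d i f x| ≤ ∑ i, |v i * pd d i f x| := Finset.abs_sum_le_sum_abs _ _
        _ ≤ ∑ _i : Fin d, ‖v‖ * M := by
            refine Finset.sum_le_sum fun i _ => ?_
            rw [abs_mul]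
            exact mul_le_mul (norm_le_pi_norm v i) (h i x) (abs_nonneg _) (norm_nonneg _)
        _ = d * M * ‖v‖ := by simp; ring

lemma hol_of_c1 {d : ℕ} {α M : ℝ} (hα0 : 0 < α) (hα1 : α < 1) {f : (Fin d → ℝ) → ℝ}
    (hf : Differentiable ℝ f) (h0 : Bd M f) (h : ∀ i, Bd M (pd d i f)) :
    Hol α ((d + 2) * M) f := by
  intro x y
  have hM := h0.nonneg
  rcases le_total (dist x y) 1 with h1 | h1
  · refine (lip_of_pd hf h x y).trans ?_
    have : dist x y ≤ dist x y ^ α := by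
      have := Real.rpow_le_rpow_of_exponent_ge' dist_nonneg h1 hα0.le hα1.le
      simpa using this
    have h3 : (d:ℝ) * M ≤ (d+2) * M := by nlinarith
    have h4 : 0 ≤ (d:ℝ) * M := by positivity
    exact mul_le_mul h3 this dist_nonneg (by positivity)
  · have h2 : 1 ≤ dist x y ^ α := Real.one_le_rpow h1 hα0.le
    have : |f x - f y| ≤ 2 * M := by
      have := abs_sub (f x) (f y)
      have := h0 x
      have := h0 y
      linarith
    have h5 : 0 ≤ (d:ℝ) * M := by positivity
    nlinarith

open MeasureTheory Set Filter Topology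

/-- Smooth periodic functions. -/
def SP (d : ℕ) (f : (Fin d → ℝ) → ℝ) : Prop := ZPer d f ∧ ContDiff ℝ ((⊤ : ℕ∞) : WithTop ℕ∞) f

lemma SP.pd {d : ℕ} {f : (Fin d → ℝ) → ℝ} (h : SP d f) (i : Fin d) : SP d (pd d i f) :=
  ⟨h.1.pd i, contDiff_pd h.2 (by simp) i⟩

lemma SP.cont {d : ℕ} {f : (Fin d → ℝ) → ℝ} (h : SP d f) : Continuous f := h.2.continuous

lemma SP.diff {d : ℕ} {f : (Fin d → ℝ) → ℝ} (h : SP d f) : Differentiable ℝ f :=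
  h.2.differentiable (by simp)

lemma SP.bdd {d : ℕ} {f : (Fin d → ℝ) → ℝ} (h : SP d f) : ∃ C, 0 ≤ C ∧ Bd C f :=
  h.1.bounded h.cont

lemma SP.const_mul {d : ℕ} {f : (Fin d → ℝ) → ℝ} (h : SP d f) (c : ℝ) :
    SP d (fun x => c * f x) :=
  ⟨fun x k => by simp [h.1 x k], contDiff_const.mul h.2⟩

lemma SP.sum {d : ℕ} {ι : Type*} {s : Finset ι} {f : ι → (Fin d → ℝ) → ℝ} (h : ∀ i ∈ s, SP d (f i)) :
    SP d (fun x => ∑ i ∈ s, f i x) :=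
  ⟨fun x k => Finset.sum_congr rfl fun i hi => (h i hi).1 x k, ContDiff.sum fun i hi => (h i hi).2⟩

/-- directional derivative -/
noncomputable def dd (d : ℕ) (b : Fin d → ℝ) (f : (Fin d → ℝ) → ℝ) : (Fin d → ℝ) → ℝ :=
  fun x => ∑ j, b j * pd d j f x

lemma SP.dd {d : ℕ} {f : (Fin d → ℝ) → ℝ} (h : SP d f) (b : Fin d → ℝ) : SP d (dd d b f) :=
  SP.sum fun i _ => (h.pd i).const_mul _

/-- averaging over translations -/
noncomputable def avg {d : ℕ} {Ω : Type*} [MeasurableSpace Ω] (μ : Measure Ω) (Y : Ω → Fin d → ℝ)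
    (f : (Fin d → ℝ) → ℝ) : (Fin d → ℝ) → ℝ := fun x => ∫ ω, f (x + Y ω) ∂μ

section avg
variable {d : ℕ} {Ω : Type*} [MeasurableSpace Ω] {μ : Measure Ω} [IsProbabilityMeasure μ]
  {Y : Ω → Fin d → ℝ}

lemma avg_integrable (hY : Measurable Y) {f : (Fin d → ℝ) → ℝ} {C : ℝ} (hf : Continuous f)
    (hb : Bd C f) (x : Fin d → ℝ) : Integrable (fun ω => f (x + Y ω)) μ := by
  refine Integrable.of_bound (C := C) ?_ (ae_of_all _ fun ω => ?_)
  · exact (hf.measurable.comp (measurable_const.add hY)).aestronglyMeasurable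
  · simpa using hb _

lemma avg_bd {f : (Fin d → ℝ) → ℝ} {C : ℝ} (hb : Bd C f) : Bd C (avg μ Y f) := by
  intro x
  have := norm_integral_le_of_norm_le_const (μ := μ) (f := fun ω => f (x + Y ω)) (C := C)
    (ae_of_all _ fun ω => by simpa using hb _)
  simpa [avg] using this

lemma avg_hol (hY : Measurable Y) {f : (Fin d → ℝ) → ℝ} {M C α : ℝ} (hf : Continuous f)
    (hM : Bd M f) (hb : Hol α C f) : Hol α C (avg μ Y f) := by
  intro x y
  unfold avg
  rw [← integral_sub (avg_integrable hY hf hM x) (avg_integrable hY hf hM y)]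
  have := norm_integral_le_of_norm_le_const (μ := μ) (f := fun ω => f (x + Y ω) - f (y + Y ω))
    (C := C * dist x y ^ α)
    (ae_of_all _ fun ω => by simpa using hb (x + Y ω) (y + Y ω))
  simpa using this

lemma avg_per {f : (Fin d → ℝ) → ℝ} (h : ZPer d f) : ZPer d (avg μ Y f) := by
  intro x k
  unfold avg
  congr 1; ext ω
  rw [← h (x + Y ω) k]; congr 1; abel

lemma avg_cont (hY : Measurable Y) {f : (Fin d → ℝ) → ℝ} {C : ℝ} (hf : Continuous f)
    (hb : Bd C f) : Continuous (avg μ Y f) := by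
  refine continuous_of_dominated (bound := fun _ => C) (fun x => ?_) (fun x => ?_) (integrable_const _) ?_
  · exact (avg_integrable hY hf hb x).aestronglyMeasurable
  · exact ae_of_all _ fun ω => by simpa using hb _
  · exact ae_of_all _ fun ω => by fun_prop

lemma avg_hasFDerivAt (hY : Measurable Y) {f : (Fin d → ℝ) → ℝ} (hp : ZPer d f)
    (hf : ContDiff ℝ 1 f) (x : Fin d → ℝ) :
    HasFDerivAt (avg μ Y f) (∑ i, avg μ Y (pd d i f) x • (ContinuousLinearMap.proj (R := ℝ) (φ := fun _ : Fin d => ℝ) i)) x := by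
  obtain ⟨C, hC0, hC⟩ := hp.bounded hf.continuous
  choose D hD0 hD using fun i => (hp.pd i).bounded (c0_pd hf i)
  have key := hasFDerivAt_integral_of_dominated_of_fderiv_le (μ := μ) (𝕜 := ℝ)
    (F := fun x ω => f (x + Y ω)) (F' := fun x ω => ∑ i, pd d i f (x + Y ω) •
      (ContinuousLinearMap.proj (R := ℝ) (φ := fun _ : Fin d => ℝ) i)) (x₀ := x) (s := univ)
    (bound := fun _ => ∑ i, D i * ‖(ContinuousLinearMap.proj (R := ℝ) (φ := fun _ : Fin d => ℝ) i)‖)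
    univ_mem (Eventually.of_forall fun y => (avg_integrable hY hf.continuous hC y).aestronglyMeasurable)
    (avg_integrable hY hf.continuous hC x) ?_ ?_ (integrable_const _) ?_
  · rw [integral_finsetSum] at key
    · simp_rw [integral_smul_const] at key
      exact key
    · intro i _
      exact (avg_integrable hY (c0_pd hf i) (hD i) x).smul_const _
  · exact (integrable_finsetSum _ fun i _ => (avg_integrable hY (c0_pd hf i) (hD i) x).smul_const
      (ContinuousLinearMap.proj (R := ℝ) (φ := fun _ : Fin d => ℝ) i)).aestronglyMeasurable
  · refine ae_of_all _ fun ω y _ => (norm_sum_le _ _).trans (Finset.sum_le_sum fun i _ => ?_)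
    rw [norm_smul]
    gcongr
    exact hD i _
  · refine ae_of_all _ fun ω y _ => ?_
    have h1 := (hf.dif1 (y + Y ω)).hasFDerivAt
    rw [fderiv_eq_sum_proj] at h1
    exact (hasFDerivAt_comp_add_right (Y ω)).2 h1

lemma avg_pd (hY : Measurable Y) {f : (Fin d → ℝ) → ℝ} (hp : ZPer d f)
    (hf : ContDiff ℝ 1 f) (i : Fin d) : pd d i (avg μ Y f) = avg μ Y (pd d i f) := by
  ext x
  rw [pd_of_hasFDerivAt (avg_hasFDerivAt hY hp hf x)]
  simp [Pi.single_apply]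

lemma avg_c1 (hY : Measurable Y) {f : (Fin d → ℝ) → ℝ} (hp : ZPer d f)
    (hf : ContDiff ℝ 1 f) : ContDiff ℝ 1 (avg μ Y f) := by
  refine contDiff_one_of_pd (fun x => (avg_hasFDerivAt hY hp hf x).differentiableAt) fun i => ?_
  rw [avg_pd hY hp hf]
  obtain ⟨C, hC0, hC⟩ := (hp.pd i).bounded (c0_pd hf i)
  exact avg_cont hY (c0_pd hf i) hC

lemma SP.c1 {f : (Fin d → ℝ) → ℝ} (h : SP d f) : ContDiff ℝ 1 f :=
  h.2.of_le (by exact_mod_cast le_top)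

lemma avg_c2 (hY : Measurable Y) {f : (Fin d → ℝ) → ℝ} (h : SP d f) :
    ContDiff ℝ 2 (avg μ Y f) := by
  refine contDiff_two_of_pd (avg_c1 hY h.1 h.c1).dif1 fun i => ?_
  rw [avg_pd hY h.1 h.c1]
  exact avg_c1 hY (h.pd i).1 (h.pd i).c1

lemma avg_pd2 (hY : Measurable Y) {f : (Fin d → ℝ) → ℝ} (h : SP d f) (i j : Fin d) :
    pd d i (pd d j (avg μ Y f)) = avg μ Y (pd d i (pd d j f)) := by
  rw [avg_pd hY h.1 h.c1, avg_pd hY (h.pd j).1 (h.pd j).c1]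

lemma avg_smul (hY : Measurable Y) {ι : Type*} (s : Finset ι) {f : ι → (Fin d → ℝ) → ℝ} (c : ι → ℝ)
    (h : ∀ i ∈ s, SP d (f i)) :
    avg μ Y (fun x => ∑ i ∈ s, c i * f i x) = fun x => ∑ i ∈ s, c i * avg μ Y (f i) x := by
  ext x
  unfold avg
  rw [integral_finsetSum]
  · simp_rw [integral_const_mul]
  · intro i hi
    obtain ⟨C, hC0, hC⟩ := (h i hi).bdd
    exact (avg_integrable hY (h i hi).cont hC x).const_mul _

end avg

open MeasureTheory Set Filter Topology

lemma stein1 {F F' : ℝ → ℝ} {C : ℝ} (hF : ∀ t, HasDerivAt F (F' t) t) (hF'c : Continuous F')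
    (h0 : ∀ t, |F t| ≤ C) (h1 : ∀ t, |F' t| ≤ C) :
    ∫ t, t * F t ∂(ProbabilityTheory.gaussianReal 0 1) = ∫ t, F' t ∂(ProbabilityTheory.gaussianReal 0 1) := by
  rw [ProbabilityTheory.integral_gaussianReal_eq_integral_smul one_ne_zero,
    ProbabilityTheory.integral_gaussianReal_eq_integral_smul one_ne_zero]
  have hFc : Continuous F := continuous_iff_continuousAt.2 fun t => (hF t).continuousAt
  set P := ProbabilityTheory.gaussianPDFReal 0 1 with hP
  have hPd : ∀ t, HasDerivAt P (-t * P t) t := by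
    intro t
    have e : P = fun x => (√(2 * Real.pi))⁻¹ * Real.exp (- x ^ 2 / 2) := by
      ext x; simp [hP, ProbabilityTheory.gaussianPDFReal]
    rw [e]
    have h2 : HasDerivAt (fun x : ℝ => - x ^ 2 / 2) (-t) t := by
      have := ((hasDerivAt_pow 2 t).neg).div_const 2
      refine this.congr_deriv ?_
      simp; ring
    have := (h2.exp).const_mul ((√(2 * Real.pi))⁻¹)
    refine this.congr_deriv ?_
    ring
  have hPi : Integrable P := ProbabilityTheory.integrable_gaussianPDFReal 0 1
  have htP : Integrable (fun t => t * P t) := by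
    have h := (integrable_mul_exp_neg_mul_sq (b := 1/2) (by norm_num)).const_mul (√(2 * Real.pi))⁻¹
    refine h.congr (ae_of_all _ fun x => ?_)
    simp only [hP, ProbabilityTheory.gaussianPDFReal]
    have : -(1/2) * x ^ 2 = -(x - 0) ^ 2 / (2 * ((1 : NNReal) : ℝ)) := by simp; ring
    rw [this]
    simp; ring
  have key := integral_mul_deriv_eq_deriv_mul_of_integrable (u := F) (v := P) (u' := F')
    (v' := fun t => - t * P t) (fun x _ => hF x) (fun x _ => hPd x) ?_ ?_ ?_
  · have e1 : ∫ t, P t • (t * F t) = - ∫ t, F t * (- t * P t) := by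
      rw [← integral_neg]; congr 1; ext t; simp; ring
    rw [e1, key, neg_neg]; congr 1; ext t; simp; ring
  · have := (htP.neg.bdd_mul (f := F) hFc.aestronglyMeasurable (ae_of_all _ fun t => by simpa using h0 t))
    refine this.congr (ae_of_all _ fun t => ?_)
    simp
  · exact hPi.bdd_mul hF'c.aestronglyMeasurable (ae_of_all _ fun t => by simpa using h1 t)
  · exact hPi.bdd_mul hFc.aestronglyMeasurable (ae_of_all _ fun t => by simpa using h0 t)

/-- standard Gaussian measure -/
noncomputable def gam (d : ℕ) : Measure (Fin d → ℝ) :=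
  Measure.pi (fun _ => ProbabilityTheory.gaussianReal 0 1)

instance (d : ℕ) : IsProbabilityMeasure (gam d) := by unfold gam; infer_instance

instance (d : ℕ) : ProbabilityTheory.IsGaussian (gam d) := by
  have h := ProbabilityTheory.map_pi_eq_stdGaussian (ι := Fin d)
  have : gam d = (ProbabilityTheory.stdGaussian (EuclideanSpace ℝ (Fin d))).map
      (PiLp.continuousLinearEquiv 2 ℝ (fun _ : Fin d => ℝ)) := by
    rw [← h, Measure.map_map (by fun_prop) (by fun_prop)]
    have : (⇑(PiLp.continuousLinearEquiv 2 ℝ fun _ : Fin d => ℝ) ∘ WithLp.toLp 2) = id := by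
      ext x; simp
    rw [this, Measure.map_id]; rfl
  rw [this]; infer_instance

lemma gam_norm_int (d : ℕ) (p : ℕ) : Integrable (fun z : Fin d → ℝ => ‖z‖ ^ p) (gam d) := by
  have h := ProbabilityTheory.IsGaussian.memLp_id (gam d) (p : ENNReal) (by simp)
  exact h.integrable_norm_pow'

lemma gam_coord_int {d : ℕ} (i : Fin d) : Integrable (fun z : Fin d → ℝ => z i) (gam d) := by
  refine (gam_norm_int d 1).mono' (measurable_pi_apply i).aestronglyMeasurable (ae_of_all _ fun z => ?_)
  simpa using norm_le_pi_norm z i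

lemma stein {d : ℕ} (i : Fin d) {F : (Fin d → ℝ) → ℝ} {C : ℝ} (hF : ContDiff ℝ 1 F)
    (h0 : Bd C F) (h1 : Bd C (pd d i F)) :
    ∫ z, z i * F z ∂(gam d) = ∫ z, pd d i F z ∂(gam d) := by
  obtain ⟨n, rfl⟩ : ∃ n, d = n + 1 := ⟨d - 1, by have := i.2; omega⟩
  have hmp := (measurePreserving_piFinSuccAbove
    (fun _ : Fin (n+1) => ProbabilityTheory.gaussianReal 0 1) i).symm
  have hI1 : Integrable (fun z => z i * F z) (gam (n+1)) := by
    have := (gam_coord_int i).bdd_mul (f := F) (c := C) hF.continuous.aestronglyMeasurable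
      (ae_of_all _ fun t => by simpa using h0 t)
    exact this.congr (ae_of_all _ fun t => by ring)
  have hI2 : Integrable (pd (n+1) i F) (gam (n+1)) :=
    Integrable.of_bound (C := C) (c0_pd hF i).aestronglyMeasurable (ae_of_all _ fun t => by simpa using h1 t)
  unfold gam at hI1 hI2 ⊢
  rw [← hmp.integral_comp', ← hmp.integral_comp']
  rw [← hmp.integrable_comp_emb (MeasurableEquiv.measurableEmbedding _)] at hI1 hI2
  simp only [Function.comp_def] at hI1 hI2
  rw [integral_prod_symm _ hI1, integral_prod_symm _ hI2]
  congr 1; ext y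
  simp only [MeasurableEquiv.piFinSuccAbove_symm_apply, Fin.insertNthEquiv, Equiv.coe_fn_mk,
    Fin.insertNth_apply_same]
  have hd : ∀ t : ℝ, HasDerivAt (fun t : ℝ => (i.insertNth t y : Fin (n+1) → ℝ)) (Pi.single i 1) t := by
    intro t
    rw [hasDerivAt_pi]
    intro j
    refine Fin.succAboveCases i ?_ (fun j => ?_) j
    · simpa using hasDerivAt_id' t
    · simpa [Pi.single_apply] using hasDerivAt_const t _
  refine stein1 (C := C) (fun t => ?_) ?_ (fun t => h0 _) (fun t => h1 _)
  · exact (hF.dif1 _).hasFDerivAt.comp_hasDerivAt t (hd t)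
  · exact (c0_pd hF i).comp (continuous_iff_continuousAt.2 fun t => (hd t).continuousAt)

lemma gam_mean (d : ℕ) : ∫ z, id z ∂(gam d) = 0 := by
  have hi : Integrable (fun z : Fin d → ℝ => z) (gam d) := by
    refine (integrable_norm_iff (by fun_prop)).1 ?_
    simpa using gam_norm_int d 1
  ext i
  have := (ContinuousLinearMap.proj (R := ℝ) (φ := fun _ : Fin d => ℝ) i).integral_comp_comm hi
  simp only [ContinuousLinearMap.proj_apply] at this
  simp only [id, Pi.zero_apply]
  rw [← this]
  have h := stein (C := 1) i (F := fun _ => 1) contDiff_const (fun x => by simp) (fun x => by simp [pd_const])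
  simpa [pd_const] using h

lemma gam_rot {d : ℕ} (F : (Fin d → ℝ) → ℝ) (hF : Continuous F) {C : ℝ} (hb : Bd C F) :
    ∫ z, F z ∂(gam d) = ∫ z, ∫ z', F ((√2)⁻¹ • z + (√2)⁻¹ • z') ∂(gam d) ∂(gam d) := by
  have hr := ProbabilityTheory.IsGaussian.map_rotation_eq_self (μ := gam d) (gam_mean d) (Real.pi / 4)
  have hs : √2 / 2 = (√2)⁻¹ := by
    rw [div_eq_iff (by norm_num), eq_comm, inv_mul_eq_iff_eq_mul₀ (by positivity)]
    simp
  have h1 : ∫ z, F z ∂(gam d) = ∫ p : (Fin d → ℝ) × (Fin d → ℝ), F p.1 ∂((gam d).prod (gam d)) := by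
    rw [integral_fun_fst (f := F)]; simp
  rw [h1, ← hr, integral_map (by fun_prop) (by fun_prop), integral_prod]
  · simp only [ContinuousLinearMap.rotation_apply, Real.cos_pi_div_four, Real.sin_pi_div_four, hs]
  · refine Integrable.of_bound (C := C) ?_ (ae_of_all _ fun ω => by simpa using hb _)
    exact (hF.comp (by fun_prop)).aestronglyMeasurable

open MeasureTheory Set Filter Topology

/-- the linear map given by a frame -/
noncomputable def Lb {d : ℕ} (b : Fin d → Fin d → ℝ) (z : Fin d → ℝ) : Fin d → ℝ :=
  fun j => ∑ i, z i * b i j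

lemma Lb_cont {d : ℕ} (b : Fin d → Fin d → ℝ) : Continuous (Lb b) := by
  unfold Lb; fun_prop

lemma Lb_norm {d : ℕ} {b : Fin d → Fin d → ℝ} {C : ℝ} (hC : 0 ≤ C) (hb : ∀ i j, |b i j| ≤ C)
    (z : Fin d → ℝ) : ‖Lb b z‖ ≤ d * C * ‖z‖ := by
  refine (pi_norm_le_iff_of_nonneg (by positivity)).2 fun j => ?_
  unfold Lb
  refine (norm_sum_le _ _).trans ?_
  refine (Finset.sum_le_card_nsmul _ _ (‖z‖ * C) fun i _ => ?_).trans (le_of_eq ?_)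
  · rw [norm_mul]
    exact mul_le_mul (norm_le_pi_norm z i) (hb i j) (norm_nonneg _) (norm_nonneg _)
  · simp; ring

lemma Lb_add {d : ℕ} (b : Fin d → Fin d → ℝ) (z z' : Fin d → ℝ) : Lb b (z + z') = Lb b z + Lb b z' := by
  ext j; simp [Lb, add_mul, Finset.sum_add_distrib]

lemma Lb_smul {d : ℕ} (b : Fin d → Fin d → ℝ) (c : ℝ) (z : Fin d → ℝ) : Lb b (c • z) = c • Lb b z := by
  ext j; simp [Lb, Finset.mul_sum, mul_assoc]

/-- Gaussian averages -/
noncomputable def Sop {d : ℕ} (b : Fin d → Fin d → ℝ) (s : ℝ) (f : (Fin d → ℝ) → ℝ) :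
    (Fin d → ℝ) → ℝ := avg (gam d) (fun z => s • Lb b z) f

lemma Ymeas {d : ℕ} (b : Fin d → Fin d → ℝ) (s : ℝ) : Measurable (fun z => s • Lb b z) :=
  ((Lb_cont b).const_smul s).measurable

lemma comp_L {d : ℕ} (b : Fin d → Fin d → ℝ) (s : ℝ) {h : (Fin d → ℝ) → ℝ} (hh : ContDiff ℝ 1 h)
    (x : Fin d → ℝ) : ContDiff ℝ 1 (fun z => h (x + s • Lb b z)) ∧
    ∀ i, pd d i (fun z => h (x + s • Lb b z)) = fun z => s * dd d (b i) h (x + s • Lb b z) := by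
  have hL : ContDiff ℝ 1 (fun z => x + s • Lb b z) := by
    unfold Lb; fun_prop
  refine ⟨hh.comp hL, fun i => ?_⟩
  ext z
  have hl : HasFDerivAt (fun z => x + s • Lb b z)
      (s • (ContinuousLinearMap.pi fun j => ∑ i, b i j • (ContinuousLinearMap.proj (R := ℝ) (φ := fun _ : Fin d => ℝ) i)) : (Fin d → ℝ) →L[ℝ] (Fin d → ℝ)) z := by
    have e : (fun z => x + s • Lb b z) = fun z => x + (s • (ContinuousLinearMap.pi fun j => ∑ i, b i j • (ContinuousLinearMap.proj (R := ℝ) (φ := fun _ : Fin d => ℝ) i)) : (Fin d → ℝ) →L[ℝ] (Fin d → ℝ)) z := by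
      ext z j; simp [Lb, mul_comm]
    rw [e]
    exact (ContinuousLinearMap.hasFDerivAt _).const_add x
  have := (hh.dif1 (x + s • Lb b z)).hasFDerivAt.comp z hl
  have h2 := pd_of_hasFDerivAt this i
  simp only [Function.comp_def] at h2
  rw [h2, ContinuousLinearMap.comp_apply, fderiv_eq_sum_pd, dd, Finset.mul_sum]
  refine Finset.sum_congr rfl fun j _ => ?_
  simp [Pi.single_apply, mul_assoc]

lemma dd_cont {d : ℕ} (b : Fin d → ℝ) {h : (Fin d → ℝ) → ℝ} (hh : ContDiff ℝ 1 h) : Continuous (dd d b h) := by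
  unfold dd
  exact continuous_finsetSum _ fun i _ => continuous_const.mul (c0_pd hh i)

lemma dd_per {d : ℕ} (b : Fin d → ℝ) {h : (Fin d → ℝ) → ℝ} (hp : ZPer d h) : ZPer d (dd d b h) := by
  intro x k
  simp only [dd, hp.pd _ x k]

lemma S_stein {d : ℕ} (b : Fin d → Fin d → ℝ) (s : ℝ) {h : (Fin d → ℝ) → ℝ} (hp : ZPer d h)
    (hh : ContDiff ℝ 1 h) (x : Fin d → ℝ) (i : Fin d) :
    ∫ z, z i * h (x + s • Lb b z) ∂(gam d) = s * Sop b s (dd d (b i) h) x := by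
  obtain ⟨h1, h2⟩ := comp_L b s hh x
  obtain ⟨C, hC0, hC⟩ := hp.bounded hh.continuous
  obtain ⟨D, hD0, hD⟩ := (dd_per (b i) hp).bounded (dd_cont (b i) hh)
  rw [stein (C := max C (|s| * D)) i h1 (fun z => (hC _).trans (le_max_left _ _)), h2 i]
  · rw [integral_const_mul]; rfl
  · intro z
    rw [h2 i, abs_mul]
    refine le_trans ?_ (le_max_right _ _)
    gcongr
    exact hD _

lemma zmul_int {d : ℕ} (b : Fin d → Fin d → ℝ) (s : ℝ) {h : (Fin d → ℝ) → ℝ} {C : ℝ} (hc : Continuous h)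
    (hC : Bd C h) (x : Fin d → ℝ) (i : Fin d) : Integrable (fun z => z i * h (x + s • Lb b z)) (gam d) := by
  have := (gam_coord_int i).bdd_mul (f := fun z => h (x + s • Lb b z)) (c := C)
    (hc.comp (continuous_const.add ((Lb_cont b).const_smul s))).aestronglyMeasurable
    (ae_of_all _ fun t => by simpa using hC _)
  exact this.congr (ae_of_all _ fun t => by ring)

lemma S_dd_bd {d : ℕ} (b : Fin d → Fin d → ℝ) {s : ℝ} (hs : 0 < s) {h : (Fin d → ℝ) → ℝ} {M : ℝ} (hp : ZPer d h)
    (hh : ContDiff ℝ 1 h) (hM : Bd M h) (i : Fin d) :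
    Bd ((∫ z : Fin d → ℝ, ‖z‖ ^ 1 ∂(gam d)) * M / s) (Sop b s (dd d (b i) h)) := by
  intro x
  have h1 := S_stein b s hp hh x i
  rw [le_div_iff₀ hs, mul_comm]
  have : |s * Sop b s (dd d (b i) h) x| = s * |Sop b s (dd d (b i) h) x| := by
    rw [abs_mul, abs_of_pos hs]
  rw [← this, ← h1, ← integral_mul_const]
  rw [← Real.norm_eq_abs]
  refine norm_integral_le_of_norm_le ((gam_norm_int d 1).mul_const M) (ae_of_all _ fun z => ?_)
  rw [norm_mul, pow_one]
  exact mul_le_mul (norm_le_pi_norm z i) (hM _) (norm_nonneg _) (norm_nonneg _)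

lemma rpow_le_one_add {t α : ℝ} (ht : 0 ≤ t) (h0 : 0 < α) (h1 : α < 1) : t ^ α ≤ 1 + t := by
  rcases le_total t 1 with h | h
  · have := Real.rpow_le_one ht h h0.le; linarith
  · have := Real.rpow_le_rpow_of_exponent_le h h1.le
    rw [Real.rpow_one] at this; linarith

lemma S_dd_hol {d : ℕ} {α C0 : ℝ} (h0 : 0 < α) (h1 : α < 1) (hC0 : 0 ≤ C0) {b : Fin d → Fin d → ℝ} (hb : ∀ i j, |b i j| ≤ C0)
    {s : ℝ} (hs : 0 < s) {h : (Fin d → ℝ) → ℝ} {H : ℝ} (hp : ZPer d h)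
    (hh : ContDiff ℝ 1 h) (hH0 : 0 ≤ H) (hH : Hol α H h) (i : Fin d) :
    Bd ((∫ z : Fin d → ℝ, (‖z‖ ^ 1 + d * C0 * ‖z‖ ^ 2) ∂(gam d)) * H * s ^ (α - 1)) (Sop b s (dd d (b i) h)) := by
  intro x
  have hst := S_stein b s hp hh x i
  obtain ⟨C, hC0', hC⟩ := hp.bounded hh.continuous
  have hz : ∫ z : Fin d → ℝ, z i * h x ∂(gam d) = 0 := by
    have := stein (C := |h x|) i (F := fun _ => h x) contDiff_const (fun x => by simp) (fun x => by simp [pd_const])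
    simpa [pd_const] using this
  have e : s * Sop b s (dd d (b i) h) x = ∫ z, z i * (h (x + s • Lb b z) - h x) ∂(gam d) := by
    simp_rw [mul_sub]
    rw [integral_sub (zmul_int b s hh.continuous hC x i) ((gam_coord_int i).mul_const _), hz, hst, sub_zero]
  have e2 : (∫ z : Fin d → ℝ, (‖z‖ ^ 1 + d * C0 * ‖z‖ ^ 2) ∂(gam d)) * H * s ^ (α - 1)
    = ((∫ z : Fin d → ℝ, (‖z‖ ^ 1 + d * C0 * ‖z‖ ^ 2) ∂(gam d)) * (H * s ^ α)) / s := by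
    rw [Real.rpow_sub_one hs.ne']; ring
  rw [e2, le_div_iff₀ hs, mul_comm]
  have : |s * Sop b s (dd d (b i) h) x| = s * |Sop b s (dd d (b i) h) x| := by
    rw [abs_mul, abs_of_pos hs]
  rw [← this, e, ← integral_mul_const]
  rw [← Real.norm_eq_abs]
  refine norm_integral_le_of_norm_le (((gam_norm_int d 1).add ((gam_norm_int d 2).const_mul _)).mul_const _) (ae_of_all _ fun z => ?_)
  rw [norm_mul]
  have hA : ‖h (x + s • Lb b z) - h x‖ ≤ (1 + d * C0 * ‖z‖) * (H * s ^ α) := by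
    refine (hH _ _).trans ?_
    rw [dist_self_add_left, norm_smul, Real.mul_rpow (norm_nonneg _) (norm_nonneg _), Real.norm_of_nonneg hs.le]
    have h3 := rpow_le_one_add (norm_nonneg (Lb b z)) h0 h1
    have h4 := Lb_norm hC0 hb z
    have : 0 ≤ H * s ^ α := by positivity
    nlinarith
  refine (mul_le_mul (norm_le_pi_norm z i) hA (norm_nonneg _) (norm_nonneg _)).trans (le_of_eq ?_)
  ring

lemma S_semi {d : ℕ} (b : Fin d → Fin d → ℝ) (s : ℝ) {h : (Fin d → ℝ) → ℝ} (hp : ZPer d h) (hc : Continuous h) :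
    Sop b s h = Sop b ((√2)⁻¹ * s) (Sop b ((√2)⁻¹ * s) h) := by
  obtain ⟨C, hC0', hC⟩ := hp.bounded hc
  ext x
  have := gam_rot (fun z => h (x + s • Lb b z))
    (hc.comp (continuous_const.add ((Lb_cont b).const_smul s))) (C := C) (fun z => hC _)
  unfold Sop avg
  rw [this]
  congr 1; ext z; congr 1; ext z'; congr 1
  rw [Lb_add, Lb_smul, Lb_smul, smul_add, smul_smul, smul_smul, mul_comm s, add_assoc]

lemma dd_q {d : ℕ} {b q : Fin d → Fin d → ℝ} (hq : ∀ j, (Pi.single j 1 : Fin d → ℝ) = ∑ i, q j i • b i)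
    (h : (Fin d → ℝ) → ℝ) (j : Fin d) : pd d j h = fun x => ∑ i, q j i * dd d (b i) h x := by
  ext x
  rw [pd, hq j, map_sum]
  refine Finset.sum_congr rfl fun i _ => ?_
  rw [map_smul, fderiv_eq_sum_pd]; rfl

lemma S_pd_sum {d : ℕ} {b q : Fin d → Fin d → ℝ} (hq : ∀ j, (Pi.single j 1 : Fin d → ℝ) = ∑ i, q j i • b i)
    {s : ℝ} {h : (Fin d → ℝ) → ℝ} (hp : ZPer d h) (hh : ContDiff ℝ 1 h) {C0 B : ℝ} (hB : 0 ≤ B) (hqC : ∀ j i, |q j i| ≤ C0)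
    (hS : ∀ i, Bd B (Sop b s (dd d (b i) h))) (j : Fin d) : Bd (d * C0 * B) (Sop b s (pd d j h)) := by
  intro x
  have : Sop b s (pd d j h) x = ∑ i, q j i * Sop b s (dd d (b i) h) x := by
    rw [dd_q hq h j]
    unfold Sop avg
    rw [integral_finsetSum]
    · simp_rw [integral_const_mul]
    · intro i hi
      obtain ⟨C, hC0, hC⟩ := (dd_per (b i) hp).bounded (dd_cont (b i) hh)
      exact (avg_integrable (Ymeas b s) (dd_cont (b i) hh) hC x).const_mul _
  rw [this]
  refine (Finset.abs_sum_le_sum_abs _ _).trans ?_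
  refine (Finset.sum_le_card_nsmul _ _ (C0 * B) fun i _ => ?_).trans (le_of_eq ?_)
  · rw [abs_mul]
    exact mul_le_mul (hqC j i) (hS i x) (abs_nonneg _) ((abs_nonneg _).trans (hqC j i))
  · simp; ring

/-- Frame data. -/
structure Frame {d : ℕ} (C0 : ℝ) (b q : Fin d → Fin d → ℝ) : Prop where
  hb : ∀ i j, |b i j| ≤ C0
  hq : ∀ j i, |q j i| ≤ C0
  e : ∀ j, (Pi.single j 1 : Fin d → ℝ) = ∑ i, q j i • b i

lemma S_pd_bounds (d : ℕ) {α C0 : ℝ} (h0 : 0 < α) (h1 : α < 1) (hC0 : 0 ≤ C0) :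
    ∃ K : ℝ, 0 ≤ K ∧ ∀ (b q : Fin d → Fin d → ℝ), Frame C0 b q → ∀ s : ℝ, 0 < s →
      ∀ h : (Fin d → ℝ) → ℝ, ZPer d h → ContDiff ℝ 1 h →
        (∀ M, Bd M h → ∀ j, Bd (K * M / s) (Sop b s (pd d j h))) ∧
        (∀ H, 0 ≤ H → Hol α H h → ∀ j, Bd (K * H * s ^ (α - 1)) (Sop b s (pd d j h))) := by
  set c1 := ∫ z : Fin d → ℝ, ‖z‖ ^ 1 ∂(gam d)
  set c2 := ∫ z : Fin d → ℝ, (‖z‖ ^ 1 + d * C0 * ‖z‖ ^ 2) ∂(gam d)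
  have hc1 : 0 ≤ c1 := integral_nonneg fun z => by positivity
  have hc2 : 0 ≤ c2 := integral_nonneg fun z => by positivity
  refine ⟨d * C0 * (c1 + c2), by positivity, fun b q hF s hs h hp hh => ⟨fun M hM j => ?_, fun H hH0 hH j => ?_⟩⟩
  · have := hM.nonneg
    refine (S_pd_sum hF.e hp hh (by positivity) hF.hq (fun i => S_dd_bd b hs hp hh hM i) j).mono ?_
    rw [show ↑d * C0 * (c1 + c2) * M / s = d * C0 * ((c1 + c2) * M / s) by ring]
    gcongr
    linarith
  · refine (S_pd_sum hF.e hp hh (by positivity) hF.hq (fun i => S_dd_hol h0 h1 hC0 hF.hb hs hp hh hH0 hH i) j).mono ?_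
    rw [show ↑d * C0 * (c1 + c2) * H * s ^ (α - 1) = d * C0 * ((c1 + c2) * H * s ^ (α - 1)) by ring]
    gcongr
    linarith

lemma S_pd23 (d : ℕ) {α C0 : ℝ} (h0 : 0 < α) (h1 : α < 1) (hC0 : 0 ≤ C0) :
    ∃ K : ℝ, 0 ≤ K ∧ ∀ (b q : Fin d → Fin d → ℝ), Frame C0 b q → ∀ s : ℝ, 0 < s →
      ∀ f : (Fin d → ℝ) → ℝ, SP d f → ∀ H, 0 ≤ H → Hol α H f →
        (∀ j l, Bd (K * H * s ^ (α - 2)) (Sop b s (pd d j (pd d l f)))) ∧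
        (∀ k j l, Bd (K * H * s ^ (α - 3)) (pd d k (Sop b s (pd d j (pd d l f))))) := by
  obtain ⟨K, hK, hKb⟩ := S_pd_bounds d h0 h1 hC0
  set c : ℝ := (√2)⁻¹ with hc
  have hc0 : 0 < c := by positivity
  have B2 : ∀ (b q : Fin d → Fin d → ℝ), Frame C0 b q → ∀ s : ℝ, 0 < s →
      ∀ f : (Fin d → ℝ) → ℝ, SP d f → ∀ H, 0 ≤ H → Hol α H f → 
        (∀ j l, Bd (K * K * c ^ (α - 2) * H * s ^ (α - 2)) (Sop b s (pd d j (pd d l f)))) := by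
    intro b q hF s hs f hf H hH0 hH j l
    have hr : 0 < c * s := by positivity
    rw [S_semi b s ((hf.pd l).pd j).1 ((hf.pd l).pd j).cont]
    have e1 : Sop b (c * s) (pd d j (pd d l f)) = pd d j (Sop b (c * s) (pd d l f)) :=
      (avg_pd (Ymeas b _) (hf.pd l).1 (hf.pd l).c1 j).symm
    rw [e1]
    have t2 := (hKb b q hF (c * s) hr f hf.1 hf.c1).2 H hH0 hH l
    have t1 := (hKb b q hF (c * s) hr (Sop b (c * s) (pd d l f)) (avg_per (hf.pd l).1)
      (avg_c1 (Ymeas b _) (hf.pd l).1 (hf.pd l).c1)).1 _ t2 j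
    refine t1.mono (le_of_eq ?_)
    have : (c * s) ^ (α - 1) / (c * s) = c ^ (α - 2) * s ^ (α - 2) := by
      rw [← Real.rpow_sub_one hr.ne', ← Real.mul_rpow hc0.le hs.le]; congr 1; ring
    rw [show K * (K * H * (c * s) ^ (α - 1)) / (c * s) = K * K * H * ((c * s) ^ (α - 1) / (c * s)) by ring, this]
    ring
  refine ⟨K * K * c ^ (α - 2) + K * (K * K * c ^ (α - 2)) * c ^ (α - 3), by positivity, ?_⟩
  intro b q hF s hs f hf H hH0 hH
  refine ⟨fun j l => (B2 b q hF s hs f hf H hH0 hH j l).mono ?_, fun k j l => ?_⟩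
  · gcongr
    have : 0 ≤ K * (K * K * c ^ (α - 2)) * c ^ (α - 3) := by positivity
    linarith
  have hr : 0 < c * s := by positivity
  have hW := (hf.pd l).pd j
  have e0 : pd d k (Sop b s (pd d j (pd d l f))) = Sop b (c * s) (pd d k (Sop b (c * s) (pd d j (pd d l f)))) := by
    rw [S_semi b s hW.1 hW.cont]
    exact avg_pd (Ymeas b _) (avg_per hW.1) (avg_c1 (Ymeas b _) hW.1 hW.c1) k
  rw [e0]
  have t1 := (hKb b q hF (c * s) hr (Sop b (c * s) (pd d j (pd d l f))) (avg_per hW.1)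
      (avg_c1 (Ymeas b _) hW.1 hW.c1)).1 _ (B2 b q hF (c * s) hr f hf H hH0 hH j l) k
  refine t1.mono ?_
  have : (c * s) ^ (α - 2) / (c * s) = c ^ (α - 3) * s ^ (α - 3) := by
    rw [← Real.rpow_sub_one hr.ne', ← Real.mul_rpow hc0.le hs.le]; congr 1; ring
  rw [show K * (K * K * c ^ (α - 2) * H * (c * s) ^ (α - 2)) / (c * s) =
    K * (K * K * c ^ (α - 2)) * H * ((c * s) ^ (α - 2) / (c * s)) by ring, this]
  rw [show K * (K * K * c ^ (α - 2)) * H * (c ^ (α - 3) * s ^ (α - 3)) = (K * (K * K * c ^ (α - 2)) * c ^ (α - 3)) * H * s ^ (α - 3) by ring]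
  gcongr
  have : 0 ≤ K * K * c ^ (α - 2) := by positivity
  linarith

open MeasureTheory Set Filter Topology

/-- the operator `Σ D_{b_i}^2` -/
noncomputable def Lap {d : ℕ} (b : Fin d → Fin d → ℝ) (h : (Fin d → ℝ) → ℝ) : (Fin d → ℝ) → ℝ :=
  fun x => ∑ i, dd d (b i) (dd d (b i) h) x

lemma dd_c1 {d : ℕ} (b : Fin d → ℝ) {h : (Fin d → ℝ) → ℝ} (hh : ContDiff ℝ 2 h) : ContDiff ℝ 1 (dd d b h) := by
  unfold dd
  exact ContDiff.sum fun i _ => contDiff_const.mul (c1_pd hh i)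

lemma pd_dd {d : ℕ} (b : Fin d → ℝ) {h : (Fin d → ℝ) → ℝ} (hh : ContDiff ℝ 2 h) (j : Fin d) :
    pd d j (dd d b h) = fun x => ∑ l, b l * pd d j (pd d l h) x := by
  unfold dd
  rw [pd_sum _ (fun l _ => ((c1_pd hh l).dif1.const_mul (b l)))]
  ext x
  refine Finset.sum_congr rfl fun l _ => ?_
  rw [pd_const_mul (c1_pd hh l).dif1]

lemma Lap_eq {d : ℕ} (b : Fin d → Fin d → ℝ) {h : (Fin d → ℝ) → ℝ} (hh : ContDiff ℝ 2 h) (x : Fin d → ℝ) :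
    Lap b h x = ∑ j, ∑ l, (∑ i, b i j * b i l) * pd d j (pd d l h) x := by
  unfold Lap
  have : ∀ i, dd d (b i) (dd d (b i) h) x = ∑ j, ∑ l, b i j * b i l * pd d j (pd d l h) x := by
    intro i
    rw [dd]
    refine Finset.sum_congr rfl fun j _ => ?_
    rw [pd_dd (b i) hh j, Finset.mul_sum]
    simp only [mul_assoc]
  simp_rw [this]
  rw [Finset.sum_comm]
  refine Finset.sum_congr rfl fun j _ => ?_
  rw [Finset.sum_comm]
  refine Finset.sum_congr rfl fun l _ => ?_
  rw [Finset.sum_mul]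

lemma SP.c2 {d : ℕ} {f : (Fin d → ℝ) → ℝ} (h : SP d f) : ContDiff ℝ 2 f :=
  contDiff_two_of_pd h.diff fun i => (h.pd i).c1

lemma SP.Lap {d : ℕ} {f : (Fin d → ℝ) → ℝ} (h : SP d f) (b : Fin d → Fin d → ℝ) : SP d (Lap b f) :=
  SP.sum fun i _ => ((h.dd (b i)).dd (b i))

lemma avg_Lap {d : ℕ} {Ω : Type*} [MeasurableSpace Ω] {μ : Measure Ω} [IsProbabilityMeasure μ]
    {Y : Ω → Fin d → ℝ} (hY : Measurable Y) {f : (Fin d → ℝ) → ℝ} (h : SP d f) (b : Fin d → Fin d → ℝ) :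
    Lap b (avg μ Y f) = avg μ Y (Lap b f) := by
  ext x
  rw [Lap_eq b (avg_c2 hY h)]
  have e : Lap b f = fun x => ∑ p : Fin d × Fin d, (∑ i, b i p.1 * b i p.2) * pd d p.1 (pd d p.2 f) x := by
    ext x; rw [Lap_eq b h.c2, Fintype.sum_prod_type]
  rw [e, avg_smul hY _ _ (fun p _ => (h.pd p.2).pd p.1)]
  simp only [Fintype.sum_prod_type]
  simp_rw [avg_pd2 hY h]

lemma S_deriv {d : ℕ} (b : Fin d → Fin d → ℝ) {f : (Fin d → ℝ) → ℝ} (hf : SP d f) (x : Fin d → ℝ) (s : ℝ) :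
    HasDerivAt (fun s => Sop b s f x) (s * Sop b s (Lap b f) x) s := by
  obtain ⟨C, hC0, hC⟩ := hf.bdd
  choose D hD0 hD using fun i => (hf.dd (b i)).bdd
  have hYc : ∀ s : ℝ, Continuous fun z => x + s • Lb b z := fun s => continuous_const.add ((Lb_cont b).const_smul s)
  have key := hasDerivAt_integral_of_dominated_loc_of_deriv_le (μ := gam d) (𝕜 := ℝ)
    (F := fun s z => f (x + s • Lb b z)) (F' := fun s z => ∑ i, z i * dd d (b i) f (x + s • Lb b z))
    (x₀ := s) (s := univ) (bound := fun z => ∑ i, ‖z‖ ^ 1 * D i) univ_mem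
    (Eventually.of_forall fun s => (hf.cont.comp (hYc s)).aestronglyMeasurable)
    (avg_integrable (Ymeas b s) hf.cont hC x) ?_ ?_ ?_ ?_
  · have h2 := key.2
    rw [integral_finsetSum _ (fun i _ => zmul_int b s (hf.dd (b i)).cont (hD i) x i)] at h2
    refine h2.congr_deriv ?_
    simp_rw [S_stein b s (hf.dd (b _)).1 (hf.dd (b _)).c1 x]
    rw [← Finset.mul_sum]
    congr 1
    unfold Sop Lap avg
    rw [integral_finsetSum]
    intro i _
    obtain ⟨E, hE0, hE⟩ := ((hf.dd (b i)).dd (b i)).bdd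
    exact avg_integrable (Ymeas b s) ((hf.dd (b i)).dd (b i)).cont hE x
  · exact (integrable_finsetSum _ (fun i _ => zmul_int b s (hf.dd (b i)).cont (hD i) x i)).aestronglyMeasurable
  · refine ae_of_all _ fun z s _ => (norm_sum_le _ _).trans (Finset.sum_le_sum fun i _ => ?_)
    rw [norm_mul, pow_one]
    exact mul_le_mul (norm_le_pi_norm z i) (hD i _) (norm_nonneg _) (norm_nonneg _)
  · exact integrable_finsetSum _ fun i _ => (gam_norm_int d 1).mul_const _
  · refine ae_of_all _ fun z s _ => ?_
    have h1 : HasDerivAt (fun s : ℝ => x + s • Lb b z) (Lb b z) s := by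
      have := ((hasDerivAt_id s).smul_const (Lb b z)).const_add x
      simpa using this
    refine ((hf.diff _).hasFDerivAt.comp_hasDerivAt s h1).congr_deriv ?_
    rw [fderiv_eq_sum_pd]
    simp only [Lb, dd, Finset.mul_sum, Finset.sum_mul]
    rw [Finset.sum_comm]
    simp only [mul_assoc]

/-- density of the Rayleigh law -/
noncomputable def rw1 (s : ℝ) : ℝ := s * Real.exp (-(s ^ 2 / 2))

lemma rw1_hasDeriv (s : ℝ) : HasDerivAt (fun s : ℝ => - Real.exp (-(s ^ 2 / 2))) (rw1 s) s := by
  have h2 : HasDerivAt (fun x : ℝ => - (x ^ 2 / 2)) (-s) s := by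
    refine (((hasDerivAt_pow 2 s).div_const 2).neg).congr_deriv ?_
    simp
  refine (h2.exp.neg).congr_deriv ?_
  unfold rw1; ring

lemma rw1_tendsto : Tendsto (fun s : ℝ => Real.exp (-(s ^ 2 / 2))) atTop (𝓝 0) := by
  refine Real.tendsto_exp_neg_atTop_nhds_zero.comp ?_
  exact (tendsto_pow_atTop (by norm_num)).atTop_div_const (by norm_num)

lemma rw1_int : IntegrableOn rw1 (Ioi 0) := by
  have h := integrable_mul_exp_neg_mul_sq (b := 1/2) (by norm_num)
  refine (h.congr (ae_of_all _ fun x => ?_)).integrableOn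
  simp only [rw1]; congr 2; ring

lemma rw1_cont : Continuous rw1 := by unfold rw1; fun_prop

lemma rw1_pos {s : ℝ} (hs : s ∈ Ioi (0:ℝ)) : 0 ≤ rw1 s := by
  have : (0:ℝ) < s := hs
  unfold rw1; positivity

lemma rw1_integral : ∫ s in Ioi (0:ℝ), rw1 s = 1 := by
  have := integral_Ioi_of_hasDerivAt_of_tendsto (a := (0:ℝ)) (m := -0)
    (rw1_hasDeriv 0).continuousAt.continuousWithinAt (fun s _ => rw1_hasDeriv s) rw1_int rw1_tendsto.neg
  rw [this]; simp

/-- Rayleigh law -/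
noncomputable def ray : Measure ℝ := (volume.restrict (Ioi 0)).withDensity (fun s => ENNReal.ofReal (rw1 s))

instance : IsProbabilityMeasure ray := by
  constructor
  unfold ray
  rw [withDensity_apply _ MeasurableSet.univ, Measure.restrict_univ,
    ← ofReal_integral_eq_lintegral_ofReal rw1_int, rw1_integral, ENNReal.ofReal_one]
  exact (ae_restrict_iff' measurableSet_Ioi).2 (ae_of_all _ fun s hs => rw1_pos hs)

lemma ray_integral (F : ℝ → ℝ) : ∫ s, F s ∂ray = ∫ s in Ioi (0:ℝ), rw1 s * F s := by
  unfold ray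
  rw [integral_withDensity_eq_integral_toReal_smul (by unfold rw1; fun_prop) (ae_of_all _ fun s => by simp)]
  refine setIntegral_congr_fun measurableSet_Ioi fun s hs => ?_
  simp [ENNReal.toReal_ofReal (rw1_pos hs)]

/-- the resolvent -/
noncomputable def Res {d : ℕ} (b : Fin d → Fin d → ℝ) (f : (Fin d → ℝ) → ℝ) : (Fin d → ℝ) → ℝ :=
  avg (ray.prod (gam d)) (fun p : ℝ × (Fin d → ℝ) => p.1 • Lb b p.2) f

lemma Res_meas {d : ℕ} (b : Fin d → Fin d → ℝ) : Measurable (fun p : ℝ × (Fin d → ℝ) => p.1 • Lb b p.2) :=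
  (continuous_fst.smul ((Lb_cont b).comp continuous_snd)).measurable

lemma Res_eq {d : ℕ} (b : Fin d → Fin d → ℝ) {f : (Fin d → ℝ) → ℝ} (hf : SP d f) (x : Fin d → ℝ) :
    Res b f x = ∫ s in Ioi (0:ℝ), rw1 s * Sop b s f x := by
  obtain ⟨C, hC0, hC⟩ := hf.bdd
  unfold Res avg
  rw [integral_prod _ (avg_integrable (Res_meas b) hf.cont hC x), ray_integral]
  rfl

lemma S_cont {d : ℕ} (b : Fin d → Fin d → ℝ) {f : (Fin d → ℝ) → ℝ} (hf : SP d f) (x : Fin d → ℝ) :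
    Continuous (fun s => Sop b s f x) :=
  continuous_iff_continuousAt.2 fun s => (S_deriv b hf x s).continuousAt

lemma S_int {d : ℕ} (b : Fin d → Fin d → ℝ) {f : (Fin d → ℝ) → ℝ} (hf : SP d f) (x : Fin d → ℝ) :
    IntegrableOn (fun s => rw1 s * Sop b s f x) (Ioi 0) := by
  obtain ⟨C, hC0, hC⟩ := hf.bdd
  have := rw1_int.bdd_mul (f := fun s => Sop b s f x) (c := C) (S_cont b hf x).aestronglyMeasurable
    (ae_of_all _ fun s => avg_bd (Y := fun z => s • Lb b z) (μ := gam d) hC x)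
  exact this.congr (ae_of_all _ fun t => by ring)

lemma Res_solves {d : ℕ} (b : Fin d → Fin d → ℝ) {f : (Fin d → ℝ) → ℝ} (hf : SP d f) (x : Fin d → ℝ) :
    Res b f x - Lap b (Res b f) x = f x := by
  have e : Lap b (Res b f) = Res b (Lap b f) := avg_Lap (Res_meas b) hf b
  rw [e, Res_eq b hf, Res_eq b (hf.Lap b), ← integral_sub (S_int b hf x) (S_int b (hf.Lap b) x)]
  obtain ⟨C, hC0, hC⟩ := hf.bdd
  have hd : ∀ s, HasDerivAt (fun s => - Real.exp (-(s ^ 2 / 2)) * Sop b s f x)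
      (rw1 s * Sop b s f x - rw1 s * Sop b s (Lap b f) x) s := by
    intro s
    refine ((rw1_hasDeriv s).mul (S_deriv b hf x s)).congr_deriv ?_
    unfold rw1; ring
  have := integral_Ioi_of_hasDerivAt_of_tendsto (a := (0:ℝ)) (m := 0)
    (hd 0).continuousAt.continuousWithinAt (fun s _ => hd s)
    ((S_int b hf x).sub (S_int b (hf.Lap b) x)) ?_
  · rw [this]
    simp [Sop, avg]
  · have h1 : Tendsto (fun s : ℝ => Real.exp (-(s ^ 2 / 2)) * C) atTop (𝓝 0) := by
      simpa using rw1_tendsto.mul_const C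
    refine squeeze_zero_norm (fun s => ?_) h1
    rw [norm_mul, norm_neg, Real.norm_of_nonneg (Real.exp_pos _).le]
    gcongr
    exact avg_bd hC x

lemma Res_hol (d : ℕ) {α C0 : ℝ} (h0 : 0 < α) (h1 : α < 1) (hC0 : 0 ≤ C0) :
    ∃ K : ℝ, 0 ≤ K ∧ ∀ (b q : Fin d → Fin d → ℝ), Frame C0 b q →
      ∀ f : (Fin d → ℝ) → ℝ, SP d f → ∀ H, 0 ≤ H → Hol α H f →
        ∀ j l, Hol α (K * H) (pd d j (pd d l (Res b f))) := by
  obtain ⟨K, hK, hKb⟩ := S_pd23 d h0 h1 hC0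
  have h1' : 0 < 1 - α := by linarith
  refine ⟨2 * K / α + d * K / (1 - α), by positivity, ?_⟩
  intro b q hF f hf H hH0 hH j l x y
  rcases eq_or_ne x y with rfl | hxy
  · simp [Real.zero_rpow h0.ne']
  set h := dist x y with hh
  have hh0 : 0 < h := dist_pos.2 hxy
  have hW := (hf.pd l).pd j
  have e : pd d j (pd d l (Res b f)) = Res b (pd d j (pd d l f)) := avg_pd2 (Res_meas b) hf j l
  rw [e, Res_eq b hW, Res_eq b hW, ← integral_sub (S_int b hW x) (S_int b hW y)]
  set W := pd d j (pd d l f)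
  have hle : ∀ s : ℝ, 0 < s → rw1 s ≤ s := fun s hs => by
    unfold rw1
    have : Real.exp (-(s^2/2)) ≤ 1 := Real.exp_le_one_iff.2 (by have := sq_nonneg s; linarith)
    nlinarith
  have hIntgr : IntegrableOn (fun s => rw1 s * Sop b s W x - rw1 s * Sop b s W y) (Ioi 0) :=
    (S_int b hW x).sub (S_int b hW y)
  rw [← Ioc_union_Ioi_eq_Ioi hh0.le, setIntegral_union (by simp) measurableSet_Ioi
    (hIntgr.mono_set Ioc_subset_Ioi_self) (hIntgr.mono_set (Ioi_subset_Ioi hh0.le))]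
  have p1 : ‖∫ s in Ioc 0 h, (rw1 s * Sop b s W x - rw1 s * Sop b s W y)‖ ≤ ∫ s in Ioc 0 h, 2 * K * H * s ^ (α - 1) := by
    refine norm_integral_le_of_norm_le ?_ ((ae_restrict_iff' measurableSet_Ioc).2 (ae_of_all _ fun s hs => ?_))
    · have := (intervalIntegral.intervalIntegrable_rpow' (a := 0) (b := h) (r := α - 1) (by linarith)).const_mul (2 * K * H)
      rwa [intervalIntegrable_iff_integrableOn_Ioc_of_le hh0.le] at this
    · have hs0 : 0 < s := hs.1
      have hb := (hKb b q hF s hs0 f hf H hH0 hH).1 j l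
      have hbx := hb x
      have hby := hb y
      rw [← mul_sub, norm_mul, Real.norm_of_nonneg (rw1_pos hs.1)]
      have t : ‖Sop b s W x - Sop b s W y‖ ≤ 2 * (K * H * s ^ (α - 2)) := by
        refine (norm_sub_le _ _).trans ?_
        simp only [Real.norm_eq_abs]; linarith
      have e3 : s ^ (α - 1) = s * s ^ (α - 2) := by
        rw [← Real.rpow_one_add' hs0.le (by linarith)]; congr 1; ring
      calc rw1 s * ‖Sop b s W x - Sop b s W y‖ ≤ s * (2 * (K * H * s ^ (α - 2))) :=
            mul_le_mul (hle s hs0) t (norm_nonneg _) hs0.le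
        _ = _ := by rw [e3]; ring
  have p2 : ‖∫ s in Ioi h, (rw1 s * Sop b s W x - rw1 s * Sop b s W y)‖ ≤ ∫ s in Ioi h, d * K * H * h * s ^ (α - 2) := by
    refine norm_integral_le_of_norm_le ?_ ((ae_restrict_iff' measurableSet_Ioi).2 (ae_of_all _ fun s hs => ?_))
    · exact (integrableOn_Ioi_rpow_of_lt (by linarith) hh0).const_mul _
    · have hs0 : 0 < s := hh0.trans hs
      have hb := (hKb b q hF s hs0 f hf H hH0 hH).2
      have hc1 : ContDiff ℝ 1 (Sop b s W) := avg_c1 (Ymeas b s) hW.1 hW.c1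
      have t := lip_of_pd hc1.dif1 (fun k => hb k j l) x y
      rw [← mul_sub, norm_mul, Real.norm_of_nonneg (rw1_pos hs0)]
      have e3 : s ^ (α - 2) = s * s ^ (α - 3) := by
        rw [← Real.rpow_one_add' hs0.le (by linarith)]; congr 1; ring
      calc rw1 s * ‖Sop b s W x - Sop b s W y‖ ≤ s * (d * (K * H * s ^ (α - 3)) * h) :=
            mul_le_mul (hle s hs0) t (norm_nonneg _) hs0.le
        _ = _ := by rw [e3]; ring
  have q1 : ∫ s in Ioc 0 h, 2 * K * H * s ^ (α - 1) = 2 * K * H * (h ^ α / α) := by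
    rw [integral_const_mul, ← intervalIntegral.integral_of_le hh0.le, integral_rpow (by left; linarith)]
    simp [Real.zero_rpow h0.ne']
  have q2 : ∫ s in Ioi h, d * K * H * h * s ^ (α - 2) = d * K * H * (h ^ α / (1 - α)) := by
    rw [integral_const_mul, integral_Ioi_rpow_of_lt (by linarith) hh0]
    have : h ^ α = h * h ^ (α - 2 + 1) := by
      rw [← Real.rpow_one_add' hh0.le (by linarith)]; congr 1; ring
    rw [this, show α - 2 + 1 = -(1 - α) by ring, neg_div, div_neg, neg_neg]
    ring
  rw [q1] at p1
  rw [q2] at p2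
  rw [← Real.norm_eq_abs]
  refine (norm_add_le _ _).trans ((add_le_add p1 p2).trans (le_of_eq ?_))
  ring

theorem resolvent_smooth (d : ℕ) {α C0 : ℝ} (h0 : 0 < α) (h1 : α < 1) (hC0 : 0 ≤ C0) :
    ∃ K : ℝ, 0 ≤ K ∧ ∀ (b q : Fin d → Fin d → ℝ), Frame C0 b q →
      ∀ f : (Fin d → ℝ) → ℝ, SP d f → ∀ H M, 0 ≤ H → Hol α H f → Bd M f →
        ∃ g : (Fin d → ℝ) → ℝ, ZPer d g ∧ ContDiff ℝ 2 g ∧ (∀ x, g x - Lap b g x = f x) ∧ Bd M g ∧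
          ∀ j l, Hol α (K * H) (pd d j (pd d l g)) := by
  obtain ⟨K, hK, hKb⟩ := Res_hol d h0 h1 hC0
  refine ⟨K, hK, fun b q hF f hf H M hH0 hH hM => ⟨Res b f, avg_per hf.1, avg_c2 (Res_meas b) hf,
    Res_solves b hf, avg_bd hM, hKb b q hF f hf H hH0 hH⟩⟩

open MeasureTheory Set Filter Topology

lemma line_deriv {d : ℕ} {f : (Fin d → ℝ) → ℝ} (hf : Differentiable ℝ f) (x : Fin d → ℝ) (j : Fin d) (t : ℝ) :
    HasDerivAt (fun t : ℝ => f (x + t • Pi.single j 1)) (pd d j f (x + t • Pi.single j 1)) t := by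
  have h1 : HasDerivAt (fun s : ℝ => x + s • (Pi.single j 1 : Fin d → ℝ)) (Pi.single j 1) t := by
    have := ((hasDerivAt_id t).smul_const (Pi.single j 1 : Fin d → ℝ)).const_add x
    simpa using this
  exact (hf _).hasFDerivAt.comp_hasDerivAt t h1

lemma line_mvt {d : ℕ} {f : (Fin d → ℝ) → ℝ} (hf : Differentiable ℝ f) (x : Fin d → ℝ) (j : Fin d) {h : ℝ} (hh : 0 < h) :
    ∃ t ∈ Ioo 0 h, pd d j f (x + t • Pi.single j 1) * h = f (x + h • Pi.single j 1) - f x := by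
  obtain ⟨t, ht, e⟩ := exists_hasDerivAt_eq_slope (fun t : ℝ => f (x + t • Pi.single j 1)) _ hh
    (continuousOn_of_forall_continuousAt fun t _ => (line_deriv hf x j t).continuousAt)
    (fun t _ => line_deriv hf x j t)
  refine ⟨t, ht, ?_⟩
  rw [e]; simp; field_simp

lemma line_dist {d : ℕ} (x : Fin d → ℝ) (j : Fin d) {t : ℝ} (ht : 0 ≤ t) :
    dist x (x + t • Pi.single j 1) = t := by
  rw [dist_self_add_right, norm_smul, Pi.norm_single]; simp [abs_of_nonneg ht]

lemma interp1 {d : ℕ} {α M H h : ℝ} (h0 : 0 < α) (hH : 0 ≤ H) {f : (Fin d → ℝ) → ℝ} (hf : Differentiable ℝ f)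
    (hM : Bd M f) {j : Fin d} (hj : Hol α H (pd d j f)) (hh : 0 < h) : Bd (H * h ^ α + 2 * M / h) (pd d j f) := by
  intro x
  obtain ⟨t, ht, e⟩ := line_mvt hf x j hh
  have h1 := hj x (x + t • Pi.single j 1)
  rw [line_dist x j ht.1.le] at h1
  have h2 : t ^ α ≤ h ^ α := Real.rpow_le_rpow ht.1.le ht.2.le h0.le
  have h3 : |pd d j f (x + t • Pi.single j 1)| ≤ 2 * M / h := by
    rw [le_div_iff₀ hh]
    rw [← abs_of_pos hh, ← abs_mul, e]
    have a := hM (x + h • Pi.single j 1)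
    have b := hM x
    refine (abs_sub _ _).trans ?_
    linarith
  have h4 : |pd d j f x| ≤ |pd d j f x - pd d j f (x + t • Pi.single j 1)| + |pd d j f (x + t • Pi.single j 1)| := by
    have := abs_add_le (pd d j f x - pd d j f (x + t • Pi.single j 1)) (pd d j f (x + t • Pi.single j 1))
    simpa using this
  nlinarith [mul_le_mul_of_nonneg_left h2 hH]

lemma ZPer.shift {d : ℕ} {f : (Fin d → ℝ) → ℝ} (hp : ZPer d f) (x : Fin d → ℝ) (j : Fin d) :
    f (x + (1:ℝ) • Pi.single j 1) = f x := by
  rw [← hp x (Pi.single j 1)]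
  congr 2; ext i
  by_cases h : i = j
  · subst h; simp
  · simp [h]

lemma rolle_bd {d : ℕ} {α H : ℝ} (h0 : 0 < α) (hH : 0 ≤ H) {f : (Fin d → ℝ) → ℝ} (hp : ZPer d f) (hf : Differentiable ℝ f)
    {j : Fin d} (hj : Hol α H (pd d j f)) : Bd H (pd d j f) := by
  intro x
  obtain ⟨t, ht, e⟩ := line_mvt hf x j one_pos
  rw [hp.shift] at e
  have e' : pd d j f (x + t • Pi.single j 1) = 0 := by linarith
  have h1 := hj x (x + t • Pi.single j 1)
  rw [line_dist x j ht.1.le, e', sub_zero] at h1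
  have h2 : t ^ α ≤ 1 := Real.rpow_le_one ht.1.le ht.2.le h0.le
  nlinarith [mul_le_mul_of_nonneg_left h2 hH]

lemma rolle_bd1 {d : ℕ} {H : ℝ} (hH : 0 ≤ H) {f : (Fin d → ℝ) → ℝ} (hp : ZPer d f) (hf : ContDiff ℝ 2 f)
    {j : Fin d} (hj : Bd H (pd d j (pd d j f))) : Bd H (pd d j f) := by
  intro x
  obtain ⟨t, ht, e⟩ := line_mvt hf.dif2 x j one_pos
  rw [hp.shift] at e
  have e' : pd d j f (x + t • Pi.single j 1) = 0 := by linarith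
  obtain ⟨s, hs, e2⟩ := line_mvt (c1_pd hf j).dif1 x j ht.1
  rw [e', zero_sub] at e2
  have : |pd d j f x| = |pd d j (pd d j f) (x + s • Pi.single j 1)| * t := by
    rw [← abs_neg, ← e2, abs_mul, abs_of_pos ht.1]
  rw [this]
  have := hj (x + s • Pi.single j 1)
  nlinarith [ht.1, ht.2, abs_nonneg (pd d j (pd d j f) (x + s • Pi.single j 1))]

/-- periodic C² functions with controlled Hölder seminorm of the Hessian -/
structure KH (d : ℕ) (α R : ℝ) (f : (Fin d → ℝ) → ℝ) : Prop where
  per : ZPer d f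
  c2 : ContDiff ℝ 2 f
  hol : ∀ i j, Hol α R (pd d i (pd d j f))

lemma KH.bd2 {d : ℕ} {α R : ℝ} {f : (Fin d → ℝ) → ℝ} (h : KH d α R f) (h0 : 0 < α) (hR : 0 ≤ R) (i j : Fin d) :
    Bd R (pd d i (pd d j f)) := rolle_bd h0 hR (h.per.pd j) (c1_pd h.c2 j).dif1 (h.hol i j)

lemma KH.bd1 {d : ℕ} {α R : ℝ} {f : (Fin d → ℝ) → ℝ} (h : KH d α R f) (h0 : 0 < α) (hR : 0 ≤ R) (j : Fin d) :
    Bd R (pd d j f) := rolle_bd1 hR h.per h.c2 (h.bd2 h0 hR j j)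

lemma KH.hol1 {d : ℕ} {α R : ℝ} {f : (Fin d → ℝ) → ℝ} (h : KH d α R f) (h0 : 0 < α) (h1 : α < 1) (hR : 0 ≤ R) (j : Fin d) :
    Hol α ((d + 2) * R) (pd d j f) :=
  hol_of_c1 h0 h1 (c1_pd h.c2 j).dif1 (h.bd1 h0 hR j) (fun i => h.bd2 h0 hR i j)

lemma KH.sub {d : ℕ} {α R R' : ℝ} {f f' : (Fin d → ℝ) → ℝ} (h : KH d α R f) (h' : KH d α R' f') :
    KH d α (R + R') (fun x => f x - f' x) := by
  refine ⟨fun x k => by rw [h.per x k, h'.per x k], h.c2.sub h'.c2, fun i j => ?_⟩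
  rw [pd_sub h.c2.dif2 h'.c2.dif2, pd_sub (c1_pd h.c2 j).dif1 (c1_pd h'.c2 j).dif1]
  intro x y
  have a := h.hol i j x y
  have b := h'.hol i j x y
  have : pd d i (pd d j f) x - pd d i (pd d j f') x - (pd d i (pd d j f) y - pd d i (pd d j f') y)
    = (pd d i (pd d j f) x - pd d i (pd d j f) y) - (pd d i (pd d j f') x - pd d i (pd d j f') y) := by ring
  rw [this]
  refine (abs_sub _ _).trans ?_
  linarith

lemma exists_small {α A η : ℝ} (h0 : 0 < α) (hη : 0 < η) : ∃ h : ℝ, 0 < h ∧ A * h ^ α ≤ η := by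
  have : Tendsto (fun h : ℝ => A * h ^ α) (𝓝[>] 0) (𝓝 0) := by
    have : ContinuousAt (fun h : ℝ => A * h ^ α) 0 :=
      continuousAt_const.mul (Real.continuousAt_rpow_const _ _ (Or.inr h0.le))
    have h2 := this.tendsto
    simp only [Real.zero_rpow h0.ne', mul_zero] at h2
    exact h2.mono_left nhdsWithin_le_nhds
  obtain ⟨h, h1, h2⟩ := ((this.eventually (ge_mem_nhds hη)).and self_mem_nhdsWithin).exists
  exact ⟨h, h2, h1⟩

lemma interp (d : ℕ) {α : ℝ} (h0 : 0 < α) (h1 : α < 1) {R η : ℝ} (hR : 0 ≤ R) (hη : 0 < η) :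
    ∃ δ : ℝ, 0 < δ ∧ ∀ f, KH d α R f → Bd δ f →
      (∀ j, Bd η (pd d j f)) ∧ ∀ i j, Bd η (pd d i (pd d j f)) := by
  have step : ∀ A : ℝ, 0 ≤ A → ∀ η : ℝ, 0 < η → ∃ δ : ℝ, 0 < δ ∧ ∀ f : (Fin d → ℝ) → ℝ, Differentiable ℝ f → Bd δ f →
      ∀ j, Hol α A (pd d j f) → Bd η (pd d j f) := by
    intro A hA η hη
    obtain ⟨h, hh, hs⟩ := exists_small (A := A) h0 (half_pos hη)
    refine ⟨h * η / 4, by positivity, fun f hf hb j hj => (interp1 h0 hA hf hb hj hh).mono ?_⟩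
    have : 2 * (h * η / 4) / h = η / 2 := by field_simp; norm_num
    rw [this]; linarith
  obtain ⟨δ1, hδ1, H1⟩ := step R hR η hη
  obtain ⟨δ2, hδ2, H2⟩ := step ((d + 2) * R) (by positivity) (min δ1 η) (by positivity)
  refine ⟨δ2, hδ2, fun f hf hb => ?_⟩
  have h3 := fun j => H2 f hf.c2.dif2 hb j (hf.hol1 h0 h1 hR j)
  exact ⟨fun j => (h3 j).mono (min_le_right _ _), fun i j =>
    H1 _ (c1_pd hf.c2 j).dif1 ((h3 j).mono (min_le_left _ _)) i (hf.hol i j)⟩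

/-- uniform convergence -/
def UC {d : ℕ} (f : ℕ → (Fin d → ℝ) → ℝ) (g : (Fin d → ℝ) → ℝ) : Prop :=
  ∀ η : ℝ, 0 < η → ∀ᶠ n in atTop, Bd η (fun x => f n x - g x)

/-- uniformly Cauchy -/
def UCau {d : ℕ} (f : ℕ → (Fin d → ℝ) → ℝ) : Prop :=
  ∀ η : ℝ, 0 < η → ∃ N, ∀ n ≥ N, ∀ m ≥ N, Bd η (fun x => f n x - f m x)

lemma UC.pt {d : ℕ} {f : ℕ → (Fin d → ℝ) → ℝ} {g : (Fin d → ℝ) → ℝ} (h : UC f g) (x : Fin d → ℝ) :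
    Tendsto (fun n => f n x) atTop (𝓝 (g x)) := by
  rw [Metric.tendsto_nhds]
  intro η hη
  filter_upwards [h (η / 2) (half_pos hη)] with n hn
  have := hn x
  rw [Real.dist_eq]; simp only at this; linarith

lemma UCau.lim {d : ℕ} {f : ℕ → (Fin d → ℝ) → ℝ} (h : UCau f) : ∃ g, UC f g := by
  have : ∀ x, ∃ y, Tendsto (fun n => f n x) atTop (𝓝 y) := by
    intro x
    refine cauchySeq_tendsto_of_complete (Metric.cauchySeq_iff.2 fun η hη => ?_)
    obtain ⟨N, hN⟩ := h (η / 2) (half_pos hη)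
    refine ⟨N, fun n hn m hm => ?_⟩
    have := hN n hn m hm x
    rw [Real.dist_eq]; simp only at this; linarith
  choose g hg using this
  refine ⟨g, fun η hη => ?_⟩
  obtain ⟨N, hN⟩ := h η hη
  filter_upwards [eventually_ge_atTop N] with n hn x
  have h2 : Tendsto (fun m => |f n x - f m x|) atTop (𝓝 |f n x - g x|) :=
    (tendsto_const_nhds.sub (hg x)).abs
  exact le_of_tendsto h2 (eventually_atTop.2 ⟨N, fun m hm => hN n hn m hm x⟩)

lemma UC.tu {d : ℕ} {f : ℕ → (Fin d → ℝ) → ℝ} {g : (Fin d → ℝ) → ℝ} (h : UC f g) : TendstoUniformly f g atTop := by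
  rw [Metric.tendstoUniformly_iff]
  intro η hη
  filter_upwards [h (η / 2) (half_pos hη)] with n hn x
  have := hn x
  rw [dist_comm, Real.dist_eq]; simp only at this; linarith

lemma uc_c1 {d : ℕ} {f : ℕ → (Fin d → ℝ) → ℝ} {g : (Fin d → ℝ) → ℝ} {F : Fin d → (Fin d → ℝ) → ℝ}
    (hf : ∀ n, ContDiff ℝ 1 (f n)) (hg : UC f g) (hF : ∀ i, UC (fun n => pd d i (f n)) (F i)) :
    ContDiff ℝ 1 g ∧ ∀ i, pd d i g = F i := by
  have hd : ∀ x, HasFDerivAt g (∑ i, F i x • (ContinuousLinearMap.proj (R := ℝ) (φ := fun _ : Fin d => ℝ) i)) x := by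
    intro x
    refine hasFDerivAt_of_tendstoUniformly (l := atTop) (f := f)
      (f' := fun n x => ∑ i, pd d i (f n) x • (ContinuousLinearMap.proj (R := ℝ) (φ := fun _ : Fin d => ℝ) i))
      (g' := fun x => ∑ i, F i x • (ContinuousLinearMap.proj (R := ℝ) (φ := fun _ : Fin d => ℝ) i))
      ?_ ?_ (fun x => hg.pt x) x
    · rw [Metric.tendstoUniformly_iff]
      intro η hη
      set c := ∑ i : Fin d, ‖(ContinuousLinearMap.proj (R := ℝ) (φ := fun _ : Fin d => ℝ) i)‖ with hc
      have hc0 : 0 ≤ c := Finset.sum_nonneg fun i _ => norm_nonneg _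
      have hη' : 0 < η / (c + 1) := by positivity
      have : ∀ᶠ n in atTop, ∀ i, Bd (η / (c + 1)) (fun x => pd d i (f n) x - F i x) :=
        eventually_all.2 fun i => hF i _ hη'
      filter_upwards [this] with n hn x
      rw [dist_comm, dist_eq_norm, ← Finset.sum_sub_distrib]
      simp_rw [← sub_smul]
      refine (norm_sum_le _ _).trans_lt ?_
      calc ∑ i : Fin d, ‖(pd d i (f n) x - F i x) • (ContinuousLinearMap.proj (R := ℝ) (φ := fun _ : Fin d => ℝ) i)‖
          ≤ ∑ i : Fin d, η / (c + 1) * ‖(ContinuousLinearMap.proj (R := ℝ) (φ := fun _ : Fin d => ℝ) i)‖ := by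
            refine Finset.sum_le_sum fun i _ => ?_
            rw [norm_smul]
            gcongr
            exact hn i x
        _ = η / (c + 1) * c := by rw [← Finset.mul_sum]
        _ < η := by
            rw [div_mul_eq_mul_div, div_lt_iff₀ (by positivity)]
            nlinarith
    · intro n x
      have := ((hf n).dif1 x).hasFDerivAt
      rwa [fderiv_eq_sum_proj] at this
  have hp : ∀ i, pd d i g = F i := by
    intro i; ext x
    rw [pd_of_hasFDerivAt (hd x)]
    simp [Pi.single_apply]
  refine ⟨contDiff_one_of_pd (fun x => (hd x).differentiableAt) fun i => ?_, hp⟩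
  rw [hp i]
  exact (hF i).tu.continuous (Eventually.of_forall fun n => c0_pd (hf n) i).frequently

lemma pd_sub2 {d : ℕ} {f g : (Fin d → ℝ) → ℝ} (hf : ContDiff ℝ 2 f) (hg : ContDiff ℝ 2 g) (i j : Fin d) :
    pd d i (pd d j (fun x => f x - g x)) = fun x => pd d i (pd d j f) x - pd d i (pd d j g) x := by
  rw [pd_sub hf.dif2 hg.dif2, pd_sub (c1_pd hf j).dif1 (c1_pd hg j).dif1]

lemma kh_closure {d : ℕ} {α R : ℝ} (h0 : 0 < α) (h1 : α < 1) (hR : 0 ≤ R) {f : ℕ → (Fin d → ℝ) → ℝ}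
    (hf : ∀ n, KH d α R (f n)) (hc : UCau f) :
    ∃ g, KH d α R g ∧ UC f g ∧ (∀ j, UC (fun n => pd d j (f n)) (pd d j g)) ∧
      ∀ i j, UC (fun n => pd d i (pd d j (f n))) (pd d i (pd d j g)) := by
  have hcc : ∀ η : ℝ, 0 < η → ∃ N, ∀ n ≥ N, ∀ m ≥ N, (∀ j, Bd η (fun x => pd d j (f n) x - pd d j (f m) x)) ∧
      ∀ i j, Bd η (fun x => pd d i (pd d j (f n)) x - pd d i (pd d j (f m)) x) := by
    intro η hη
    obtain ⟨δ, hδ, H⟩ := interp d h0 h1 (add_nonneg hR hR) hη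
    obtain ⟨N, hN⟩ := hc δ hδ
    refine ⟨N, fun n hn m hm => ?_⟩
    have := H _ ((hf n).sub (hf m)) (hN n hn m hm)
    refine ⟨fun j => ?_, fun i j => ?_⟩
    · rw [← pd_sub (hf n).c2.dif2 (hf m).c2.dif2]; exact this.1 j
    · rw [← pd_sub2 (hf n).c2 (hf m).c2]; exact this.2 i j
  obtain ⟨g, hg⟩ := hc.lim
  have h1c : ∀ j, UCau (fun n => pd d j (f n)) := fun j η hη => by
    obtain ⟨N, hN⟩ := hcc η hη
    exact ⟨N, fun n hn m hm => (hN n hn m hm).1 j⟩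
  have h2c : ∀ i j, UCau (fun n => pd d i (pd d j (f n))) := fun i j η hη => by
    obtain ⟨N, hN⟩ := hcc η hη
    exact ⟨N, fun n hn m hm => (hN n hn m hm).2 i j⟩
  choose G hG using fun j => (h1c j).lim
  choose W hW using fun i j => (h2c i j).lim
  obtain ⟨g1, g2⟩ := uc_c1 (fun n => (hf n).c2.of21) hg hG
  have hGG := fun j => uc_c1 (fun n => c1_pd (hf n).c2 j) (hG j) (fun i => hW i j)
  have e2 : ∀ i j, pd d i (pd d j g) = W i j := fun i j => by rw [g2 j, (hGG j).2 i]
  refine ⟨g, ⟨fun x k => ?_, ?_, fun i j x y => ?_⟩, hg, fun j => by rw [g2 j]; exact hG j,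
    fun i j => by rw [e2 i j]; exact hW i j⟩
  · refine tendsto_nhds_unique (hg.pt _) ?_
    simpa only [(hf _).per x k] using hg.pt x
  · refine contDiff_two_of_pd g1.dif1 fun i => ?_
    rw [g2 i]; exact (hGG i).1
  · rw [e2 i j]
    have t := (((hW i j).pt x).sub ((hW i j).pt y)).abs
    exact le_of_tendsto t (Eventually.of_forall fun n => (hf n).hol i j x y)

lemma kh_compact {d : ℕ} {α R ρ : ℝ} (h0 : 0 < α) (h1 : α < 1) (hR : 0 ≤ R) {f : ℕ → (Fin d → ℝ) → ℝ}
    (hf : ∀ n, KH d α R (f n)) (hb : ∀ n, Bd ρ (f n)) :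
    ∃ φ : ℕ → ℕ, StrictMono φ ∧ ∃ g, KH d α R g ∧ Bd ρ g ∧ UC (fun n => f (φ n)) g ∧
      (∀ j, UC (fun n => pd d j (f (φ n))) (pd d j g)) ∧
      ∀ i j, UC (fun n => pd d i (pd d j (f (φ n)))) (pd d i (pd d j g)) := by
  have hlip : ∀ n x y, |f n x - f n y| ≤ d * R * dist x y := fun n =>
    lip_of_pd (hf n).c2.dif2 (fun j => (hf n).bd1 h0 hR j)
  let Q := ↥(Icc (0 : Fin d → ℝ) 1)
  have : CompactSpace Q := isCompact_iff_compactSpace.1 isCompact_Icc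
  let F : ℕ → BoundedContinuousFunction Q ℝ := fun n =>
    BoundedContinuousFunction.mkOfCompact ⟨fun x => f n x.1, (hf n).c2.continuous.comp continuous_subtype_val⟩
  have hcomp := BoundedContinuousFunction.arzela_ascoli (Icc (-ρ) ρ) isCompact_Icc (range F) ?_ ?_
  · obtain ⟨G, _, φ, hφ, hG⟩ := hcomp.tendsto_subseq (x := F) (fun n => subset_closure (mem_range_self n))
    have hcau : UCau (fun n => f (φ n)) := by
      intro η hη
      obtain ⟨N, hN⟩ := Metric.cauchySeq_iff.1 hG.cauchySeq η hη
      refine ⟨N, fun n hn m hm x => ?_⟩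
      obtain ⟨k, hk⟩ := exists_cube x
      have h3 := (BoundedContinuousFunction.dist_coe_le_dist (f := F (φ n)) (g := F (φ m)) ⟨_, hk⟩).trans (hN n hn m hm).le
      rw [Real.dist_eq] at h3
      simp only [F, BoundedContinuousFunction.mkOfCompact_apply, ContinuousMap.coe_mk] at h3
      rwa [(hf _).per x k, (hf _).per x k] at h3
    obtain ⟨g, hg, hu, hu1, hu2⟩ := kh_closure h0 h1 hR (fun n => hf (φ n)) hcau
    refine ⟨φ, hφ, g, hg, fun x => ?_, hu, hu1, hu2⟩
    exact le_of_tendsto (hu.pt x).abs (Eventually.of_forall fun n => hb _ x)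
  · rintro _ x ⟨n, rfl⟩
    exact abs_le.1 (hb n x.1)
  · intro x
    rw [Metric.equicontinuousAt_iff]
    intro η hη
    refine ⟨η / (d * R + 1), by positivity, ?_⟩
    rintro y hy ⟨_, n, rfl⟩
    have h3 := hlip n x.1 y.1
    have h4 : dist x.1 y.1 < η / (d * R + 1) := by rw [dist_comm]; exact hy
    rw [lt_div_iff₀ (by positivity)] at h4
    change |f n x.1 - f n y.1| < η
    have : 0 ≤ d * R := by positivity
    nlinarith [dist_nonneg (x := x.1) (y := y.1)]

open MeasureTheory Set Filter Topology

lemma mollify {d : ℕ} {α H M η : ℝ} (h0 : 0 < α) {f : (Fin d → ℝ) → ℝ} (hp : ZPer d f)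
    (hH : Hol α H f) (hM : Bd M f) (hη : 0 < η) :
    ∃ f' : (Fin d → ℝ) → ℝ, SP d f' ∧ Hol α H f' ∧ Bd M f' ∧ Bd η (fun x => f' x - f x) := by
  have hc := hH.continuous h0
  obtain ⟨r, hr, hrs⟩ := exists_small (A := |H|) h0 hη
  let φ : ContDiffBump (0 : Fin d → ℝ) := ⟨r / 2, r, by positivity, by linarith⟩
  let μ : Measure (Fin d → ℝ) := volume.withDensity (fun t => ENNReal.ofReal (φ.normed volume t))
  have hφc : Continuous (φ.normed volume) := φ.continuous_normed
  have hφi : Integrable (φ.normed (volume : Measure (Fin d → ℝ))) := φ.integrable_normed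
  have hμ : IsProbabilityMeasure μ := by
    constructor
    rw [withDensity_apply _ MeasurableSet.univ, Measure.restrict_univ,
      ← ofReal_integral_eq_lintegral_ofReal hφi (ae_of_all _ fun t => φ.nonneg_normed t),
      φ.integral_normed, ENNReal.ofReal_one]
  have hY : Measurable (fun t : Fin d → ℝ => - t) := measurable_neg
  have e : avg μ (fun t => - t) f = convolution (φ.normed volume) f (ContinuousLinearMap.lsmul ℝ ℝ) volume := by
    ext x
    unfold avg convolution
    simp only [μ]
    rw [integral_withDensity_eq_integral_toReal_smul (by fun_prop) (ae_of_all _ fun s => by simp)]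
    congr 1; ext t
    rw [ENNReal.toReal_ofReal (φ.nonneg_normed t)]
    simp [sub_eq_add_neg]
  refine ⟨avg μ (fun t => - t) f, ⟨avg_per hp, ?_⟩, avg_hol hY hc hM hH, avg_bd hM, ?_⟩
  · rw [e]
    exact φ.hasCompactSupport_normed.contDiff_convolution_left _ φ.contDiff_normed hc.locallyIntegrable
  · intro x
    rw [e]
    have := φ.dist_normed_convolution_le (μ := volume) (g := f) (x₀ := x) (ε := η) hc.aestronglyMeasurable ?_
    · simpa [Real.dist_eq] using this
    · intro y hy
      have hy' : dist y x ≤ r := (Metric.mem_ball.1 hy).le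
      refine (hH y x).trans (le_trans ?_ hrs)
      have := Real.rpow_le_rpow dist_nonneg hy' h0.le
      have h3 : 0 ≤ dist y x ^ α := by positivity
      nlinarith [le_abs_self H, abs_nonneg H]

theorem resolventK (d : ℕ) {α C0 : ℝ} (h0 : 0 < α) (h1 : α < 1) (hC0 : 0 ≤ C0) :
    ∃ K : ℝ, 0 ≤ K ∧ ∀ (b q : Fin d → Fin d → ℝ), Frame C0 b q →
      ∀ f : (Fin d → ℝ) → ℝ, ZPer d f → ∀ H M, 0 ≤ H → Hol α H f → Bd M f →
        ∃ g : (Fin d → ℝ) → ℝ, KH d α (K * H) g ∧ (∀ x, g x - Lap b g x = f x) ∧ Bd M g := by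
  obtain ⟨K, hK, hKb⟩ := Res_hol d h0 h1 hC0
  refine ⟨K, hK, fun b q hF f hp H M hH0 hH hM => ?_⟩
  choose F hF1 hF2 hF3 hF4 using fun n : ℕ =>
    mollify h0 hp hH hM (η := 1 / ((n : ℝ) + 1)) (by positivity)
  have hg : ∀ n, KH d α (K * H) (Res b (F n)) := fun n =>
    ⟨avg_per (hF1 n).1, avg_c2 (Res_meas b) (hF1 n), hKb b q hF (F n) (hF1 n) H hH0 (hF2 n)⟩
  have hFc : UC F f := by
    intro η hη
    obtain ⟨N, hN⟩ := exists_nat_one_div_lt hη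
    filter_upwards [eventually_ge_atTop N] with n hn
    refine (hF4 n).mono (le_trans ?_ hN.le)
    have : (N : ℝ) ≤ n := by exact_mod_cast hn
    gcongr
  have hcau : UCau (fun n => Res b (F n)) := by
    intro η hη
    obtain ⟨N, hN⟩ := eventually_atTop.1 (hFc (η / 2) (half_pos hη))
    refine ⟨N, fun n hn m hm x => ?_⟩
    have h2 : Res b (F n) x - Res b (F m) x = avg (ray.prod (gam d)) (fun p : ℝ × (Fin d → ℝ) => p.1 • Lb b p.2)
        (fun x => F n x - F m x) x := by
      unfold Res avg
      rw [integral_sub (avg_integrable (Res_meas b) (hF1 n).cont (hF3 n) x)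
        (avg_integrable (Res_meas b) (hF1 m).cont (hF3 m) x)]
    simp only
    rw [h2]
    refine avg_bd (fun y => ?_) x
    have a := hN n hn y
    have c := hN m hm y
    have : F n y - F m y = (F n y - f y) - (F m y - f y) := by ring
    rw [this]
    refine (abs_sub _ _).trans ?_
    simp only at a c
    linarith
  obtain ⟨g, hgK, hu, hu1, hu2⟩ := kh_closure h0 h1 (by positivity) hg hcau
  refine ⟨g, hgK, fun x => ?_, fun x => ?_⟩
  · have t1 : Tendsto (fun n => Res b (F n) x - Lap b (Res b (F n)) x) atTop (𝓝 (g x - Lap b g x)) := by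
      refine (hu.pt x).sub ?_
      simp_rw [fun n => Lap_eq b (hg n).c2 x, Lap_eq b hgK.c2 x]
      exact tendsto_finsetSum _ fun j _ => tendsto_finsetSum _ fun l _ => ((hu2 j l).pt x).const_mul _
    refine tendsto_nhds_unique t1 ?_
    simp_rw [fun n => Res_solves b (hF1 n) x]
    exact hFc.pt x
  · exact le_of_tendsto (hu.pt x).abs (Eventually.of_forall fun n => avg_bd (hF3 n) x)

open MeasureTheory Set Filter Topology

noncomputable def et (N : ℕ) (j : Fin N) (t : ℝ) : ℝ :=
  expNegInvGlue (Real.cos (2 * Real.pi * (t - (j : ℝ) / N)) - Real.cos (2 * Real.pi / N))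

lemma et_smooth {N : ℕ} (j : Fin N) : ContDiff ℝ ((⊤ : ℕ∞) : WithTop ℕ∞) (et N j) := by
  unfold et
  refine expNegInvGlue.contDiff.comp ?_
  refine ContDiff.sub (Real.contDiff_cos.comp ?_) contDiff_const
  fun_prop

lemma et_nonneg {N : ℕ} (j : Fin N) (t : ℝ) : 0 ≤ et N j t := expNegInvGlue.nonneg _

lemma et_per {N : ℕ} (j : Fin N) (t : ℝ) (k : ℤ) : et N j (t + k) = et N j t := by
  unfold et
  have : 2 * Real.pi * (t + k - (j : ℝ) / N) = 2 * Real.pi * (t - (j : ℝ) / N) + k * (2 * Real.pi) := by ring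
  rw [this, Real.cos_add_int_mul_two_pi]

lemma et_supp {N : ℕ} (hN : 2 ≤ N) (j : Fin N) (t : ℝ) (h : et N j t ≠ 0) :
    ∃ k : ℤ, |t - (j : ℝ) / N - k| < 1 / N := by
  have hNr : (2 : ℝ) ≤ N := by exact_mod_cast hN
  refine ⟨round (t - (j : ℝ) / N), ?_⟩
  set s := t - (j : ℝ) / N with hs
  have h1 : Real.cos (2 * Real.pi / N) < Real.cos (2 * Real.pi * s) := by
    by_contra hh
    push Not at hh
    exact h (expNegInvGlue.zero_of_nonpos (by linarith))
  have h2 : Real.cos (2 * Real.pi * s) = Real.cos (2 * Real.pi * |s - round s|) := by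
    have e : 2 * Real.pi * |s - round s| = |2 * Real.pi * (s - round s)| := by
      rw [abs_mul, abs_of_pos Real.two_pi_pos]
    rw [e, Real.cos_abs]
    have : 2 * Real.pi * (s - round s) = 2 * Real.pi * s - round s * (2 * Real.pi) := by ring
    rw [this, Real.cos_sub_int_mul_two_pi]
  by_contra hh
  push Not at hh
  rw [h2] at h1
  have h3 : |s - round s| ≤ 1 / 2 := abs_sub_round s
  have h4 : Real.cos (2 * Real.pi * |s - round s|) ≤ Real.cos (2 * Real.pi / N) := by
    have hp := Real.pi_pos
    refine Real.cos_le_cos_of_nonneg_of_le_pi (by positivity) (by nlinarith) ?_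
    calc 2 * Real.pi / N = 2 * Real.pi * (1 / N) := by ring
      _ ≤ _ := by gcongr
  linarith

lemma et_exists {N : ℕ} (hN : 2 ≤ N) (t : ℝ) : ∃ j : Fin N, 0 < et N j t := by
  have hNr : (2 : ℝ) ≤ N := by exact_mod_cast hN
  have hNz : (N : ℤ) ≠ 0 := by omega
  set r : ℤ := round (t * N)
  have hr1 := Int.emod_nonneg r hNz
  have hr2 := Int.emod_lt_of_pos r (by omega : (0 : ℤ) < N)
  refine ⟨⟨(r % N).toNat, by omega⟩, ?_⟩
  unfold et
  refine expNegInvGlue.pos_of_pos ?_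
  have e1 : (((r % N).toNat : ℕ) : ℝ) = r - N * ((r / N : ℤ) : ℝ) := by
    have h5 : (((r % N).toNat : ℕ) : ℤ) = r % N := Int.toNat_of_nonneg hr1
    have h6 : (((r % N).toNat : ℕ) : ℤ) = r - N * (r / N) := by
      rw [h5]; exact Int.emod_def r N
    exact_mod_cast congrArg (Int.cast : ℤ → ℝ) h6
  have e2 : 2 * Real.pi * (t - (((r % N).toNat : ℕ) : ℝ) / N) = 2 * Real.pi * (t - r / N) + ((r / N : ℤ) : ℝ) * (2 * Real.pi) := by
    rw [e1]; field_simp; ring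
  simp only
  rw [e2, Real.cos_add_int_mul_two_pi, ← Real.cos_abs, sub_pos]
  have h7 : |t * N - r| ≤ 1 / 2 := abs_sub_round _
  have h8 : |2 * Real.pi * (t - r / N)| = 2 * Real.pi / N * |t * N - r| := by
    rw [← abs_of_pos (by positivity : (0:ℝ) < 2 * Real.pi / N), ← abs_mul]
    congr 1; field_simp
  rw [h8]
  have hp := Real.pi_pos
  have hq : 0 < 2 * Real.pi / N := by positivity
  refine Real.cos_lt_cos_of_nonneg_of_le_pi (by positivity) ?_ (by nlinarith)
  rw [div_le_iff₀ (by linarith)]; nlinarith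

lemma et_card {N : ℕ} (hN : 2 ≤ N) (t : ℝ) : (Finset.univ.filter fun j : Fin N => et N j t ≠ 0).card ≤ 2 := by
  have hNr : (2 : ℝ) ≤ N := by exact_mod_cast hN
  have hNz : (N : ℤ) ≠ 0 := by omega
  set f : ℤ := ⌊t * N⌋
  have key : ∀ j : Fin N, et N j t ≠ 0 → ((j : ℕ) : ℤ) ∈ ({f % N, (f + 1) % N} : Finset ℤ) := by
    intro j hj
    obtain ⟨k, hk⟩ := et_supp hN j t hj
    have h1 : |t * N - ((j : ℕ) + N * k : ℤ)| < 1 := by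
      have : t * N - (((j : ℕ) + N * k : ℤ) : ℝ) = (t - (j : ℝ) / N - k) * N := by push_cast; field_simp; ring
      rw [this, abs_mul, abs_of_pos (by linarith : (0:ℝ) < N)]
      rwa [lt_div_iff₀ (by linarith)] at hk
    have h2 := abs_lt.1 h1
    have h3 : ((j : ℕ) + N * k : ℤ) = f ∨ ((j : ℕ) + N * k : ℤ) = f + 1 := by
      have f1 := Int.floor_le (t * N)
      have f2 := Int.lt_floor_add_one (t * N)
      have a1 : f < ((j : ℕ) + N * k : ℤ) + 1 := by
        have : (f : ℝ) < (((j : ℕ) + N * k : ℤ) : ℝ) + 1 := by linarith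
        exact_mod_cast this
      have a2 : ((j : ℕ) + N * k : ℤ) < f + 2 := by
        have : (((j : ℕ) + N * k : ℤ) : ℝ) < (f : ℝ) + 2 := by
          have : t * N < (f : ℝ) + 1 := f2
          linarith
        exact_mod_cast this
      omega
    have hjl : ((j : ℕ) : ℤ) = ((j : ℕ) + N * k : ℤ) % N := by
      rw [Int.add_mul_emod_self_left, Int.emod_eq_of_lt (by omega) (by have := j.2; omega)]
    simp only [Finset.mem_insert, Finset.mem_singleton]
    rcases h3 with h3 | h3
    · left; rw [hjl, h3]
    · right; rw [hjl, h3]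
  calc _ ≤ ({f % N, (f + 1) % N} : Finset ℤ).card := by
        refine Finset.card_le_card_of_injOn (fun j => ((j : ℕ) : ℤ)) ?_ ?_
        · intro j hj
          exact key j (by simpa using hj)
        · intro a _ b _ h
          simp only at h
          exact Fin.ext (by exact_mod_cast h)
    _ ≤ 2 := Finset.card_le_two

noncomputable def zt (N : ℕ) (j : Fin N) (t : ℝ) : ℝ := et N j t / √(∑ l, et N l t ^ 2)

lemma et_sum_pos {N : ℕ} (hN : 2 ≤ N) (t : ℝ) : 0 < ∑ l, et N l t ^ 2 := by
  obtain ⟨j, hj⟩ := et_exists hN t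
  exact Finset.sum_pos' (fun i _ => by positivity) ⟨j, Finset.mem_univ _, by positivity⟩

lemma zt_smooth {N : ℕ} (hN : 2 ≤ N) (j : Fin N) : ContDiff ℝ ((⊤ : ℕ∞) : WithTop ℕ∞) (zt N j) := by
  unfold zt
  refine (et_smooth j).div ?_ fun t => (Real.sqrt_pos.2 (et_sum_pos hN t)).ne'
  refine ContDiff.sqrt (ContDiff.sum fun l _ => (et_smooth l).pow 2) fun t => (et_sum_pos hN t).ne'

lemma zt_per {N : ℕ} (j : Fin N) (t : ℝ) (k : ℤ) : zt N j (t + k) = zt N j t := by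
  unfold zt; simp only [et_per]

lemma zt_sq {N : ℕ} (hN : 2 ≤ N) (t : ℝ) : ∑ j, zt N j t ^ 2 = 1 := by
  unfold zt
  simp_rw [div_pow, Real.sq_sqrt (et_sum_pos hN t).le]
  rw [← Finset.sum_div, div_self (et_sum_pos hN t).ne']

lemma zt_l1 {N : ℕ} (hN : 2 ≤ N) (t : ℝ) : ∑ j, |zt N j t| ≤ 2 := by
  have h1 : ∀ j, |zt N j t| ≤ if et N j t ≠ 0 then 1 else 0 := by
    intro j
    split_ifs with h
    · have : zt N j t ^ 2 ≤ 1 := by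
        rw [← zt_sq hN t]
        exact Finset.single_le_sum (f := fun j => zt N j t ^ 2) (fun i _ => sq_nonneg _) (Finset.mem_univ j)
      exact (sq_le_one_iff_abs_le_one _).1 this
    · push Not at h
      simp [zt, h]
  refine (Finset.sum_le_sum fun j _ => h1 j).trans ?_
  rw [Finset.sum_boole]
  exact_mod_cast et_card hN t

theorem partition (d N : ℕ) (hN : 2 ≤ N) : ∃ ζ : (Fin d → Fin N) → (Fin d → ℝ) → ℝ,
    (∀ k, SP d (ζ k)) ∧ (∀ x, ∑ k, ζ k x ^ 2 = 1) ∧ (∀ x, ∑ k, |ζ k x| ≤ 2 ^ d) ∧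
    ∀ k x, ζ k x ≠ 0 → ∃ n : Fin d → ℤ,
      dist x ((fun i => ((k i : ℕ) : ℝ) / N) + fun i => (n i : ℝ)) ≤ 1 / N := by
  refine ⟨fun k x => ∏ i, zt N (k i) (x i), fun k => ⟨fun x n => ?_, ?_⟩, fun x => ?_, fun x => ?_, fun k x h => ?_⟩
  · simp [zt_per]
  · refine contDiff_prod fun i _ => (zt_smooth hN _).comp (contDiff_apply ℝ ℝ i)
  · simp_rw [← Finset.prod_pow]
    rw [← Fintype.prod_sum (fun i j => zt N j (x i) ^ 2)]
    simp [zt_sq hN]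
  · simp_rw [Finset.abs_prod]
    rw [← Fintype.prod_sum (fun i j => |zt N j (x i)|)]
    refine (Finset.prod_le_prod (fun i _ => by positivity) fun i _ => zt_l1 hN (x i)).trans ?_
    simp
  · have h1 : ∀ i, et N (k i) (x i) ≠ 0 := by
      intro i hi
      exact h (Finset.prod_eq_zero (Finset.mem_univ i) (by simp [zt, hi]))
    choose n hn using fun i => et_supp hN (k i) (x i) (h1 i)
    refine ⟨n, (dist_pi_le_iff (by positivity)).2 fun i => ?_⟩
    rw [Real.dist_eq]
    simp only [Pi.add_apply]
    rw [← sub_sub]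
    exact (hn i).le

open MeasureTheory Set Filter Topology

/-- the integral over the unit cube -/
noncomputable def IT {d : ℕ} (f : (Fin d → ℝ) → ℝ) : ℝ := ∫ x in Icc (0 : Fin d → ℝ) 1, f x

lemma IT_int {d : ℕ} {f : (Fin d → ℝ) → ℝ} (hf : Continuous f) :
    IntegrableOn f (Icc (0 : Fin d → ℝ) 1) := hf.continuousOn.integrableOn_compact isCompact_Icc

lemma IT_add {d : ℕ} {f g : (Fin d → ℝ) → ℝ} (hf : Continuous f) (hg : Continuous g) :
    IT (fun x => f x + g x) = IT f + IT g := integral_add (IT_int hf) (IT_int hg)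

lemma IT_sub {d : ℕ} {f g : (Fin d → ℝ) → ℝ} (hf : Continuous f) (hg : Continuous g) :
    IT (fun x => f x - g x) = IT f - IT g := integral_sub (IT_int hf) (IT_int hg)

lemma IT_mul {d : ℕ} {f : (Fin d → ℝ) → ℝ} (c : ℝ) :
    IT (fun x => c * f x) = c * IT f := integral_const_mul c f

lemma IT_neg {d : ℕ} {f : (Fin d → ℝ) → ℝ} :
    IT (fun x => - f x) = - IT f := integral_neg f

lemma IT_sum {d : ℕ} {ι : Type*} (s : Finset ι) {f : ι → (Fin d → ℝ) → ℝ} (hf : ∀ i, Continuous (f i)) :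
    IT (fun x => ∑ i ∈ s, f i x) = ∑ i ∈ s, IT (f i) := integral_finsetSum _ fun i _ => IT_int (hf i)

lemma IT_mono {d : ℕ} {f g : (Fin d → ℝ) → ℝ} (hf : Continuous f) (hg : Continuous g) (h : ∀ x, f x ≤ g x) :
    IT f ≤ IT g := setIntegral_mono (IT_int hf) (IT_int hg) h

lemma IT_const {d : ℕ} (c : ℝ) : IT (fun _ : Fin d → ℝ => c) = c := by
  unfold IT
  rw [setIntegral_const]
  simp [Measure.real, Real.volume_Icc_pi]

lemma IT_zero {d : ℕ} {f : (Fin d → ℝ) → ℝ} (hp : ZPer d f) (hf : Continuous f) (h0 : ∀ x, 0 ≤ f x)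
    (h : IT f ≤ 0) (x : Fin d → ℝ) : f x = 0 := by
  have h1 : IT f = 0 := le_antisymm h (setIntegral_nonneg measurableSet_Icc fun x _ => h0 x)
  have h2 : f =ᵐ[volume.restrict (Icc (0 : Fin d → ℝ) 1)] 0 :=
    (setIntegral_eq_zero_iff_of_nonneg_ae (ae_of_all _ h0) (IT_int hf)).1 h1
  have h3 : ∀ y ∈ interior (Icc (0 : Fin d → ℝ) 1), f y = 0 := by
    have h4 : f =ᵐ[volume.restrict (interior (Icc (0 : Fin d → ℝ) 1))] 0 :=
      ae_restrict_of_ae_restrict_of_subset interior_subset h2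
    have := Measure.eqOn_open_of_ae_eq h4 isOpen_interior hf.continuousOn continuousOn_const
    exact this
  have h5 : ∀ y ∈ Icc (0 : Fin d → ℝ) 1, f y = 0 := by
    have hcl : closure (interior (Icc (0 : Fin d → ℝ) 1)) = Icc (0 : Fin d → ℝ) 1 := by
      rw [← pi_univ_Icc, interior_pi_set finite_univ, closure_pi_set]
      simp
    intro y hy
    rw [← hcl] at hy
    exact closure_minimal (fun z hz => h3 z hz) (isClosed_singleton.preimage hf) hy
  obtain ⟨k, hk⟩ := exists_cube x
  have := hp x k
  rw [← this]
  exact h5 _ hk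

lemma IT_pd {d : ℕ} {f : (Fin d → ℝ) → ℝ} (hp : ZPer d f) (hf : ContDiff ℝ 1 f) (i : Fin d) :
    IT (pd d i f) = 0 := by
  obtain _ | n := d
  · exact i.elim0
  have hIntgr := IT_int (c0_pd hf i)
  have key := integral_divergence_of_hasFDerivAt_off_countable' (0 : Fin (n+1) → ℝ) 1 (by intro j; simp)
    (fun j x => if j = i then f x else 0) (fun j x => if j = i then fderiv ℝ f x else 0) ∅ countable_empty
    (fun j => by
      by_cases hj : j = i
      · simp only [hj, if_true]; exact hf.continuous.continuousOn
      · simp only [hj, if_false]; exact continuousOn_const)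
    (fun x _ j => by
      by_cases hj : j = i
      · simp only [hj, if_true]; exact (hf.dif1 x).hasFDerivAt
      · simp only [hj, if_false]; exact hasFDerivAt_const _ _)
    (by
      refine hIntgr.congr_fun (fun x _ => ?_) measurableSet_Icc
      unfold pd
      rw [Finset.sum_eq_single i]
      · simp
      · intro j _ hj; simp [hj]
      · simp)
  unfold IT
  have e : ∀ x, ∑ j, (if j = i then fderiv ℝ f x else 0) (Pi.single j 1) = pd (n+1) i f x := by
    intro x
    unfold pd
    rw [Finset.sum_eq_single i]
    · simp
    · intro j _ hj; simp [hj]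
    · simp
  simp_rw [e] at key
  rw [key]
  refine Finset.sum_eq_zero fun j _ => ?_
  by_cases hj : j = i
  · subst hj
    simp only [if_true, sub_eq_zero]
    refine setIntegral_congr_fun measurableSet_Icc fun x _ => ?_
    simp only [Pi.one_apply, Pi.zero_apply]
    have := hp (j.insertNth 0 x) (Pi.single j 1)
    rw [← this]
    congr 1
    ext l
    refine Fin.succAboveCases j ?_ (fun l => ?_) l
    · simp
    · simp
  · simp [hj]

lemma ibp {d : ℕ} {f g : (Fin d → ℝ) → ℝ} (hp : ZPer d f) (hf : ContDiff ℝ 1 f) (gp : ZPer d g) (hg : ContDiff ℝ 1 g) (i : Fin d) :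
    IT (fun x => pd d i f x * g x) = - IT (fun x => f x * pd d i g x) := by
  have h := IT_pd (f := fun x => f x * g x) (fun x k => by simp only [hp x k, gp x k]) (hf.mul hg) i
  rw [pd_mul hf.dif1 hg.dif1, IT_add] at h
  · linarith
  · exact (c0_pd hf i).mul hg.continuous
  · exact hf.continuous.mul (c0_pd hg i)

open MeasureTheory Set Filter Topology

structure GG (α L : ℝ) (G G' : ℝ → ℝ) : Prop where
  der : ∀ y, HasDerivAt G (G' y) y
  pos : ∀ y, 0 < G' y
  bd : ∀ y, G' y ≤ L
  hol : ∀ x y, |G' x - G' y| ≤ L * |x - y| ^ α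

lemma exists_G {α : ℝ} (h0 : 0 < α) (h1 : α < 1) {g : ℝ → ℝ} (hg : Ghyp α g) (hA2 : A2 g) {a' b' : ℝ}
    (ha' : 0 < a') (hab' : a' ≤ b') : ∃ G G' : ℝ → ℝ, ∃ L p q : ℝ, GG α L G G' ∧
      (∀ y ∈ Icc p q, 0 < G y ∧ g (G y) = y) ∧ ∀ x ∈ Icc a' b', g x ∈ Ioo p q ∧ G (g x) = x := by
  obtain ⟨hmono, hcont, hdiff, hloc⟩ := hg
  obtain ⟨c1, c2, β, hc1, -, hlow, -⟩ := hA2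
  set a := a' / 2 with ha
  set b := 2 * b' with hb
  have ha0 : 0 < a := by positivity
  have hab : a < b := by linarith
  have hsub : Icc a b ⊆ Ioi 0 := fun x hx => lt_of_lt_of_le ha0 hx.1
  obtain ⟨C, hC, hH⟩ := hloc (Icc a b) isCompact_Icc hsub
  let cl : ℝ → ℝ := fun t => max a (min b t)
  have clm : ∀ t, cl t ∈ Icc a b := fun t => ⟨le_max_left _ _, max_le hab.le (min_le_left _ _)⟩
  have clid : ∀ t ∈ Icc a b, cl t = t := fun t ht => by simp only [cl]; rw [min_eq_right ht.2, max_eq_right ht.1]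
  have cllip : ∀ s t, |cl s - cl t| ≤ |s - t| := fun s t => by
    simp only [cl]
    refine (abs_max_sub_max_le_max _ _ _ _).trans ?_
    simp only [sub_self, abs_zero]
    refine max_le (abs_nonneg _) ((abs_min_sub_min_le_max _ _ _ _).trans ?_)
    simp
  let h' : ℝ → ℝ := fun t => deriv g (cl t)
  have h'hol : ∀ s t, |h' s - h' t| ≤ C * |s - t| ^ α := fun s t => by
    refine (hH _ (clm s) _ (clm t)).trans ?_
    rw [Real.dist_eq]
    have := cllip s t
    gcongr
  have h'c : Continuous h' := by
    rw [Metric.continuous_iff]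
    intro s η hη
    obtain ⟨r, hr, hrs⟩ := exists_small (A := C + 1) h0 (half_pos hη)
    refine ⟨r, hr, fun t ht => ?_⟩
    rw [Real.dist_eq] at ht ⊢
    refine (h'hol t s).trans_lt ?_
    have h3 : |t - s| ^ α ≤ r ^ α := Real.rpow_le_rpow (abs_nonneg _) ht.le h0.le
    have h4 : 0 ≤ r ^ α := by positivity
    nlinarith
  have h'pos : ∀ t, 0 < h' t := fun t => by
    have hz : 0 < cl t := hsub (clm t)
    exact lt_of_lt_of_le (by positivity) (hlow _ hz)
  have hcl : ∀ t, h' t = h' (cl t) := fun t => by simp only [h']; rw [clid _ (clm t)]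
  obtain ⟨tm, -, htm⟩ := isCompact_Icc.exists_isMinOn (nonempty_Icc.2 hab.le) (h'c.continuousOn (s := Icc a b))
  set c := h' tm with hc
  have hcpos : 0 < c := h'pos tm
  have hcle : ∀ t, c ≤ h' t := fun t => by rw [hcl t]; exact htm (clm t)
  let h : ℝ → ℝ := fun z => g a + ∫ t in a..z, h' t
  have hder : ∀ z, HasDerivAt h (h' z) z := fun z =>
    (intervalIntegral.integral_hasDerivAt_right (h'c.intervalIntegrable _ _)
      (h'c.stronglyMeasurableAtFilter _ _) h'c.continuousAt).const_add _
  have hgde : ∀ z ∈ Icc a b, HasDerivAt g (deriv g z) z := fun z hz =>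
    (hdiff.differentiableAt (Ioi_mem_nhds (hsub hz))).hasDerivAt
  have heq : ∀ z ∈ Icc a b, h z = g z := fun z hz => by
    have : ∫ t in a..z, h' t = g z - g a := by
      refine intervalIntegral.integral_eq_sub_of_hasDerivAt (fun t ht => ?_) (h'c.intervalIntegrable _ _)
      rw [uIcc_of_le hz.1] at ht
      have ht' : t ∈ Icc a b := ⟨ht.1, ht.2.trans hz.2⟩
      have := hgde t ht'
      simp only [h']; rwa [clid t ht']
    simp only [h, this]; ring
  have hmon : Monotone (fun z => h z - c * z) := by
    refine monotone_of_hasDerivAt_nonneg (f' := fun z => h' z - c) (fun z => ?_) fun z => ?_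
    · exact ((hder z).sub ((hasDerivAt_id z).const_mul c)).congr_deriv (by simp)
    · simpa using hcle z
  have hexp : ∀ x y, c * |x - y| ≤ |h x - h y| := by
    have key : ∀ x y, y ≤ x → c * |x - y| ≤ |h x - h y| := fun x y hxy => by
      have := hmon hxy
      simp only at this
      rw [abs_of_nonneg (by linarith)]
      refine le_trans (by linarith) (le_abs_self _)
    intro x y
    rcases le_total y x with hh | hh
    · exact key x y hh
    · rw [abs_sub_comm x, abs_sub_comm (h x)]; exact key y x hh
  have hcnt : Continuous h := continuous_iff_continuousAt.2 fun z => (hder z).continuousAt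
  have hsurj : Function.Surjective h := by
    refine hcnt.surjective ?_ ?_
    · refine tendsto_atTop_mono' _ (f₁ := fun z => c * z + h 0) ?_ ?_
      · filter_upwards [eventually_ge_atTop 0] with z hz
        have := hmon hz; simp only [mul_zero, sub_zero] at this; linarith
      · exact tendsto_atTop_add_const_right _ _ (tendsto_id.const_mul_atTop hcpos)
    · refine tendsto_atBot_mono' _ (f₁ := fun z => c * z + h 0) ?_ ?_
      · filter_upwards [eventually_le_atBot 0] with z hz
        have := hmon hz; simp only [mul_zero, sub_zero] at this; linarith
      · exact tendsto_atBot_add_const_right _ _ (tendsto_id.const_mul_atBot hcpos)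
  choose G hG using hsurj
  have hinj : ∀ x y, h x = h y → x = y := fun x y hxy => by
    have := hexp x y
    rw [hxy, sub_self, abs_zero] at this
    have h3 : |x - y| ≤ 0 := by nlinarith [abs_nonneg (x - y)]
    exact sub_eq_zero.1 (abs_nonpos_iff.1 h3)
  have hGh : ∀ x, G (h x) = x := fun x => hinj _ _ (hG _)
  have hGlip : ∀ x y, |G x - G y| ≤ c⁻¹ * |x - y| := fun x y => by
    have := hexp (G x) (G y)
    rw [hG, hG] at this
    rwa [inv_mul_eq_div, le_div_iff₀ hcpos, mul_comm]
  have hGc : Continuous G := (LipschitzWith.of_dist_le_mul (K := ⟨c⁻¹, by positivity⟩) fun x y => by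
    rw [Real.dist_eq, Real.dist_eq]; exact hGlip x y).continuous
  refine ⟨G, fun y => (h' (G y))⁻¹, max c⁻¹ (c⁻¹ * c⁻¹ * (C * (c⁻¹) ^ α)), g a, g b, ⟨fun y => ?_, fun y => ?_, fun y => ?_, fun x y => ?_⟩, fun y hy => ?_, fun x hx => ?_⟩
  · exact HasDerivAt.of_local_left_inverse hGc.continuousAt (hder (G y)) (h'pos _).ne' (Eventually.of_forall hG)
  · exact inv_pos.2 (h'pos _)
  · exact le_max_of_le_left (inv_anti₀ hcpos (hcle _))
  · have hx := h'pos (G x)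
    have hy := h'pos (G y)
    have e : (h' (G x))⁻¹ - (h' (G y))⁻¹ = (h' (G x))⁻¹ * (h' (G y))⁻¹ * (h' (G y) - h' (G x)) := by field_simp
    rw [e, abs_mul, abs_of_pos (by positivity)]
    have i1 := inv_anti₀ hcpos (hcle (G x))
    have i2 := inv_anti₀ hcpos (hcle (G y))
    have i3 : |h' (G y) - h' (G x)| ≤ C * ((c⁻¹) ^ α * |x - y| ^ α) := by
      refine (h'hol _ _).trans ?_
      rw [← Real.mul_rpow (by positivity) (abs_nonneg _), abs_sub_comm x y]
      have := hGlip y x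
      gcongr
    calc _ ≤ c⁻¹ * c⁻¹ * (C * ((c⁻¹) ^ α * |x - y| ^ α)) := by gcongr
      _ = c⁻¹ * c⁻¹ * (C * (c⁻¹) ^ α) * |x - y| ^ α := by ring
      _ ≤ _ := by gcongr; exact le_max_right _ _
  · obtain ⟨z, hz, rfl⟩ := intermediate_value_Icc hab.le (hcont.mono fun x hx => mem_Ici.2 (mem_Ioi.1 (hsub hx)).le) hy
    rw [← heq z hz, hGh]
    exact ⟨hsub hz, (heq z hz).symm⟩
  · have hx' : x ∈ Icc a b := ⟨by linarith [hx.1], by linarith [hx.2]⟩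
    refine ⟨⟨hmono (mem_Ici.2 ha0.le) (mem_Ici.2 (hsub hx').le) (by linarith [hx.1]), hmono (mem_Ici.2 (hsub hx').le) (mem_Ici.2 (by linarith)) (by linarith [hx.2])⟩, ?_⟩
    rw [← heq x hx', hGh]

open MeasureTheory Set Filter Topology

lemma frame_at (d : ℕ) {s0 S L B : ℝ} (hs0 : 0 < s0) (hL : 0 ≤ L) (hB : 0 ≤ B) :
    ∃ C0 : ℝ, 0 ≤ C0 ∧ ∀ (s γ : ℝ) (p : Fin d → ℝ), s0 ≤ s → s ≤ S → 0 ≤ γ → γ ≤ L → (∀ i, |p i| ≤ B) →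
      ∃ b q : Fin d → Fin d → ℝ, Frame C0 b q ∧
        ∀ j l, ∑ i, b i j * b i l = (if j = l then s else 0) + γ * p j * p l := by
  have hr0 : 0 < √s0 := Real.sqrt_pos.2 hs0
  refine ⟨√S + L / √s0 * (B * B) + (1 + L / √s0 / √s0 * (B * B)) / √s0, by positivity, fun s γ p hs hS hγ hγL hp => ?_⟩
  set a := √s with ha
  have ha0 : √s0 ≤ a := Real.sqrt_le_sqrt hs
  have hapos : 0 < a := hr0.trans_le ha0
  have haS : a ≤ √S := Real.sqrt_le_sqrt hS
  have has : a ^ 2 = s := Real.sq_sqrt (by linarith)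
  set P := ∑ i, p i * p i with hP
  have hP0 : 0 ≤ P := Finset.sum_nonneg fun i _ => mul_self_nonneg _
  set r := √(a ^ 2 + P * γ) with hr
  have hrr : r ^ 2 = a ^ 2 + P * γ := Real.sq_sqrt (by positivity)
  have hrn : 0 ≤ r := Real.sqrt_nonneg _
  set c := γ / (a + r) with hc
  have hcr : c * (a + r) = γ := by rw [hc]; field_simp
  have hc0 : 0 ≤ c := by positivity
  have hcP : c * P = r - a := by
    have : (a + r) * (c * P) = (a + r) * (r - a) := by
      calc _ = (c * (a + r)) * P := by ring
        _ = γ * P := by rw [hcr]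
        _ = _ := by nlinarith
    exact mul_left_cancel₀ (by positivity) this
  have hcL : c ≤ L / √s0 := by
    rw [hc]; gcongr; linarith
  set c' := c / (a + c * P) with hc'
  have hc'e : c' * (a + c * P) = c := by rw [hc']; field_simp
  have hc'0 : 0 ≤ c' := by positivity
  have hc'L : c' ≤ L / √s0 / √s0 := by
    have : 0 ≤ c * P := by positivity
    rw [hc']; gcongr; linarith
  have hpp : ∀ i j, |p i * p j| ≤ B * B := fun i j => by
    rw [abs_mul]; exact mul_le_mul (hp i) (hp j) (abs_nonneg _) hB
  have hd : ∀ (i j : Fin d) (t : ℝ), 0 ≤ t → |if i = j then t else 0| ≤ t := fun i j t ht => by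
    split_ifs
    · rw [abs_of_nonneg ht]
    · simpa using ht
  refine ⟨fun i j => (if i = j then a else 0) + c * (p i * p j), fun j i => ((if j = i then 1 else 0) - c' * (p j * p i)) / a, ⟨fun i j => ?_, fun j i => ?_, fun j => ?_⟩, fun j l => ?_⟩
  · have h1 : |(if i = j then a else 0) + c * (p i * p j)| ≤ √S + L / √s0 * (B * B) := by
      refine (abs_add_le _ _).trans (add_le_add ((hd i j a hapos.le).trans haS) ?_)
      rw [abs_mul, abs_of_nonneg hc0]
      have := hpp i j
      gcongr
    have h2 : 0 ≤ (1 + L / √s0 / √s0 * (B * B)) / √s0 := by positivity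
    linarith
  · have h1 : |((if j = i then 1 else 0) - c' * (p j * p i)) / a| ≤ (1 + L / √s0 / √s0 * (B * B)) / √s0 := by
      rw [abs_div, abs_of_pos hapos]
      have h3 : |(if j = i then 1 else 0) - c' * (p j * p i)| ≤ 1 + L / √s0 / √s0 * (B * B) := by
        refine (abs_sub _ _).trans (add_le_add (hd j i 1 zero_le_one) ?_)
        rw [abs_mul, abs_of_nonneg hc'0]
        have := hpp j i
        gcongr
      gcongr
    have h2 : 0 ≤ √S + L / √s0 * (B * B) := by positivity
    linarith
  · ext l
    simp only [Finset.sum_apply, Pi.smul_apply, smul_eq_mul]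
    have e : ∀ i, ((if j = i then (1:ℝ) else 0) - c' * (p j * p i)) / a * ((if i = l then a else 0) + c * (p i * p l))
        = (if j = i then ((if i = l then a else 0) + c * (p i * p l)) / a else 0)
          - (if i = l then c' * (p j * p i) else 0) - c' * c / a * p j * p l * (p i * p i) := by
      intro i
      split_ifs <;> field_simp <;> ring
    simp_rw [e]
    rw [Finset.sum_sub_distrib, Finset.sum_sub_distrib, Finset.sum_ite_eq, Finset.sum_ite_eq', ← Finset.mul_sum, ← hP]
    simp only [Finset.mem_univ, if_true]
    have e2 : c * (p j * p l) / a - c' * (p j * p l) - c' * c / a * p j * p l * P = 0 := by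
      have : c * (p j * p l) / a - c' * (p j * p l) - c' * c / a * p j * p l * P = (p j * p l) / a * (c - c' * (a + c * P)) := by
        field_simp; ring
      rw [this, hc'e]; ring
    rw [add_div, add_sub_assoc, add_sub_assoc] 
    have e3 : c * (p j * p l) / a - c' * (p j * p l) - c' * c / a * p j * p l * P = 0 := e2
    rw [sub_sub] at e3 ⊢
    by_cases hjl : j = l
    · subst hjl
      simp; field_simp; field_simp at e3; linarith
    · simp [hjl, Pi.single_apply, Ne.symm hjl]; linarith
  · have e : ∀ i, ((if i = j then a else 0) + c * (p i * p j)) * ((if i = l then a else 0) + c * (p i * p l))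
        = (if i = j then (if i = l then a ^ 2 else 0) + a * c * (p i * p l) else 0)
          + (if i = l then a * c * (p i * p j) else 0) + c ^ 2 * p j * p l * (p i * p i) := by
      intro i
      split_ifs <;> ring
    simp_rw [e]
    rw [Finset.sum_add_distrib, Finset.sum_add_distrib, Finset.sum_ite_eq', Finset.sum_ite_eq', ← Finset.mul_sum, ← hP]
    simp only [Finset.mem_univ, if_true, has]
    have : γ = 2 * a * c + c * (c * P) := by rw [hcP, ← hcr]; ring
    rw [this]; ring

open MeasureTheory Set Filter Topology

section
variable {d : ℕ}

/-- uniform convergence to a bounded limit -/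
def UCB (f : ℕ → (Fin d → ℝ) → ℝ) (g : (Fin d → ℝ) → ℝ) : Prop := UC f g ∧ ∃ C, Bd C g

lemma UCB.const {g : (Fin d → ℝ) → ℝ} {C : ℝ} (h : Bd C g) : UCB (fun _ => g) g :=
  ⟨fun η hη => Eventually.of_forall fun _ x => by simpa using hη.le, C, h⟩

lemma UCB.num {a : ℕ → ℝ} {b : ℝ} (h : Tendsto a atTop (𝓝 b)) : UCB (fun n (_ : Fin d → ℝ) => a n) (fun _ => b) := by
  refine ⟨fun η hη => ?_, |b|, fun x => le_refl _⟩
  filter_upwards [Metric.tendsto_nhds.1 h η hη] with n hn x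
  rw [Real.dist_eq] at hn
  exact hn.le

lemma UCB.add {f f' : ℕ → (Fin d → ℝ) → ℝ} {g g' : (Fin d → ℝ) → ℝ} (h : UCB f g) (h' : UCB f' g') :
    UCB (fun n x => f n x + f' n x) (fun x => g x + g' x) := by
  obtain ⟨h, C, hC⟩ := h
  obtain ⟨h', C', hC'⟩ := h'
  refine ⟨fun η hη => ?_, C + C', fun x => (abs_add_le _ _).trans (add_le_add (hC x) (hC' x))⟩
  filter_upwards [h _ (half_pos hη), h' _ (half_pos hη)] with n h1 h2 x
  have e : f n x + f' n x - (g x + g' x) = (f n x - g x) + (f' n x - g' x) := by ring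
  simp only
  rw [e]
  refine (abs_add_le _ _).trans ?_
  have := h1 x
  have := h2 x
  simp only at *
  linarith

lemma UCB.mul {f f' : ℕ → (Fin d → ℝ) → ℝ} {g g' : (Fin d → ℝ) → ℝ} (h : UCB f g) (h' : UCB f' g') :
    UCB (fun n x => f n x * f' n x) (fun x => g x * g' x) := by
  obtain ⟨h, C, hC⟩ := h
  obtain ⟨h', C', hC'⟩ := h'
  have hC0 := hC.nonneg
  have hC0' := hC'.nonneg
  refine ⟨fun η hη => ?_, C * C', fun x => ?_⟩
  · have hδ : 0 < min 1 (η / (C + C' + 1)) := by positivity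
    filter_upwards [h _ hδ, h' _ hδ] with n h1 h2 x
    have e : f n x * f' n x - g x * g' x = (f n x - g x) * (f' n x - g' x) + (f n x - g x) * g' x + g x * (f' n x - g' x) := by ring
    simp only
    rw [e]
    have k1 := h1 x
    have k2 := h2 x
    simp only at k1 k2
    set δ := min 1 (η / (C + C' + 1))
    have k3 : δ ≤ 1 := min_le_left _ _
    have k4 : δ * (C + C' + 1) ≤ η := by
      have : δ ≤ η / (C + C' + 1) := min_le_right _ _
      rwa [le_div_iff₀ (by positivity)] at this
    calc _ ≤ |f n x - g x| * |f' n x - g' x| + |f n x - g x| * |g' x| + |g x| * |f' n x - g' x| := by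
          refine (abs_add_le _ _).trans (add_le_add ((abs_add_le _ _).trans ?_) ?_) <;> simp [abs_mul]
      _ ≤ δ * 1 + δ * C' + C * δ := by
          have := hC x
          have := hC' x
          have : |f' n x - g' x| ≤ 1 := k2.trans k3
          gcongr
      _ ≤ η := by linarith
  · rw [abs_mul]; exact mul_le_mul (hC x) (hC' x) (abs_nonneg _) hC0

lemma UCB.neg {f : ℕ → (Fin d → ℝ) → ℝ} {g : (Fin d → ℝ) → ℝ} (h : UCB f g) :
    UCB (fun n x => - f n x) (fun x => - g x) := by
  have := (UCB.const (d := d) (g := fun _ => (-1:ℝ)) (C := 1) fun x => by simp).mul h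
  simpa using this

lemma UCB.sub {f f' : ℕ → (Fin d → ℝ) → ℝ} {g g' : (Fin d → ℝ) → ℝ} (h : UCB f g) (h' : UCB f' g') :
    UCB (fun n x => f n x - f' n x) (fun x => g x - g' x) := by
  simpa [sub_eq_add_neg] using h.add h'.neg

lemma UCB.sum {ι : Type*} (s : Finset ι) {f : ι → ℕ → (Fin d → ℝ) → ℝ} {g : ι → (Fin d → ℝ) → ℝ} (h : ∀ i, UCB (f i) (g i)) :
    UCB (fun n x => ∑ i ∈ s, f i n x) (fun x => ∑ i ∈ s, g i x) := by
  classical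
  induction s using Finset.induction_on with
  | empty => simpa using UCB.const (d := d) (g := fun _ => (0:ℝ)) (C := 0) fun x => by simp
  | insert a s ha ih => simpa [Finset.sum_insert ha] using (h a).add ih

lemma UCB.comp {f : ℕ → (Fin d → ℝ) → ℝ} {g : (Fin d → ℝ) → ℝ} (h : UCB f g) {φ : ℝ → ℝ} (hφ : Continuous φ) :
    UCB (fun n x => φ (f n x)) (fun x => φ (g x)) := by
  obtain ⟨h, C, hC⟩ := h
  have hcpt : IsCompact (Icc (-(C + 1)) (C + 1)) := isCompact_Icc
  have hu := hcpt.uniformContinuousOn_of_continuous hφ.continuousOn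
  obtain ⟨B, hB⟩ := hcpt.exists_bound_of_continuousOn hφ.continuousOn
  have hmem : ∀ x, g x ∈ Icc (-(C + 1)) (C + 1) := fun x => by
    have := abs_le.1 (hC x); constructor <;> linarith
  refine ⟨fun η hη => ?_, B, fun x => hB _ (hmem x)⟩
  obtain ⟨δ, hδ, hd⟩ := Metric.uniformContinuousOn_iff.1 hu η hη
  filter_upwards [h (min 1 (δ / 2)) (by positivity)] with n h1 x
  have k := h1 x
  simp only at k
  have k1 : |f n x - g x| ≤ 1 := k.trans (min_le_left _ _)
  have k2 : |f n x - g x| ≤ δ / 2 := k.trans (min_le_right _ _)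
  have := hd (f n x) (by
    have := abs_le.1 (hC x)
    have := abs_le.1 k1
    constructor <;> linarith) (g x) (hmem x) (by rw [Real.dist_eq]; linarith)
  rw [Real.dist_eq] at this
  exact this.le

lemma UCB.IT {f : ℕ → (Fin d → ℝ) → ℝ} {g : (Fin d → ℝ) → ℝ} (h : UCB f g) (hf : ∀ n, Continuous (f n)) (hg : Continuous g) :
    Tendsto (fun n => IT (f n)) atTop (𝓝 (IT g)) := by
  rw [Metric.tendsto_nhds]
  intro η hη
  filter_upwards [h.1 (η / 2) (half_pos hη)] with n hn
  rw [Real.dist_eq, ← IT_sub (hf n) hg]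
  refine lt_of_le_of_lt ?_ (half_lt_self hη)
  rw [abs_le, ← IT_const (d := d) (η / 2), ← IT_neg]
  have hc := (hf n).sub hg
  refine ⟨IT_mono continuous_const.neg hc fun x => ?_, IT_mono hc continuous_const fun x => ?_⟩
  · exact (abs_le.1 (hn x)).1
  · exact (abs_le.1 (hn x)).2

/-- asymptotic bound for the Hölder seminorm -/
def HolS (α : ℝ) (f : ℕ → (Fin d → ℝ) → ℝ) (c : ℝ) : Prop := ∀ η > 0, ∀ᶠ n in atTop, Hol α (c + η) (f n)

lemma Hol.add {α C C' : ℝ} {f g : (Fin d → ℝ) → ℝ} (h : Hol α C f) (h' : Hol α C' g) : Hol α (C + C') (fun x => f x + g x) := by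
  intro x y
  have e : f x + g x - (f y + g y) = (f x - f y) + (g x - g y) := by ring
  simp only
  rw [e, add_mul]
  exact (abs_add_le _ _).trans (add_le_add (h x y) (h' x y))

lemma HolS.add {α c c' : ℝ} {f g : ℕ → (Fin d → ℝ) → ℝ} (h : HolS α f c) (h' : HolS α g c') :
    HolS α (fun n x => f n x + g n x) (c + c') := by
  intro η hη
  filter_upwards [h _ (half_pos hη), h' _ (half_pos hη)] with n h1 h2
  exact (h1.add h2).mono (by linarith)

lemma HolS.mono {α c c' : ℝ} {f : ℕ → (Fin d → ℝ) → ℝ} (h : HolS α f c) (hc : c ≤ c') : HolS α f c' :=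
  fun η hη => (h η hη).mono fun _ hn => Hol.mono hn (by linarith)

lemma Hol.neg {α C : ℝ} {f : (Fin d → ℝ) → ℝ} (h : Hol α C f) : Hol α C (fun x => - f x) := fun x y => by
  simp only
  rw [← neg_sub', abs_neg]; exact h x y

lemma HolS.neg {α c : ℝ} {f : ℕ → (Fin d → ℝ) → ℝ} (h : HolS α f c) : HolS α (fun n x => - f n x) c :=
  fun η hη => (h η hη).mono fun _ hn => Hol.neg hn

lemma HolS.sum {α : ℝ} {ι : Type*} (s : Finset ι) {c : ι → ℝ} {f : ι → ℕ → (Fin d → ℝ) → ℝ} (h : ∀ i, HolS α (f i) (c i)) :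
    HolS α (fun n x => ∑ i ∈ s, f i n x) (∑ i ∈ s, c i) := by
  classical
  induction s using Finset.induction_on with
  | empty =>
    intro η hη
    refine Eventually.of_forall fun n x y => ?_
    simp only [Finset.sum_empty, sub_self, abs_zero]
    positivity
  | insert a s ha ih => simpa [Finset.sum_insert ha] using (h a).add ih

lemma HolS.sum_mul {α b c C : ℝ} (hb : 0 ≤ b) (hc : 0 ≤ c) {κ : Type*} [Fintype κ] {f h : κ → ℕ → (Fin d → ℝ) → ℝ}
    (hf : ∀ᶠ n in atTop, ∀ x, ∑ k, |f k n x| ≤ b) (hfh : ∀ k, ∀ᶠ n in atTop, Hol α C (f k n))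
    (hu : ∀ k, UC (h k) (fun _ => 0)) (hh : ∀ k, HolS α (h k) c) :
    HolS α (fun n x => ∑ k, f k n x * h k n x) (b * c) := by
  intro η hη
  set δ := η / (b + Fintype.card κ * |C| + 1) with hδ
  have hδ0 : 0 < δ := by positivity
  have hδe : δ * (b + Fintype.card κ * |C| + 1) = η := by rw [hδ]; field_simp
  filter_upwards [hf, eventually_all.2 hfh, eventually_all.2 fun k => hu k δ hδ0, eventually_all.2 fun k => hh k δ hδ0] with n h1 h2 h3 h4 x y
  have e : ∑ k, f k n x * h k n x - ∑ k, f k n y * h k n y = ∑ k, (f k n x * (h k n x - h k n y) + h k n y * (f k n x - f k n y)) := by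
    rw [← Finset.sum_sub_distrib]; exact Finset.sum_congr rfl fun k _ => by ring
  simp only
  rw [e]
  have hD : 0 ≤ dist x y ^ α := by positivity
  calc _ ≤ ∑ k, (|f k n x| * ((c + δ) * dist x y ^ α) + δ * (|C| * dist x y ^ α)) := by
        refine (Finset.abs_sum_le_sum_abs _ _).trans (Finset.sum_le_sum fun k _ => (abs_add_le _ _).trans ?_)
        rw [abs_mul, abs_mul]
        have a1 := h4 k x y
        have a2 := h3 k y
        simp only [sub_zero] at a2
        have a3 : |f k n x - f k n y| ≤ |C| * dist x y ^ α := (h2 k x y).trans (by gcongr; exact le_abs_self _)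
        gcongr
    _ = (∑ k, |f k n x|) * ((c + δ) * dist x y ^ α) + Fintype.card κ * (δ * (|C| * dist x y ^ α)) := by
        rw [Finset.sum_add_distrib, ← Finset.sum_mul]; simp
    _ ≤ b * ((c + δ) * dist x y ^ α) + Fintype.card κ * (δ * (|C| * dist x y ^ α)) := by
        gcongr
        exact h1 x
    _ = (b * c + (δ * (b + Fintype.card κ * |C| + 1) - δ)) * dist x y ^ α := by ring
    _ ≤ _ := by
        rw [hδe]; gcongr; linarith

lemma HolS.mul {α b c C : ℝ} (hb : 0 ≤ b) (hc : 0 ≤ c) {f h : ℕ → (Fin d → ℝ) → ℝ}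
    (hf : ∀ᶠ n in atTop, Bd b (f n)) (hfh : ∀ᶠ n in atTop, Hol α C (f n))
    (hu : UC h (fun _ => 0)) (hh : HolS α h c) :
    HolS α (fun n x => f n x * h n x) (b * c) := by
  have := HolS.sum_mul (κ := Unit) hb hc (f := fun _ => f) (h := fun _ => h) (hf.mono fun n hn x => by simpa using hn x) (fun _ => hfh) (fun _ => hu) (fun _ => hh)
  simpa using this

lemma HolS.const {α C : ℝ} {f : (Fin d → ℝ) → ℝ} (h : Hol α C f) : HolS α (fun _ => f) C :=
  fun η hη => Eventually.of_forall fun _ => h.mono (by linarith)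

/-- small in C^1 implies small in Hölder -/
lemma HolS.of_c1 {α : ℝ} (h0 : 0 < α) (h1 : α < 1) {f : ℕ → (Fin d → ℝ) → ℝ} (hp : ∀ n, ZPer d (f n)) (hf : ∀ n, ContDiff ℝ 1 (f n))
    (hu : UC f (fun _ => 0)) (hd : ∀ j, UC (fun n => pd d j (f n)) (fun _ => 0)) : HolS α f 0 := by
  intro η hη
  have hδ : 0 < η / (d + 2) := by positivity
  filter_upwards [hu _ hδ, eventually_all.2 fun j => hd j _ hδ] with n k1 k2
  have e : (d + 2) * (η / (d + 2)) = η := by field_simp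
  have := hol_of_c1 h0 h1 (hf n).dif1 (M := η / (d + 2)) (by simpa using k1) (fun i => by simpa using k2 i)
  rwa [e, ← zero_add η] at this

end

open MeasureTheory Set Filter Topology

noncomputable def Wf (d : ℕ) (ε μ : ℝ) (V u : (Fin d → ℝ) → ℝ) (x : Fin d → ℝ) : ℝ :=
  ε * u x + (1 / 2) * gradSq d u x + μ * V x

noncomputable def Ff (d : ℕ) (G : ℝ → ℝ) (ε μ : ℝ) (V u : (Fin d → ℝ) → ℝ) (x : Fin d → ℝ) : ℝ :=
  ε * G (Wf d ε μ V u x) - ε - divUp d (fun y => G (Wf d ε μ V u y)) u x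

lemma GG.cont {α L : ℝ} {G G' : ℝ → ℝ} (h : GG α L G G') : Continuous G :=
  continuous_iff_continuousAt.2 fun z => (h.der z).continuousAt

lemma GG.cont' {α L : ℝ} {G G' : ℝ → ℝ} (h : GG α L G G') (h0 : 0 < α) : Continuous G' := by
  rw [Metric.continuous_iff]
  intro s η hη
  obtain ⟨r, hr, hrs⟩ := exists_small (A := |L|) h0 (half_pos hη)
  refine ⟨r, hr, fun t ht => ?_⟩
  rw [Real.dist_eq] at ht ⊢
  refine (h.hol t s).trans_lt ?_
  have h3 : |t - s| ^ α ≤ r ^ α := Real.rpow_le_rpow (abs_nonneg _) ht.le h0.le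
  have h5 : 0 ≤ |t - s| ^ α := by positivity
  nlinarith [le_abs_self L, abs_nonneg L]

lemma GG.L0 {α L : ℝ} {G G' : ℝ → ℝ} (h : GG α L G G') : 0 ≤ L := (h.pos 0).le.trans (h.bd 0)

lemma GG.lip {α L : ℝ} {G G' : ℝ → ℝ} (h : GG α L G G') (x y : ℝ) : |G x - G y| ≤ L * |x - y| := by
  have := Convex.norm_image_sub_le_of_norm_hasDerivWithin_le (f := G) (f' := G') (s := univ) (C := L)
    (fun x _ => (h.der x).hasDerivWithinAt) (fun x _ => by rw [Real.norm_eq_abs, abs_of_pos (h.pos x)]; exact h.bd x)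
    convex_univ (mem_univ y) (mem_univ x)
  simpa [Real.norm_eq_abs] using this

lemma GG.smono {α L : ℝ} {G G' : ℝ → ℝ} (h : GG α L G G') : StrictMono G :=
  strictMono_of_hasDerivAt_pos h.der h.pos

lemma GG.c1 {α L : ℝ} {G G' : ℝ → ℝ} (h : GG α L G G') (h0 : 0 < α) : ContDiff ℝ 1 G := by
  rw [contDiff_one_iff_deriv]
  refine ⟨fun x => (h.der x).differentiableAt, ?_⟩
  have : deriv G = G' := funext fun x => (h.der x).deriv
  rw [this]; exact h.cont' h0

section
variable {d : ℕ} {α L ε μ : ℝ} {G G' : ℝ → ℝ} {V u : (Fin d → ℝ) → ℝ}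

lemma gradSq_per (hu : ZPer d u) : ZPer d (gradSq d u) := fun x k => by
  unfold gradSq
  exact Finset.sum_congr rfl fun i _ => by rw [hu.pd i x k]

lemma gradSq_c1 (hu : ContDiff ℝ 2 u) : ContDiff ℝ 1 (gradSq d u) :=
  ContDiff.sum fun i _ => (c1_pd hu i).pow 2

lemma Wf_per (hV : ZPer d V) (hu : ZPer d u) : ZPer d (Wf d ε μ V u) := fun x k => by
  unfold Wf; rw [hu x k, hV x k, gradSq_per hu x k]

lemma Wf_c1 (hV : ContDiff ℝ 1 V) (hu : ContDiff ℝ 2 u) : ContDiff ℝ 1 (Wf d ε μ V u) :=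
  ((contDiff_const.mul hu.of21).add (contDiff_const.mul (gradSq_c1 hu))).add (contDiff_const.mul hV)

lemma pd_Wf (hV : ContDiff ℝ 1 V) (hu : ContDiff ℝ 2 u) (i : Fin d) (x : Fin d → ℝ) :
    pd d i (Wf d ε μ V u) x = ε * pd d i u x + ∑ j, pd d j u x * pd d i (pd d j u) x + μ * pd d i V x := by
  have hg : Differentiable ℝ (gradSq d u) := (gradSq_c1 hu).dif1
  have e : Wf d ε μ V u = fun x => (ε * u x + (1 / 2) * gradSq d u x) + μ * V x := rfl
  have e2 : gradSq d u = fun x => ∑ j, pd d j u x * pd d j u x := by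
    ext x; unfold gradSq; simp_rw [sq]
  have h3 : pd d i (gradSq d u) x = ∑ j, 2 * (pd d j u x * pd d i (pd d j u) x) := by
    rw [e2, pd_sum _ (fun j _ => (c1_pd hu j).dif1.fun_mul (c1_pd hu j).dif1)]
    refine Finset.sum_congr rfl fun j _ => ?_
    rw [pd_mul (c1_pd hu j).dif1 (c1_pd hu j).dif1]; ring
  rw [e, pd_add ((hu.dif2.const_mul ε).fun_add (hg.const_mul _)) (hV.dif1.const_mul μ), pd_add (hu.dif2.const_mul ε) (hg.const_mul _),
    pd_const_mul hu.dif2, pd_const_mul hg, pd_const_mul hV.dif1]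
  simp only
  rw [h3, ← Finset.mul_sum]; ring

lemma pd_G {w : (Fin d → ℝ) → ℝ} (hG : GG α L G G') (hw : ContDiff ℝ 1 w) (i : Fin d) (x : Fin d → ℝ) :
    pd d i (fun x => G (w x)) x = G' (w x) * pd d i w x := by
  have := (hG.der (w x)).comp_hasFDerivAt x (hw.dif1 x).hasFDerivAt
  have h2 := pd_of_hasFDerivAt this i
  simpa [pd, Function.comp_def] using h2

lemma mf_c1 (hG : GG α L G G') (h0 : 0 < α) {w : (Fin d → ℝ) → ℝ} (hw : ContDiff ℝ 1 w) : ContDiff ℝ 1 (fun x => G (w x)) :=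
  (hG.c1 h0).comp hw

lemma Ff_per (hV : ZPer d V) (hu : ZPer d u) : ZPer d (Ff d G ε μ V u) := by
  intro x k
  unfold Ff divUp
  rw [Wf_per hV hu x k]
  congr 1
  refine Finset.sum_congr rfl fun i _ => ?_
  refine ZPer.pd (f := fun y => G (Wf d ε μ V u y) * pd d i u y) (fun y k => ?_) i x k
  simp only
  rw [Wf_per hV hu y k, hu.pd i y k]

lemma flux_c1 (hG : GG α L G G') (h0 : 0 < α) (hV : ContDiff ℝ 1 V) (hu : ContDiff ℝ 2 u) (i : Fin d) :
    ContDiff ℝ 1 (fun y => G (Wf d ε μ V u y) * pd d i u y) :=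
  (mf_c1 hG h0 (Wf_c1 hV hu)).mul (c1_pd hu i)

lemma Ff_cont (hG : GG α L G G') (h0 : 0 < α) (hV : ContDiff ℝ 1 V) (hu : ContDiff ℝ 2 u) : Continuous (Ff d G ε μ V u) := by
  have hW := (Wf_c1 (ε := ε) (μ := μ) hV hu).continuous
  have hGc := hG.cont
  unfold Ff divUp
  refine Continuous.sub (by fun_prop) ?_
  exact continuous_finsetSum _ fun i _ => c0_pd (flux_c1 hG h0 hV hu i) i

noncomputable def aco (d : ℕ) (G G' : ℝ → ℝ) (ε μ : ℝ) (V u : (Fin d → ℝ) → ℝ) (i j : Fin d) (x : Fin d → ℝ) : ℝ :=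
  (if i = j then G (Wf d ε μ V u x) else 0) + G' (Wf d ε μ V u x) * pd d i u x * pd d j u x

noncomputable def cco (d : ℕ) (G G' : ℝ → ℝ) (ε μ : ℝ) (V u : (Fin d → ℝ) → ℝ) (x : Fin d → ℝ) : ℝ :=
  ε * G (Wf d ε μ V u x) - ε - ∑ i, G' (Wf d ε μ V u x) * (ε * pd d i u x + μ * pd d i V x) * pd d i u x

lemma Ff_expand (hG : GG α L G G') (h0 : 0 < α) (hV : ContDiff ℝ 1 V) (hu : ContDiff ℝ 2 u) (x : Fin d → ℝ) :
    Ff d G ε μ V u x = cco d G G' ε μ V u x - ∑ i, ∑ j, aco d G G' ε μ V u i j x * pd d i (pd d j u) x := by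
  have hW := Wf_c1 (ε := ε) (μ := μ) hV hu
  have e : ∀ i, pd d i (fun y => G (Wf d ε μ V u y) * pd d i u y) x =
      G' (Wf d ε μ V u x) * (ε * pd d i u x + μ * pd d i V x) * pd d i u x + ∑ j, aco d G G' ε μ V u i j x * pd d i (pd d j u) x := by
    intro i
    rw [pd_mul (mf_c1 hG h0 hW).dif1 (c1_pd hu i).dif1]
    simp only
    rw [pd_G hG hW, pd_Wf hV hu]
    unfold aco
    simp_rw [add_mul, Finset.sum_add_distrib, ite_mul, zero_mul]
    rw [Finset.sum_ite_eq]
    simp only [Finset.mem_univ, if_true]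
    have : ∑ j, G' (Wf d ε μ V u x) * pd d i u x * pd d j u x * pd d i (pd d j u) x = G' (Wf d ε μ V u x) * pd d i u x * ∑ j, pd d j u x * pd d i (pd d j u) x := by
      rw [Finset.mul_sum]; exact Finset.sum_congr rfl fun j _ => by ring
    rw [this]; ring
  unfold Ff divUp cco
  simp_rw [e, Finset.sum_add_distrib]
  ring

lemma Ff_weak (hG : GG α L G G') (h0 : 0 < α) (hVp : ZPer d V) (hV : ContDiff ℝ 1 V) (hup : ZPer d u) (hu : ContDiff ℝ 2 u)
    {z : (Fin d → ℝ) → ℝ} (hzp : ZPer d z) (hz : ContDiff ℝ 1 z) :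
    IT (fun x => Ff d G ε μ V u x * z x) =
      IT (fun x => G (Wf d ε μ V u x) * (ε * z x + ∑ i, pd d i u x * pd d i z x) - ε * z x) := by
  have hW := (Wf_c1 (ε := ε) (μ := μ) hV hu)
  have hGW := (mf_c1 hG h0 hW).continuous
  have hzc := hz.continuous
  have hfl := fun i => flux_c1 (ε := ε) (μ := μ) hG h0 hV hu i
  have hflp : ∀ i, ZPer d (fun y => G (Wf d ε μ V u y) * pd d i u y) := fun i x k => by
    simp only; rw [Wf_per hVp hup x k, hup.pd i x k]
  have e1 : (fun x => Ff d G ε μ V u x * z x) = fun x => (ε * G (Wf d ε μ V u x) - ε) * z x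
      - ∑ i, pd d i (fun y => G (Wf d ε μ V u y) * pd d i u y) x * z x := by
    ext x; unfold Ff divUp; rw [sub_mul, Finset.sum_mul]
  have e2 : (fun x => G (Wf d ε μ V u x) * (ε * z x + ∑ i, pd d i u x * pd d i z x) - ε * z x) =
      fun x => (ε * G (Wf d ε μ V u x) - ε) * z x + ∑ i, G (Wf d ε μ V u x) * pd d i u x * pd d i z x := by
    ext x
    rw [mul_add, Finset.mul_sum]
    simp_rw [mul_assoc]; ring
  have c1 : ∀ i, Continuous fun x => pd d i (fun y => G (Wf d ε μ V u y) * pd d i u y) x * z x :=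
    fun i => (c0_pd (hfl i) i).mul hzc
  have c2 : ∀ i, Continuous fun x => G (Wf d ε μ V u x) * pd d i u x * pd d i z x :=
    fun i => (hfl i).continuous.mul (c0_pd hz i)
  have c3 : Continuous fun x => (ε * G (Wf d ε μ V u x) - ε) * z x :=
    ((continuous_const.mul hGW).sub continuous_const).mul hzc
  rw [e1, e2, IT_sub c3 (continuous_finsetSum _ fun i _ => c1 i), IT_add c3 (continuous_finsetSum _ fun i _ => c2 i),
    IT_sum _ c1, IT_sum _ c2, sub_eq_add_neg, ← Finset.sum_neg_distrib]
  congr 1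
  refine Finset.sum_congr rfl fun i _ => ?_
  rw [ibp (hflp i) (hfl i) hzp hz i, neg_neg]

/-- the shifted equation -/
lemma Wf_diff {v : (Fin d → ℝ) → ℝ} (hu : ContDiff ℝ 1 u) (hv : ContDiff ℝ 1 v) (t : ℝ) (x : Fin d → ℝ) :
    Wf d ε μ V (fun x => u x + t * v x) x = Wf d ε μ V u x
      + t * (ε * v x + ∑ i, pd d i u x * pd d i v x) + t ^ 2 * (1 / 2 * gradSq d v x) := by
  have e : ∀ i, pd d i (fun x => u x + t * v x) x = pd d i u x + t * pd d i v x := fun i => by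
    rw [pd_add hu.dif1 (hv.dif1.const_mul t), pd_const_mul hv.dif1]
  unfold Wf gradSq
  simp_rw [e]
  have : ∑ i, (pd d i u x + t * pd d i v x) ^ 2 = ∑ i, pd d i u x ^ 2 + 2 * t * ∑ i, pd d i u x * pd d i v x + t ^ 2 * ∑ i, pd d i v x ^ 2 := by
    rw [Finset.mul_sum, Finset.mul_sum, ← Finset.sum_add_distrib, ← Finset.sum_add_distrib]
    exact Finset.sum_congr rfl fun i _ => by ring
  rw [this]; ring

noncomputable def Jf (d : ℕ) (Φ : ℝ → ℝ) (ε μ : ℝ) (V u : (Fin d → ℝ) → ℝ) : ℝ :=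
  IT (fun x => Φ (Wf d ε μ V u x) - ε * u x)

lemma tangent (hG : StrictMono G) {Φ : ℝ → ℝ} (hΦ : ∀ y, HasDerivAt Φ (G y) y) {a b : ℝ} (hab : a ≠ b) :
    G a * (b - a) < Φ b - Φ a := by
  have hc : Continuous Φ := continuous_iff_continuousAt.2 fun z => (hΦ z).continuousAt
  rcases lt_or_gt_of_ne hab with h | h
  · obtain ⟨c, hc1, hc2⟩ := exists_hasDerivAt_eq_slope Φ G h hc.continuousOn fun x _ => hΦ x
    rw [eq_div_iff (by linarith)] at hc2
    rw [← hc2]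
    have := hG hc1.1
    nlinarith
  · obtain ⟨c, hc1, hc2⟩ := exists_hasDerivAt_eq_slope Φ G h hc.continuousOn fun x _ => hΦ x
    rw [eq_div_iff (by linarith)] at hc2
    have := hG hc1.2
    nlinarith

lemma tangent_le (hG : StrictMono G) {Φ : ℝ → ℝ} (hΦ : ∀ y, HasDerivAt Φ (G y) y) (a b : ℝ) :
    G a * (b - a) ≤ Φ b - Φ a := by
  by_cases h : a = b
  · subst h; simp
  · exact (tangent hG hΦ h).le

lemma unique_min (hε : 0 < ε) (hG : GG α L G G') (h0 : 0 < α) {Φ : ℝ → ℝ} (hΦ : ∀ y, HasDerivAt Φ (G y) y)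
    (hVp : ZPer d V) (hV : ContDiff ℝ 1 V) (hup : ZPer d u) (hu : ContDiff ℝ 2 u) (hF : ∀ x, Ff d G ε μ V u x = 0)
    (hm : ∀ x, 0 < G (Wf d ε μ V u x)) {v : (Fin d → ℝ) → ℝ} (hvp : ZPer d v) (hv : ContDiff ℝ 2 v)
    (hJ : Jf d Φ ε μ V (fun x => u x + v x) ≤ Jf d Φ ε μ V u) (x : Fin d → ℝ) : v x = 0 := by
  have hc : Continuous Φ := continuous_iff_continuousAt.2 fun z => (hΦ z).continuousAt
  have hW := (Wf_c1 (ε := ε) (μ := μ) hV hu).continuous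
  have hWv := (Wf_c1 (ε := ε) (μ := μ) hV (hu.add hv)).continuous
  have hGW := hG.cont.comp hW
  have hWd : ∀ x, Wf d ε μ V (fun x => u x + v x) x = Wf d ε μ V u x + (ε * v x + ∑ i, pd d i u x * pd d i v x) + 1 / 2 * gradSq d v x := fun x => by
    have := Wf_diff (ε := ε) (μ := μ) (V := V) hu.of21 hv.of21 1 x
    simpa using this
  have hgc : Continuous (gradSq d v) := (gradSq_c1 hv).continuous
  have hweak := Ff_weak (ε := ε) (μ := μ) hG h0 hVp hV hup hu hvp hv.of21
  simp only [hF, zero_mul] at hweak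
  rw [IT_const] at hweak
  set W := Wf d ε μ V u with hWdef
  set W1 := Wf d ε μ V (fun x => u x + v x) with hW1
  set E : (Fin d → ℝ) → ℝ := fun x => G (W x) * (ε * v x + ∑ i, pd d i u x * pd d i v x) - ε * v x with hE
  have hEc : Continuous E := by
    have c1 : Continuous fun x => ∑ i, pd d i u x * pd d i v x :=
      continuous_finsetSum _ fun i _ => (c0_pd hu.of21 i).mul (c0_pd hv.of21 i)
    have c2 := hv.continuous
    simp only [hE]
    exact (hGW.mul ((continuous_const.mul c2).add c1)).sub (continuous_const.mul c2)
  set D : (Fin d → ℝ) → ℝ := fun x => (Φ (W1 x) - Φ (W x) - G (W x) * (W1 x - W x)) + G (W x) * (1 / 2 * gradSq d v x) with hD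
  have hDc : Continuous D := by
    have := hc.comp hW
    have := hc.comp hWv
    exact (((hc.comp hWv).sub (hc.comp hW)).sub (hGW.mul (hWv.sub hW))).add (hGW.mul (continuous_const.mul hgc))
  have hD0 : ∀ x, 0 ≤ D x := fun x => by
    have h1 := tangent_le hG.smono hΦ (W x) (W1 x)
    have h2 : 0 ≤ gradSq d v x := Finset.sum_nonneg fun i _ => sq_nonneg _
    have h3 := hm x
    have : 0 ≤ G (W x) * (1 / 2 * gradSq d v x) := by positivity
    simp only [hD]; linarith
  have hDp : ZPer d D := fun x k => by
    simp only [hD, hWdef, hW1]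
    rw [Wf_per hVp hup x k, Wf_per (u := fun x => u x + v x) hVp (fun x k => by simp only [hup x k, hvp x k]) x k, gradSq_per hvp x k]
  have hid : IT D = Jf d Φ ε μ V (fun x => u x + v x) - Jf d Φ ε μ V u := by
    have k1 : Continuous fun x => Φ (W1 x) - ε * (u x + v x) := (hc.comp hWv).sub (continuous_const.mul (hu.continuous.add hv.continuous))
    have k2 : Continuous fun x => Φ (W x) - ε * u x := (hc.comp hW).sub (continuous_const.mul hu.continuous)
    have : IT D + IT E = Jf d Φ ε μ V (fun x => u x + v x) - Jf d Φ ε μ V u := by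
      unfold Jf
      rw [← IT_sub k1 k2, ← IT_add hDc hEc]
      congr 1; ext x
      simp only [hD, hE]
      rw [hWd x]; ring
    linarith
  have hz := IT_zero hDp hDc hD0 (by linarith) x
  have h1 := tangent_le hG.smono hΦ (W x) (W1 x)
  have h2 : 0 ≤ gradSq d v x := Finset.sum_nonneg fun i _ => sq_nonneg _
  have h3 := hm x
  have h4 : 0 ≤ G (W x) * (1 / 2 * gradSq d v x) := by positivity
  have h5 : W x = W1 x := by
    by_contra hne
    have := tangent hG.smono hΦ hne
    simp only [hD] at hz; linarith
  have h6 : gradSq d v x = 0 := by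
    simp only [hD, ← h5] at hz
    have : G (W x) * (1 / 2 * gradSq d v x) = 0 := by linarith
    rcases mul_eq_zero.1 this with h | h
    · exact absurd h h3.ne'
    · linarith
  have h7 : ∀ i, pd d i v x = 0 := fun i => by
    have := (Finset.sum_eq_zero_iff_of_nonneg (fun i _ => sq_nonneg _)).1 h6 i (Finset.mem_univ i)
    simpa using this
  have h8 := hWd x
  simp only [h6, h7, mul_zero, Finset.sum_const_zero, add_zero] at h8
  have : ε * v x = 0 := by linarith
  rcases mul_eq_zero.1 this with h | h
  · exact absurd h hε.ne'
  · exact h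

lemma var_ineq (hG : GG α L G G') (h0 : 0 < α) {Φ : ℝ → ℝ} (hΦ : ∀ y, HasDerivAt Φ (G y) y)
    (hVp : ZPer d V) (hV : ContDiff ℝ 1 V) (hup : ZPer d u) (hu : ContDiff ℝ 2 u)
    {z : (Fin d → ℝ) → ℝ} (hzp : ZPer d z) (hz : ContDiff ℝ 2 z)
    (hJ : ∀ t : ℝ, 0 < t → t ≤ 1 → Jf d Φ ε μ V u ≤ Jf d Φ ε μ V (fun x => u x + t * z x)) :
    0 ≤ IT (fun x => Ff d G ε μ V u x * z x) := by
  have hc : Continuous Φ := continuous_iff_continuousAt.2 fun z => (hΦ z).continuousAt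
  have hW := (Wf_c1 (ε := ε) (μ := μ) hV hu).continuous
  have hWt : ∀ t : ℝ, Continuous (Wf d ε μ V (fun x => u x + t * z x)) := fun t =>
    (Wf_c1 (ε := ε) (μ := μ) hV (hu.add (contDiff_const.mul hz))).continuous
  have hGW := hG.cont.comp hW
  have hWd := fun t x => Wf_diff (ε := ε) (μ := μ) (V := V) hu.of21 hz.of21 t x
  have hQc : Continuous (fun x => 1 / 2 * gradSq d z x) := continuous_const.mul (gradSq_c1 hz).continuous
  rw [Ff_weak (ε := ε) (μ := μ) hG h0 hVp hV hup hu hzp hz.of21]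
  set W := Wf d ε μ V u with hWdef
  set E : (Fin d → ℝ) → ℝ := fun x => ε * z x + ∑ i, pd d i u x * pd d i z x with hE
  set Q : (Fin d → ℝ) → ℝ := fun x => 1 / 2 * gradSq d z x with hQ
  have hEc : Continuous E := by
    have c1 : Continuous fun x => ∑ i, pd d i u x * pd d i z x :=
      continuous_finsetSum _ fun i _ => (c0_pd hu.of21 i).mul (c0_pd hz.of21 i)
    exact (continuous_const.mul hz.continuous).add c1
  set I := IT (fun x => G (W x) * E x - ε * z x) with hI
  set T : (Fin d → ℝ) → ℝ := fun x => G (W x) * Q x + L * (|E x| + |Q x|) ^ 2 with hT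
  have hTc : Continuous T := (hGW.mul hQc).add (continuous_const.mul ((hEc.abs.add hQc.abs).pow 2))
  have hIc : Continuous (fun x => G (W x) * E x - ε * z x) := (hGW.mul hEc).sub (continuous_const.mul hz.continuous)
  have key : ∀ t : ℝ, 0 < t → t ≤ 1 → 0 ≤ I + t * IT T := by
    intro t ht ht1
    have h1 : 0 ≤ Jf d Φ ε μ V (fun x => u x + t * z x) - Jf d Φ ε μ V u := sub_nonneg.2 (hJ t ht ht1)
    have k1 : Continuous fun x => Φ (Wf d ε μ V (fun x => u x + t * z x) x) - ε * (u x + t * z x) :=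
      (hc.comp (hWt t)).sub (continuous_const.mul (hu.continuous.add (continuous_const.mul hz.continuous)))
    have k2 : Continuous fun x => Φ (W x) - ε * u x := (hc.comp hW).sub (continuous_const.mul hu.continuous)
    unfold Jf at h1
    rw [← IT_sub k1 k2] at h1
    have h2 : IT (fun x => Φ (Wf d ε μ V (fun x => u x + t * z x) x) - ε * (u x + t * z x) - (Φ (W x) - ε * u x))
        ≤ IT (fun x => t * (G (W x) * E x - ε * z x) + t ^ 2 * T x) := by
      refine IT_mono (k1.sub k2) ((continuous_const.mul hIc).add (continuous_const.mul hTc)) fun x => ?_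
      have a1 := tangent_le hG.smono hΦ (Wf d ε μ V (fun x => u x + t * z x) x) (W x)
      rw [hWd t x] at a1 ⊢
      have e : W x + t * E x + t ^ 2 * Q x = W x + (t * E x + t ^ 2 * Q x) := by ring
      rw [e] at a1 ⊢
      set D := t * E x + t ^ 2 * Q x with hDD
      have a2 : (G (W x + D) - G (W x)) * D ≤ L * D ^ 2 := by
        refine (le_abs_self _).trans ?_
        rw [abs_mul]
        have := hG.lip (W x + D) (W x)
        rw [add_sub_cancel_left] at this
        calc _ ≤ L * |D| * |D| := by gcongr
          _ = L * D ^ 2 := by rw [mul_assoc, abs_mul_abs_self, sq]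
      have a3 : D ^ 2 ≤ t ^ 2 * (|E x| + |Q x|) ^ 2 := by
        rw [← mul_pow, ← sq_abs D]
        have : |D| ≤ t * (|E x| + |Q x|) := by
          rw [hDD]
          refine (abs_add_le _ _).trans ?_
          rw [abs_mul, abs_mul, abs_of_pos ht, abs_of_pos (by positivity : 0 < t ^ 2)]
          have h5 := abs_nonneg (Q x)
          have h6 : t ^ 2 ≤ t := by nlinarith
          have h7 := mul_le_mul_of_nonneg_right h6 h5
          linarith
        gcongr
      have a4 := mul_le_mul_of_nonneg_left a3 hG.L0
      simp only [hT]
      nlinarith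
    rw [IT_add (f := fun x => t * (G (W x) * E x - ε * z x)) (g := fun x => t ^ 2 * T x) (continuous_const.mul hIc) (continuous_const.mul hTc), IT_mul, IT_mul] at h2
    have h3 : 0 ≤ t * (I + t * IT T) := by
      have : t * (I + t * IT T) = t * I + t ^ 2 * IT T := by ring
      rw [this]; linarith
    exact nonneg_of_mul_nonneg_right h3 ht
  have hlim : Tendsto (fun t : ℝ => I + t * IT T) (𝓝[>] 0) (𝓝 (I + 0 * IT T)) := by
    refine Tendsto.mono_left ?_ nhdsWithin_le_nhds
    exact (continuous_const.add (continuous_id.mul continuous_const)).tendsto 0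
  rw [zero_mul, add_zero] at hlim
  refine ge_of_tendsto hlim ?_
  filter_upwards [Ioc_mem_nhdsGT (zero_lt_one (α := ℝ))] with t ht
  exact key t ht.1 ht.2

end

open MeasureTheory Set Filter Topology

section
variable {d : ℕ} {α L ε μ : ℝ} {G G' : ℝ → ℝ} {V u : (Fin d → ℝ) → ℝ}

lemma UC.ucb {f : ℕ → (Fin d → ℝ) → ℝ} {g : (Fin d → ℝ) → ℝ} (h : UC f g) (hp : ZPer d g) (hc : Continuous g) : UCB f g := by
  obtain ⟨C, -, hC⟩ := hp.bounded hc
  exact ⟨h, C, hC⟩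

lemma ZPer.ucb {g : (Fin d → ℝ) → ℝ} (hp : ZPer d g) (hc : Continuous g) : UCB (fun _ => g) g := by
  obtain ⟨C, -, hC⟩ := hp.bounded hc
  exact UCB.const hC

lemma pd_add' {v : (Fin d → ℝ) → ℝ} (hu : ContDiff ℝ 1 u) (hv : ContDiff ℝ 1 v) (i : Fin d) :
    pd d i (fun x => u x + v x) = fun x => pd d i u x + pd d i v x := pd_add hu.dif1 hv.dif1 i

/-- convergence data -/
structure Cv (d : ℕ) (V u : (Fin d → ℝ) → ℝ) (vn : ℕ → (Fin d → ℝ) → ℝ) (v : (Fin d → ℝ) → ℝ) (μn : ℕ → ℝ) (μ : ℝ) : Prop where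
  Vp : ZPer d V
  Vc : ContDiff ℝ 1 V
  up : ZPer d u
  uc : ContDiff ℝ 2 u
  vnp : ∀ n, ZPer d (vn n)
  vnc : ∀ n, ContDiff ℝ 2 (vn n)
  vp : ZPer d v
  vc : ContDiff ℝ 2 v
  c0 : UC vn v
  c1 : ∀ i, UC (fun n => pd d i (vn n)) (pd d i v)
  cμ : Tendsto μn atTop (𝓝 μ)

variable {vn : ℕ → (Fin d → ℝ) → ℝ} {v : (Fin d → ℝ) → ℝ} {μn : ℕ → ℝ}

lemma Cv.uu (h : Cv d V u vn v μn μ) : UCB (fun n x => u x + vn n x) (fun x => u x + v x) :=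
  (h.up.ucb h.uc.continuous).add (h.c0.ucb h.vp h.vc.continuous)

lemma Cv.du (h : Cv d V u vn v μn μ) (i : Fin d) : UCB (fun n => pd d i (fun x => u x + vn n x)) (pd d i (fun x => u x + v x)) := by
  rw [pd_add' h.uc.of21 h.vc.of21]
  simp_rw [fun n => pd_add' h.uc.of21 (h.vnc n).of21 i]
  exact ((h.up.pd i).ucb (c0_pd h.uc.of21 i)).add ((h.c1 i).ucb (h.vp.pd i) (c0_pd h.vc.of21 i))

lemma Cv.W (h : Cv d V u vn v μn μ) : UCB (fun n => Wf d ε (μn n) V (fun x => u x + vn n x)) (Wf d ε μ V (fun x => u x + v x)) := by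
  unfold Wf gradSq
  simp_rw [sq]
  exact (((UCB.num tendsto_const_nhds).mul h.uu).add ((UCB.num tendsto_const_nhds).mul (UCB.sum _ fun i => (h.du i).mul (h.du i)))).add
    ((UCB.num h.cμ).mul (h.Vp.ucb h.Vc.continuous))

lemma Cv.a (h : Cv d V u vn v μn μ) (hG : GG α L G G') (h0 : 0 < α) (i j : Fin d) :
    UCB (fun n => aco d G G' ε (μn n) V (fun x => u x + vn n x) i j) (aco d G G' ε μ V (fun x => u x + v x) i j) := by
  unfold aco
  refine UCB.add ?_ (((h.W.comp (hG.cont' h0)).mul (h.du i)).mul (h.du j))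
  split_ifs
  · exact h.W.comp hG.cont
  · exact UCB.num tendsto_const_nhds

lemma Cv.c (h : Cv d V u vn v μn μ) (hG : GG α L G G') (h0 : 0 < α) :
    UCB (fun n => cco d G G' ε (μn n) V (fun x => u x + vn n x)) (cco d G G' ε μ V (fun x => u x + v x)) := by
  unfold cco
  refine UCB.sub (UCB.sub ((UCB.num tendsto_const_nhds).mul (h.W.comp hG.cont)) (UCB.num tendsto_const_nhds)) (UCB.sum _ fun i => ?_)
  exact ((h.W.comp (hG.cont' h0)).mul (((UCB.num tendsto_const_nhds).mul (h.du i)).add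
    ((UCB.num h.cμ).mul ((h.Vp.pd i).ucb (c0_pd h.Vc i))))).mul (h.du i)

lemma Cv.J (h : Cv d V u vn v μn μ) {Φ : ℝ → ℝ} (hΦ : Continuous Φ) :
    Tendsto (fun n => Jf d Φ ε (μn n) V (fun x => u x + vn n x)) atTop (𝓝 (Jf d Φ ε μ V (fun x => u x + v x))) := by
  unfold Jf
  refine UCB.IT ((h.W.comp hΦ).sub ((UCB.num tendsto_const_nhds).mul h.uu)) (fun n => ?_) ?_
  · exact (hΦ.comp (Wf_c1 h.Vc (h.uc.add (h.vnc n))).continuous).sub (continuous_const.mul (h.uc.add (h.vnc n)).continuous)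
  · exact (hΦ.comp (Wf_c1 h.Vc (h.uc.add h.vc)).continuous).sub (continuous_const.mul (h.uc.add h.vc).continuous)

lemma exists_min {R ρ : ℝ} (h0 : 0 < α) (h1 : α < 1) (hR : 0 ≤ R) (hρ : 0 ≤ ρ) (hG : GG α L G G') {Φ : ℝ → ℝ} (hΦ : ∀ y, HasDerivAt Φ (G y) y)
    (hVp : ZPer d V) (hV : ContDiff ℝ 1 V) (hup : ZPer d u) (hu : ContDiff ℝ 2 u) :
    ∃ v, KH d α R v ∧ Bd ρ v ∧ ∀ v', KH d α R v' → Bd ρ v' →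
      Jf d Φ ε μ V (fun x => u x + v x) ≤ Jf d Φ ε μ V (fun x => u x + v' x) := by
  have hc : Continuous Φ := continuous_iff_continuousAt.2 fun z => (hΦ z).continuousAt
  set S : Set ℝ := (fun v => Jf d Φ ε μ V (fun x => u x + v x)) '' {v | KH d α R v ∧ Bd ρ v} with hS
  have hzero : KH d α R (fun _ => 0) := by
    refine ⟨fun x k => rfl, contDiff_const, fun i j x y => ?_⟩
    rw [pd_const, pd_const]; simp; positivity
  have hne : S.Nonempty := ⟨_, fun _ => 0, ⟨hzero, fun x => by simpa using hρ⟩, rfl⟩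
  have hbdd : BddBelow S := by
    by_contra hb
    have : ∀ n : ℕ, ∃ v, (KH d α R v ∧ Bd ρ v) ∧ Jf d Φ ε μ V (fun x => u x + v x) < - n := by
      intro n
      by_contra hn
      push Not at hn
      refine hb ⟨-n, ?_⟩
      rintro _ ⟨v, hv, rfl⟩
      exact hn v hv
    choose f hf hfn using this
    obtain ⟨φ, hφ, g, hg, hgρ, c0, c1, -⟩ := kh_compact h0 h1 hR (fun n => (hf n).1) (fun n => (hf n).2)
    have cv : Cv d V u (fun n => f (φ n)) g (fun _ => μ) μ :=
      ⟨hVp, hV, hup, hu, fun n => (hf _).1.per, fun n => (hf _).1.c2, hg.per, hg.c2, c0, c1, tendsto_const_nhds⟩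
    have t := cv.J (ε := ε) hc
    have t2 : Tendsto (fun n => Jf d Φ ε μ V (fun x => u x + f (φ n) x)) atTop atBot := by
      refine tendsto_atBot_mono (fun n => (hfn (φ n)).le) ?_
      exact tendsto_neg_atTop_atBot.comp (tendsto_natCast_atTop_atTop.comp hφ.tendsto_atTop)
    exact not_tendsto_nhds_of_tendsto_atBot t2 _ t
  obtain ⟨s, -, hs, hsS⟩ := exists_seq_tendsto_sInf hne hbdd
  choose f hf hfs using hsS
  obtain ⟨φ, hφ, g, hg, hgρ, c0, c1, -⟩ := kh_compact h0 h1 hR (fun n => (hf n).1) (fun n => (hf n).2)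
  have cv : Cv d V u (fun n => f (φ n)) g (fun _ => μ) μ :=
    ⟨hVp, hV, hup, hu, fun n => (hf _).1.per, fun n => (hf _).1.c2, hg.per, hg.c2, c0, c1, tendsto_const_nhds⟩
  have t := cv.J (ε := ε) hc
  have t2 : Tendsto (fun n => Jf d Φ ε μ V (fun x => u x + f (φ n) x)) atTop (𝓝 (sInf S)) := by
    have : (fun n => Jf d Φ ε μ V (fun x => u x + f (φ n) x)) = fun n => s (φ n) := funext fun n => hfs (φ n)
    rw [this]
    exact hs.comp hφ.tendsto_atTop
  refine ⟨g, hg, hgρ, fun v' h1 h2 => ?_⟩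
  rw [tendsto_nhds_unique t t2]
  exact csInf_le hbdd ⟨v', ⟨h1, h2⟩, rfl⟩

/-- uniform Hölder families -/
def UB (α : ℝ) {ι : Type*} (f : ι → (Fin d → ℝ) → ℝ) : Prop := ∃ C : ℝ, 0 ≤ C ∧ ∀ n, Bd C (f n) ∧ Hol α C (f n)

variable {ι : Type*}

lemma UB.num {a : ι → ℝ} {C : ℝ} (hC : 0 ≤ C) (h : ∀ n, |a n| ≤ C) : UB (d := d) α (fun n _ => a n) :=
  ⟨C, hC, fun n => ⟨fun _ => h n, fun x y => by simp; positivity⟩⟩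

lemma UB.add {f g : ι → (Fin d → ℝ) → ℝ} (hf : UB α f) (hg : UB α g) : UB α (fun n x => f n x + g n x) := by
  obtain ⟨C, hC, h⟩ := hf
  obtain ⟨C', hC', h'⟩ := hg
  exact ⟨C + C', by positivity, fun n => ⟨fun x => (abs_add_le _ _).trans (add_le_add ((h n).1 x) ((h' n).1 x)), (h n).2.add (h' n).2⟩⟩

lemma Hol.mul {C C' D D' : ℝ} {f g : (Fin d → ℝ) → ℝ} (b : Bd D f) (b' : Bd D' g) (h : Hol α C f) (h' : Hol α C' g) :
    Hol α (D * C' + D' * C) (fun x => f x * g x) := by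
  intro x y
  have e : f x * g x - f y * g y = f x * (g x - g y) + g y * (f x - f y) := by ring
  simp only
  rw [e]
  refine (abs_add_le _ _).trans ?_
  rw [abs_mul, abs_mul, add_mul, mul_assoc, mul_assoc]
  have := b.nonneg
  have := b'.nonneg
  exact add_le_add (mul_le_mul (b x) (h' x y) (abs_nonneg _) ‹_›) (mul_le_mul (b' y) (h x y) (abs_nonneg _) ‹_›)

lemma UB.mul {f g : ι → (Fin d → ℝ) → ℝ} (hf : UB α f) (hg : UB α g) : UB α (fun n x => f n x * g n x) := by
  obtain ⟨C, hC, h⟩ := hf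
  obtain ⟨C', hC', h'⟩ := hg
  refine ⟨2 * (C * C'), by positivity, fun n => ⟨fun x => ?_, ?_⟩⟩
  · rw [abs_mul]
    have := mul_le_mul ((h n).1 x) ((h' n).1 x) (abs_nonneg _) hC
    have : 0 ≤ C * C' := by positivity
    linarith
  · exact (Hol.mul (h n).1 (h' n).1 (h n).2 (h' n).2).mono (by linarith)

lemma UB.neg {f : ι → (Fin d → ℝ) → ℝ} (hf : UB α f) : UB α (fun n x => - f n x) := by
  obtain ⟨C, hC, h⟩ := hf
  exact ⟨C, hC, fun n => ⟨fun x => by rw [abs_neg]; exact (h n).1 x, (h n).2.neg⟩⟩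

lemma UB.sub {f g : ι → (Fin d → ℝ) → ℝ} (hf : UB α f) (hg : UB α g) : UB α (fun n x => f n x - g n x) := by
  simpa [sub_eq_add_neg] using hf.add hg.neg

lemma UB.sum {κ : Type*} (s : Finset κ) {f : κ → ι → (Fin d → ℝ) → ℝ} (hf : ∀ k, UB α (f k)) : UB α (fun n x => ∑ k ∈ s, f k n x) := by
  classical
  induction s using Finset.induction_on with
  | empty => simpa using UB.num (d := d) (ι := ι) (a := fun _ => 0) le_rfl (by simp)
  | insert a s ha ih => simpa [Finset.sum_insert ha] using (hf a).add ih

lemma UB.of_c1 (h0 : 0 < α) (h1 : α < 1) {f : ι → (Fin d → ℝ) → ℝ} (hf : ∀ n, ContDiff ℝ 1 (f n))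
    {C : ℝ} (hC : 0 ≤ C) (b : ∀ n, Bd C (f n)) (b' : ∀ n i, Bd C (pd d i (f n))) : UB α f :=
  ⟨(d + 2) * C, by positivity, fun n => ⟨(b n).mono (by nlinarith [(Nat.cast_nonneg d : (0:ℝ) ≤ d)]), hol_of_c1 h0 h1 (hf n).dif1 (b n) (b' n)⟩⟩

lemma UB.of_hol {f : (Fin d → ℝ) → ℝ} {C : ℝ} (h0 : 0 < α) (hp : ZPer d f) (h : Hol α C f) : UB (ι := ι) α (fun _ => f) := by
  obtain ⟨B, hB, hb⟩ := hp.bounded (h.continuous h0)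
  exact ⟨max B |C|, by positivity, fun _ => ⟨hb.mono (le_max_left _ _), h.mono ((le_abs_self _).trans (le_max_right _ _))⟩⟩

lemma UB.of_per_c1 (h0 : 0 < α) (h1 : α < 1) {f : (Fin d → ℝ) → ℝ} (hp : ZPer d f) (hf : ContDiff ℝ 1 f) : UB (ι := ι) α (fun _ => f) := by
  obtain ⟨B, hB, hb⟩ := hp.bounded hf.continuous
  choose C hC hc using fun i => (hp.pd i).bounded (c0_pd hf i)
  have hs : 0 ≤ ∑ i, C i := Finset.sum_nonneg fun i _ => hC i
  refine UB.of_c1 h0 h1 (fun _ => hf) (C := B + ∑ i, C i) (by positivity) (fun _ => hb.mono (by linarith)) fun _ i => (hc i).mono ?_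
  have := Finset.single_le_sum (f := C) (fun i _ => hC i) (Finset.mem_univ i)
  linarith

/-- admissible perturbations -/
structure Adm (d : ℕ) (v : (Fin d → ℝ) → ℝ) (μ : ℝ) : Prop where
  c2 : ContDiff ℝ 2 v
  b0 : Bd 1 v
  b1 : ∀ i, Bd 1 (pd d i v)
  b2 : ∀ i j, Bd 1 (pd d i (pd d j v))
  hμ : |μ| ≤ 1

lemma coef_bound (h0 : 0 < α) (h1 : α < 1) (hG : GG α L G G') (hVp : ZPer d V) (hV : ContDiff ℝ 1 V) {CV : ℝ} (hVh : ∀ i, Hol α CV (pd d i V))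
    (hup : ZPer d u) (hu : ContDiff ℝ 2 u) {CU : ℝ} (huh : ∀ i j, Hol α CU (pd d i (pd d j u))) :
    ∃ C1 : ℝ, 0 ≤ C1 ∧ ∀ v μ, Adm d v μ → (∀ i j, Hol α C1 (aco d G G' ε μ V (fun x => u x + v x) i j)) ∧
      Hol α C1 (fun x => cco d G G' ε μ V (fun x => u x + v x) x - ∑ i, ∑ j, aco d G G' ε μ V (fun x => u x + v x) i j x * pd d i (pd d j u) x) := by
  let ι := {p : ((Fin d → ℝ) → ℝ) × ℝ // Adm d p.1 p.2}
  have uv : UB (ι := ι) α (fun p => p.1.1) := UB.of_c1 h0 h1 (fun p => p.2.c2.of21) zero_le_one (fun p => p.2.b0) (fun p => p.2.b1)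
  have uv1 : ∀ i, UB (ι := ι) α (fun p => pd d i p.1.1) := fun i =>
    UB.of_c1 h0 h1 (fun p => c1_pd p.2.c2 i) zero_le_one (fun p => p.2.b1 i) (fun p j => p.2.b2 j i)
  have uμ : UB (ι := ι) (d := d) α (fun p _ => p.1.2) := UB.num zero_le_one fun p => p.2.hμ
  have nu : ∀ c : ℝ, UB (ι := ι) (d := d) α (fun _ _ => c) := fun c => UB.num (abs_nonneg c) fun _ => le_rfl
  have uu : UB (ι := ι) α (fun p x => u x + p.1.1 x) := (UB.of_per_c1 h0 h1 hup hu.of21).add uv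
  have uu1 : ∀ i, UB (ι := ι) α (fun p => pd d i (fun x => u x + p.1.1 x)) := fun i => by
    simp_rw [fun p : ι => pd_add' hu.of21 p.2.c2.of21 i]
    exact (UB.of_per_c1 h0 h1 (hup.pd i) (c1_pd hu i)).add (uv1 i)
  have uV : UB (ι := ι) α (fun _ => V) := UB.of_per_c1 h0 h1 hVp hV
  have uV1 : ∀ i, UB (ι := ι) α (fun _ => pd d i V) := fun i => UB.of_hol h0 (hVp.pd i) (hVh i)
  have uW : UB (ι := ι) α (fun p => Wf d ε p.1.2 V (fun x => u x + p.1.1 x)) := by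
    unfold Wf gradSq
    simp_rw [sq]
    exact (((nu _).mul uu).add ((nu _).mul (UB.sum _ fun i => (uu1 i).mul (uu1 i)))).add (uμ.mul uV)
  have uc : ∀ p : ι, ContDiff ℝ 2 (fun x => u x + p.1.1 x) := fun p => hu.add p.2.c2
  -- gradient of W is uniformly bounded
  have uWlip : ∃ M : ℝ, 0 ≤ M ∧ ∀ (p : ι) (x y : Fin d → ℝ), |Wf d ε p.1.2 V (fun x => u x + p.1.1 x) x - Wf d ε p.1.2 V (fun x => u x + p.1.1 x) y| ≤ M * dist x y := by
    obtain ⟨M1, hM1, b1⟩ : ∃ M : ℝ, 0 ≤ M ∧ ∀ (p : ι) i, Bd M (pd d i (Wf d ε p.1.2 V (fun x => u x + p.1.1 x))) := by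
      choose A hA bA using uu1
      choose B hB bB using fun i => (uV1 i)
      choose D hD bD using fun i j => ((hup.pd j).pd i).bounded (c0_pd (c1_pd hu j) i)
      have sA : 0 ≤ ∑ i, A i := Finset.sum_nonneg fun i _ => hA i
      have sB : 0 ≤ ∑ i, B i := Finset.sum_nonneg fun i _ => hB i
      have sD : 0 ≤ ∑ i, ∑ j, D i j := Finset.sum_nonneg fun i _ => Finset.sum_nonneg fun j _ => hD i j
      refine ⟨|ε| * (∑ i, A i) + (∑ i, A i) * ((∑ i, ∑ j, D i j) + 1) + 1 * ∑ i, B i, by positivity, fun p i x => ?_⟩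
      rw [pd_Wf hV (uc p)]
      have lA : ∀ i, A i ≤ ∑ i, A i := fun i => Finset.single_le_sum (fun i _ => hA i) (Finset.mem_univ i)
      have lB : B i ≤ ∑ i, B i := Finset.single_le_sum (fun i _ => hB i) (Finset.mem_univ i)
      have lD : ∀ j, D i j ≤ ∑ i, ∑ j, D i j := fun j =>
        (Finset.single_le_sum (fun j _ => hD i j) (Finset.mem_univ j)).trans
          (Finset.single_le_sum (f := fun i => ∑ j, D i j) (fun i _ => Finset.sum_nonneg fun j _ => hD i j) (Finset.mem_univ i))
      refine (abs_add_le _ _).trans (add_le_add ((abs_add_le _ _).trans (add_le_add ?_ ?_)) ?_)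
      · rw [abs_mul]
        have := ((bA i p).1 x).trans (lA i)
        gcongr
      · refine (Finset.abs_sum_le_sum_abs _ _).trans ?_
        rw [Finset.sum_mul]
        refine Finset.sum_le_sum fun j _ => ?_
        rw [abs_mul]
        have k1 := (bA j p).1 x
        have k2 : |pd d i (pd d j (fun x => u x + p.1.1 x)) x| ≤ (∑ i, ∑ j, D i j) + 1 := by
          rw [pd_add' hu.of21 p.2.c2.of21 j, pd_add' (c1_pd hu j) (c1_pd p.2.c2 j) i]
          exact (abs_add_le _ _).trans (add_le_add ((bD i j x).trans (lD j)) (p.2.b2 i j x))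
        have := hA j
        gcongr
      · rw [abs_mul]
        exact mul_le_mul p.2.hμ (((bB i p).1 x).trans lB) (abs_nonneg _) zero_le_one
    exact ⟨d * M1, by positivity, fun p x y => lip_of_pd (Wf_c1 hV (uc p)).dif1 (b1 p) x y⟩
  have uGW : UB (ι := ι) α (fun p x => G (Wf d ε p.1.2 V (fun x => u x + p.1.1 x) x)) := by
    obtain ⟨C, hC, h⟩ := uW
    have hL := hG.L0
    refine ⟨|G 0| + L * C, by positivity, fun p => ⟨fun x => ?_, fun x y => ?_⟩⟩
    · have k1 := hG.lip (Wf d ε p.1.2 V (fun x => u x + p.1.1 x) x) 0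
      rw [sub_zero] at k1
      have k2 := abs_sub_abs_le_abs_sub (G (Wf d ε p.1.2 V (fun x => u x + p.1.1 x) x)) (G 0)
      have k3 := mul_le_mul_of_nonneg_left ((h p).1 x) hL
      linarith
    · refine (hG.lip _ _).trans ?_
      have k := mul_le_mul_of_nonneg_left ((h p).2 x y) hL
      refine k.trans ?_
      rw [← mul_assoc]
      gcongr
      linarith [abs_nonneg (G 0)]
  have uG'W : UB (ι := ι) α (fun p x => G' (Wf d ε p.1.2 V (fun x => u x + p.1.1 x) x)) := by
    obtain ⟨M, hM, h⟩ := uWlip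
    have hL := hG.L0
    refine ⟨L + L * M ^ α, by positivity, fun p => ⟨fun x => ?_, fun x y => ?_⟩⟩
    · rw [abs_of_pos (hG.pos _)]
      have : 0 ≤ L * M ^ α := by positivity
      have := hG.bd (Wf d ε p.1.2 V (fun x => u x + p.1.1 x) x)
      linarith
    · refine (hG.hol _ _).trans ?_
      calc _ ≤ L * (M * dist x y) ^ α := by
            have := h p x y
            gcongr
        _ = L * M ^ α * dist x y ^ α := by rw [Real.mul_rpow hM dist_nonneg]; ring
        _ ≤ _ := by gcongr; linarith
  have ua : ∀ i j, UB (ι := ι) α (fun p => aco d G G' ε p.1.2 V (fun x => u x + p.1.1 x) i j) := fun i j => by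
    unfold aco
    refine UB.add ?_ ((uG'W.mul (uu1 i)).mul (uu1 j))
    split_ifs
    · exact uGW
    · exact nu 0
  have ucc : UB (ι := ι) α (fun p x => cco d G G' ε p.1.2 V (fun x => u x + p.1.1 x) x - ∑ i, ∑ j, aco d G G' ε p.1.2 V (fun x => u x + p.1.1 x) i j x * pd d i (pd d j u) x) := by
    refine UB.sub ?_ (UB.sum _ fun i => UB.sum _ fun j => (ua i j).mul (UB.of_hol h0 ((hup.pd j).pd i) (huh i j)))
    unfold cco
    exact (((nu _).mul uGW).sub (nu _)).sub (UB.sum _ fun i => (uG'W.mul (((nu _).mul (uu1 i)).add (uμ.mul (uV1 i)))).mul (uu1 i))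
  choose A hA bA using ua
  obtain ⟨C, hC, bC⟩ := ucc
  have sA : 0 ≤ ∑ i, ∑ j, A i j := Finset.sum_nonneg fun i _ => Finset.sum_nonneg fun j _ => hA i j
  refine ⟨C + ∑ i, ∑ j, A i j, by positivity, fun v μ hv => ⟨fun i j => ?_, ?_⟩⟩
  · refine (bA i j ⟨(v, μ), hv⟩).2.mono ?_
    have := (Finset.single_le_sum (fun j _ => hA i j) (Finset.mem_univ j)).trans
          (Finset.single_le_sum (f := fun i => ∑ j, A i j) (fun i _ => Finset.sum_nonneg fun j _ => hA i j) (Finset.mem_univ i))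
    linarith
  · exact (bC ⟨(v, μ), hv⟩).2.mono (by linarith)

end

open MeasureTheory Set Filter Topology

section
variable {d : ℕ}

lemma UC.z {f : ℕ → (Fin d → ℝ) → ℝ} (h : UC f (fun _ => 0)) : UCB f (fun _ => 0) := ⟨h, 0, fun x => by simp⟩

lemma UCB.mul_z {f h : ℕ → (Fin d → ℝ) → ℝ} {g : (Fin d → ℝ) → ℝ} (hf : UCB f g) (hh : UCB h (fun _ => 0)) :
    UCB (fun n x => f n x * h n x) (fun _ => 0) := by
  simpa using hf.mul hh

lemma UCB.add_z {f h : ℕ → (Fin d → ℝ) → ℝ} (hf : UCB f (fun _ => 0)) (hh : UCB h (fun _ => 0)) :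
    UCB (fun n x => f n x + h n x) (fun _ => 0) := by
  simpa using hf.add hh

lemma UCB.sub_z {f h : ℕ → (Fin d → ℝ) → ℝ} (hf : UCB f (fun _ => 0)) (hh : UCB h (fun _ => 0)) :
    UCB (fun n x => f n x - h n x) (fun _ => 0) := by
  simpa using hf.sub hh

lemma UCB.sum_z {κ : Type*} (s : Finset κ) {f : κ → ℕ → (Fin d → ℝ) → ℝ} (hf : ∀ k, UCB (f k) (fun _ => 0)) :
    UCB (fun n x => ∑ k ∈ s, f k n x) (fun _ => 0) := by
  simpa using UCB.sum s hf

lemma SP.ucb {f : (Fin d → ℝ) → ℝ} (h : SP d f) : UCB (fun _ => f) f := ZPer.ucb h.1 h.cont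

lemma SP.hol {α : ℝ} (h0 : 0 < α) (h1 : α < 1) {f : (Fin d → ℝ) → ℝ} (h : SP d f) : ∃ C : ℝ, Hol α C f := by
  obtain ⟨C, -, hC⟩ := UB.of_per_c1 (ι := Unit) h0 h1 h.1 h.c1
  exact ⟨C, (hC ()).2⟩

lemma uc_deriv {α H : ℝ} (h0 : 0 < α) (h1 : α < 1) (hH : 0 ≤ H) {f : ℕ → (Fin d → ℝ) → ℝ} (hf : ∀ n, KH d α H (f n))
    (hu : UC f (fun _ => 0)) : (∀ j, UC (fun n => pd d j (f n)) (fun _ => 0)) ∧ ∀ i j, UC (fun n => pd d i (pd d j (f n))) (fun _ => 0) := by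
  constructor
  · intro j η hη
    obtain ⟨δ, hδ, h⟩ := interp d h0 h1 hH hη
    filter_upwards [hu δ hδ] with n hn
    simpa using (h _ (hf n) (by simpa using hn)).1 j
  · intro i j η hη
    obtain ⟨δ, hδ, h⟩ := interp d h0 h1 hH hη
    filter_upwards [hu δ hδ] with n hn
    simpa using (h _ (hf n) (by simpa using hn)).2 i j

lemma pd2_mul {f g : (Fin d → ℝ) → ℝ} (hf : ContDiff ℝ 2 f) (hg : ContDiff ℝ 2 g) (i j : Fin d) :
    pd d i (pd d j (fun x => f x * g x)) = fun x => (pd d i (pd d j f) x * g x + pd d j f x * pd d i g x)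
      + (pd d i f x * pd d j g x + f x * pd d i (pd d j g) x) := by
  rw [pd_mul hf.dif2 hg.dif2, pd_add ((c1_pd hf j).mul hg.of21).dif1 (hf.of21.mul (c1_pd hg j)).dif1,
    pd_mul (c1_pd hf j).dif1 hg.dif2, pd_mul hf.dif2 (c1_pd hg j).dif1]


/-- HolS of a fixed smooth function times a vanishing sequence -/
lemma HolS.smul {α c : ℝ} (h0 : 0 < α) (h1 : α < 1) (hc : 0 ≤ c) {ζ : (Fin d → ℝ) → ℝ} (hζ : SP d ζ) {b : ℝ} (hb : Bd b ζ)
    {h : ℕ → (Fin d → ℝ) → ℝ} (hu : UC h (fun _ => 0)) (hh : HolS α h c) : HolS α (fun n x => ζ x * h n x) (b * c) := by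
  obtain ⟨C, hC⟩ := hζ.hol h0 h1
  exact HolS.mul (C := C) hb.nonneg hc (f := fun _ => ζ) (Eventually.of_forall fun _ => hb) (Eventually.of_forall fun _ => hC) hu hh

lemma HolS.smul0 {α : ℝ} (h0 : 0 < α) (h1 : α < 1) {ζ : (Fin d → ℝ) → ℝ} (hζ : SP d ζ)
    {h : ℕ → (Fin d → ℝ) → ℝ} (hu : UC h (fun _ => 0)) (hh : HolS α h 0) : HolS α (fun n x => ζ x * h n x) 0 := by
  obtain ⟨b, -, hb⟩ := hζ.bdd
  simpa using HolS.smul h0 h1 le_rfl hζ hb hu hh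

lemma HolS.add0 {α : ℝ} {f g : ℕ → (Fin d → ℝ) → ℝ} (h : HolS α f 0) (h' : HolS α g 0) : HolS α (fun n x => f n x + g n x) 0 := by
  simpa using h.add h'

lemma HolS.sum0 {α : ℝ} {κ : Type*} (s : Finset κ) {f : κ → ℕ → (Fin d → ℝ) → ℝ} (h : ∀ k, HolS α (f k) 0) :
    HolS α (fun n x => ∑ k ∈ s, f k n x) 0 := by
  simpa using HolS.sum s h

lemma w_hol {α H b : ℝ} (h0 : 0 < α) (h1 : α < 1) (hH : 0 ≤ H) (hb0 : 0 ≤ b) {κ : Type*} [Fintype κ] {ζ : κ → (Fin d → ℝ) → ℝ}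
    (hζ : ∀ k, SP d (ζ k)) (hb : ∀ x, ∑ k, |ζ k x| ≤ b) {g : κ → ℕ → (Fin d → ℝ) → ℝ} (hg : ∀ k n, KH d α H (g k n))
    (hu : ∀ k, UC (g k) (fun _ => 0)) (i j : Fin d) :
    HolS α (fun n => pd d i (pd d j (fun x => ∑ k, ζ k x * g k n x))) (b * H) := by
  have hd := fun k => uc_deriv h0 h1 hH (hg k) (hu k)
  have e : ∀ n, pd d i (pd d j (fun x => ∑ k, ζ k x * g k n x)) = fun x =>
      ∑ k, ((pd d i (pd d j (ζ k)) x * g k n x + pd d j (ζ k) x * pd d i (g k n) x) + pd d i (ζ k) x * pd d j (g k n) x)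
        + ∑ k, ζ k x * pd d i (pd d j (g k n)) x := by
    intro n
    have c : ∀ k, ContDiff ℝ 2 (fun x => ζ k x * g k n x) := fun k => (hζ k).c2.mul (hg k n).c2
    rw [pd_sum _ (fun k _ => (c k).dif2), pd_sum _ (fun k _ => (c1_pd (c k) j).dif1)]
    ext x
    rw [← Finset.sum_add_distrib]
    refine Finset.sum_congr rfl fun k _ => ?_
    rw [pd2_mul (hζ k).c2 (hg k n).c2]
    ring
  simp_rw [e]
  have a0 : ∀ k, HolS α (g k) 0 := fun k => HolS.of_c1 h0 h1 (fun n => (hg k n).per) (fun n => (hg k n).c2.of21) (hu k) (hd k).1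
  have a1 : ∀ k i, HolS α (fun n => pd d i (g k n)) 0 := fun k i =>
    HolS.of_c1 h0 h1 (fun n => (hg k n).per.pd i) (fun n => c1_pd (hg k n).c2 i) ((hd k).1 i) (fun j => (hd k).2 j i)
  have t1 := HolS.sum0 (κ := κ) Finset.univ fun k => ((HolS.smul0 h0 h1 (((hζ k).pd j).pd i) (hu k) (a0 k)).add0
    (HolS.smul0 h0 h1 ((hζ k).pd j) ((hd k).1 i) (a1 k i))).add0 (HolS.smul0 h0 h1 ((hζ k).pd i) ((hd k).1 j) (a1 k j))
  choose C hC using fun k => (hζ k).hol h0 h1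
  have t2 : HolS α (fun n x => ∑ k, ζ k x * pd d i (pd d j (g k n)) x) (b * H) := by
    refine HolS.sum_mul (C := ∑ k, |C k|) (f := fun k _ => ζ k) hb0 hH (Eventually.of_forall fun _ => hb)
      (fun k => Eventually.of_forall fun _ => (hC k).mono ?_) (fun k => (hd k).2 i j) fun k η hη => Eventually.of_forall fun n => ((hg k n).hol i j).mono (by linarith)
    exact (le_abs_self _).trans (Finset.single_le_sum (f := fun k => |C k|) (fun k _ => abs_nonneg _) (Finset.mem_univ k))
  simpa using t1.add t2

/-- the commutator error -/
noncomputable def errf (ζ c v : (Fin d → ℝ) → ℝ) (A : Fin d → Fin d → ℝ) (a : Fin d → Fin d → (Fin d → ℝ) → ℝ) (x : Fin d → ℝ) : ℝ :=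
  (ζ x * c x + ∑ j, ∑ l, (ζ x * (A j l - a j l x)) * pd d j (pd d l v) x)
    + ((∑ j, ∑ l, ((pd d j (pd d l ζ) x * (A j l * v x) + pd d l ζ x * (A j l * pd d j v x)) + pd d j ζ x * (A j l * pd d l v x)))
    + ζ x * (- v x))

lemma err_eq {ζ c v F : (Fin d → ℝ) → ℝ} {A b : Fin d → Fin d → ℝ} {a : Fin d → Fin d → (Fin d → ℝ) → ℝ} (hζ : ContDiff ℝ 2 ζ) (hv : ContDiff ℝ 2 v)
    (hF : ∀ x, F x = c x - ∑ i, ∑ j, a i j x * pd d i (pd d j v) x) (hA : ∀ j l, ∑ i, b i j * b i l = A j l) (x : Fin d → ℝ) :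
    errf ζ c v A a x = ζ x * F x - ζ x * v x + Lap b (fun x => ζ x * v x) x := by
  rw [Lap_eq b (hζ.mul hv), hF]
  simp only [hA]
  unfold errf
  have : ∑ j, ∑ l, A j l * pd d j (pd d l (fun x => ζ x * v x)) x
    = (∑ j, ∑ l, ((pd d j (pd d l ζ) x * (A j l * v x) + pd d l ζ x * (A j l * pd d j v x)) + pd d j ζ x * (A j l * pd d l v x)))
      + (∑ j, ∑ l, (ζ x * (A j l - a j l x)) * pd d j (pd d l v) x) + ζ x * ∑ i, ∑ j, a i j x * pd d i (pd d j v) x := by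
    rw [Finset.mul_sum, ← Finset.sum_add_distrib, ← Finset.sum_add_distrib]
    refine Finset.sum_congr rfl fun j _ => ?_
    rw [Finset.mul_sum, ← Finset.sum_add_distrib, ← Finset.sum_add_distrib]
    refine Finset.sum_congr rfl fun l _ => ?_
    rw [pd2_mul hζ hv]
    ring
  rw [this]
  ring

lemma HolS.cm {α c : ℝ} (r : ℝ) {f : ℕ → (Fin d → ℝ) → ℝ} (hc : 0 ≤ c) (hu : UC f (fun _ => 0)) (h : HolS α f c) :
    HolS α (fun n x => r * f n x) (|r| * c) :=
  HolS.mul (C := 0) (f := fun _ _ => r) (abs_nonneg r) hc (Eventually.of_forall fun _ _ => le_rfl) (Eventually.of_forall fun _ x y => by simp) hu h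

lemma err_bound {α C1 η R : ℝ} (h0 : 0 < α) (h1 : α < 1) (hC1 : 0 ≤ C1) (hη : 0 ≤ η) (hR : 0 ≤ R) {ζ : (Fin d → ℝ) → ℝ}
    {c v : ℕ → (Fin d → ℝ) → ℝ} {A : Fin d → Fin d → ℝ} {a : ℕ → Fin d → Fin d → (Fin d → ℝ) → ℝ} (hζ : SP d ζ) (hζ1 : Bd 1 ζ)
    (hv : ∀ n, KH d α R (v n)) (hu : UC v (fun _ => 0)) (hc : UC c (fun _ => 0)) (hch : ∀ᶠ n in atTop, Hol α C1 (c n))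
    (hah : ∀ᶠ n in atTop, ∀ i j, Hol α C1 (a n i j)) {a0 : Fin d → Fin d → (Fin d → ℝ) → ℝ}
    (ha : ∀ i j, UCB (fun n => a n i j) (a0 i j)) (hs : ∀ᶠ n in atTop, ∀ i j x, |ζ x * (A i j - a n i j x)| ≤ η) :
    UC (fun n => errf ζ (c n) (v n) A (a n)) (fun _ => 0) ∧ HolS α (fun n => errf ζ (c n) (v n) A (a n)) (C1 + d * (d * (η * R))) := by
  obtain ⟨d1, d2⟩ := uc_deriv h0 h1 hR hv hu
  constructor
  · have num : ∀ r : ℝ, UCB (d := d) (fun _ _ => r) (fun _ => r) := fun r => UCB.num tendsto_const_nhds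
    have := UCB.add_z (UCB.add_z (UCB.mul_z hζ.ucb hc.z) (UCB.sum_z Finset.univ fun j => UCB.sum_z Finset.univ fun l =>
      UCB.mul_z (hζ.ucb.mul ((num (A j l)).sub (ha j l))) (d2 j l).z))
      (UCB.add_z (UCB.sum_z Finset.univ fun j => UCB.sum_z Finset.univ fun l => UCB.add_z (UCB.add_z
        (UCB.mul_z ((hζ.pd l).pd j).ucb (UCB.mul_z (num (A j l)) hu.z)) (UCB.mul_z (hζ.pd l).ucb (UCB.mul_z (num (A j l)) (d1 j).z)))
        (UCB.mul_z (hζ.pd j).ucb (UCB.mul_z (num (A j l)) (d1 l).z))) (UCB.mul_z hζ.ucb (by simpa using hu.z.neg)))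
    exact this.1
  · have a0' : HolS α v 0 := HolS.of_c1 h0 h1 (fun n => (hv n).per) (fun n => (hv n).c2.of21) hu d1
    have a1 : ∀ i, HolS α (fun n => pd d i (v n)) 0 := fun i =>
      HolS.of_c1 h0 h1 (fun n => (hv n).per.pd i) (fun n => c1_pd (hv n).c2 i) (d1 i) (fun j => d2 j i)
    have num : ∀ r : ℝ, UCB (d := d) (fun _ _ => r) (fun _ => r) := fun r => UCB.num tendsto_const_nhds
    have cm : ∀ (r : ℝ) {f : ℕ → (Fin d → ℝ) → ℝ}, UC f (fun _ => 0) → HolS α f 0 → HolS α (fun n x => r * f n x) 0 := fun r f u h => by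
      simpa using HolS.cm r le_rfl u h
    obtain ⟨Cζ, hCζ⟩ := hζ.hol h0 h1
    have t1 : HolS α (fun n x => ζ x * c n x) (1 * C1) := HolS.smul h0 h1 hC1 hζ hζ1 hc
      (fun η hη => hch.mono fun n hn => hn.mono (by linarith))
    have t2 : ∀ j l, HolS α (fun n x => (ζ x * (A j l - a n j l x)) * pd d j (pd d l (v n)) x) (η * R) := by
      intro j l
      obtain ⟨-, B, hB⟩ := (num (A j l)).sub (ha j l)
      have hbn : ∀ᶠ n in atTop, Bd (B + 1) (fun x => A j l - a n j l x) := by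
        filter_upwards [((num (A j l)).sub (ha j l)).1 1 one_pos] with n hn x
        have k1 := hn x
        have k2 := hB x
        simp only at k1 k2
        have := abs_sub_abs_le_abs_sub (A j l - a n j l x) (A j l - a0 j l x)
        linarith
      refine HolS.mul (C := 1 * C1 + (B + 1) * Cζ) hη hR (hs.mono fun n hn => hn j l) ?_ (d2 j l)
        (fun σ hσ => Eventually.of_forall fun n => ((hv n).hol j l).mono (by linarith))
      filter_upwards [hbn, hah] with n k1 k2
      refine Hol.mul hζ1 k1 hCζ ?_
      intro x y
      have e : A j l - a n j l x - (A j l - a n j l y) = -(a n j l x - a n j l y) := by ring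
      rw [e, abs_neg]
      exact k2 j l x y
    have t2' := HolS.sum Finset.univ fun j => HolS.sum Finset.univ fun l => t2 j l
    have t3 := HolS.sum0 (α := α) Finset.univ fun j => HolS.sum0 Finset.univ fun l => HolS.add0 (HolS.add0
        (HolS.smul0 h0 h1 ((hζ.pd l).pd j) (UCB.mul_z (num (A j l)) hu.z).1 (cm (A j l) hu a0')) (HolS.smul0 h0 h1 (hζ.pd l) (UCB.mul_z (num (A j l)) (d1 j).z).1 (cm (A j l) (d1 j) (a1 j))))
        (HolS.smul0 h0 h1 (hζ.pd j) (UCB.mul_z (num (A j l)) (d1 l).z).1 (cm (A j l) (d1 l) (a1 l)))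
    have t4 := HolS.smul0 h0 h1 hζ (h := fun n x => - v n x) (by simpa using hu.z.neg.1) a0'.neg
    have := (t1.add t2').add (t3.add t4)
    refine HolS.mono this ?_
    simp

lemma ibp_dd {f g : (Fin d → ℝ) → ℝ} (b : Fin d → ℝ) (hp : ZPer d f) (hf : ContDiff ℝ 1 f) (gp : ZPer d g) (hg : ContDiff ℝ 1 g) :
    IT (fun x => dd d b f x * g x) = - IT (fun x => f x * dd d b g x) := by
  have cf := fun i => c0_pd hf i
  have cg := fun i => c0_pd hg i
  have hfc := hf.continuous
  have hgc := hg.continuous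
  have e1 : (fun x => dd d b f x * g x) = fun x => ∑ j, b j * (pd d j f x * g x) := by
    ext x; unfold dd; rw [Finset.sum_mul]; exact Finset.sum_congr rfl fun j _ => by ring
  have e2 : (fun x => f x * dd d b g x) = fun x => ∑ j, b j * (f x * pd d j g x) := by
    ext x; unfold dd; rw [Finset.mul_sum]; exact Finset.sum_congr rfl fun j _ => by ring
  rw [e1, e2, IT_sum (f := fun j x => b j * (pd d j f x * g x)) _ (fun j => continuous_const.mul ((cf j).mul hgc)),
    IT_sum (f := fun j x => b j * (f x * pd d j g x)) _ (fun j => continuous_const.mul (hfc.mul (cg j))), ← Finset.sum_neg_distrib]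
  refine Finset.sum_congr rfl fun j _ => ?_
  rw [IT_mul, IT_mul, ibp hp hf gp hg j]
  ring

lemma energy {κ : Type*} [Fintype κ] {ζ : κ → (Fin d → ℝ) → ℝ} (hζ : ∀ k, SP d (ζ k)) (h1 : ∀ x, ∑ k, ζ k x ^ 2 = 1)
    {F : (Fin d → ℝ) → ℝ} (hF : Continuous F) {Gk : κ → (Fin d → ℝ) → ℝ} (hp : ∀ k, ZPer d (Gk k))
    (hG : ∀ k, ContDiff ℝ 2 (Gk k)) {b : κ → Fin d → Fin d → ℝ} (he : ∀ k x, Gk k x - Lap (b k) (Gk k) x = ζ k x * F x)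
    (hI : 0 ≤ IT (fun x => F x * (- ∑ k, ζ k x * Gk k x))) (x : Fin d → ℝ) : F x = 0 := by
  have c2 : ∀ k i, Continuous (dd d (b k i) (Gk k)) := fun k i => dd_cont _ (hG k).of21
  have c3 : ∀ k i, Continuous (dd d (b k i) (dd d (b k i) (Gk k))) := fun k i => dd_cont _ (dd_c1 _ (hG k))
  have c1 : ∀ k, Continuous (Gk k) := fun k => (hG k).continuous
  have cz : ∀ k, Continuous (ζ k) := fun k => (hζ k).cont
  set E : (Fin d → ℝ) → ℝ := fun x => ∑ k, (Gk k x ^ 2 + ∑ i, dd d (b k i) (Gk k) x ^ 2) with hE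
  have key : IT (fun x => F x * (- ∑ k, ζ k x * Gk k x)) = - IT E := by
    have e1 : (fun x => F x * (- ∑ k, ζ k x * Gk k x)) = fun x => - ∑ k, (Gk k x ^ 2 - ∑ i, dd d (b k i) (dd d (b k i) (Gk k)) x * Gk k x) := by
      ext x
      rw [mul_neg, Finset.mul_sum]
      congr 1
      refine Finset.sum_congr rfl fun k _ => ?_
      have := he k x
      unfold Lap at this
      rw [← Finset.sum_mul]
      linear_combination (-Gk k x) * this
    rw [e1, IT_neg, IT_sum (f := fun k x => Gk k x ^ 2 - ∑ i, dd d (b k i) (dd d (b k i) (Gk k)) x * Gk k x) _ (fun k => by fun_prop),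
      hE, IT_sum (f := fun k x => Gk k x ^ 2 + ∑ i, dd d (b k i) (Gk k) x ^ 2) _ (fun k => by fun_prop)]
    congr 1
    refine Finset.sum_congr rfl fun k _ => ?_
    rw [IT_sub (f := fun x => Gk k x ^ 2) (g := fun x => ∑ i, dd d (b k i) (dd d (b k i) (Gk k)) x * Gk k x) (by fun_prop) (by fun_prop),
      IT_add (f := fun x => Gk k x ^ 2) (g := fun x => ∑ i, dd d (b k i) (Gk k) x ^ 2) (by fun_prop) (by fun_prop), sub_eq_add_neg]
    congr 1
    rw [IT_sum (f := fun i x => dd d (b k i) (dd d (b k i) (Gk k)) x * Gk k x) _ (fun k => by fun_prop), IT_sum (f := fun i x => dd d (b k i) (Gk k) x ^ 2) _ (fun k => by fun_prop),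
      ← Finset.sum_neg_distrib]
    refine Finset.sum_congr rfl fun i _ => ?_
    rw [ibp_dd _ (dd_per _ (hp k)) (dd_c1 _ (hG k)) (hp k) (hG k).of21, neg_neg]
    simp_rw [sq]
  have nn : ∀ k x, 0 ≤ Gk k x ^ 2 + ∑ i, dd d (b k i) (Gk k) x ^ 2 := fun k x =>
    add_nonneg (sq_nonneg _) (Finset.sum_nonneg fun i _ => sq_nonneg _)
  have hz : ∀ x, E x = 0 := IT_zero (fun x k => by simp only [hE, hp _ x k, dd_per _ (hp _) x k]) (by fun_prop)
    (fun x => Finset.sum_nonneg fun k _ => nn k x) (by linarith)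
  have hG0 : ∀ k, Gk k = fun _ => 0 := by
    intro k
    ext x
    have := (Finset.sum_eq_zero_iff_of_nonneg fun k _ => nn k x).1 (hz x) k (Finset.mem_univ k)
    have h2 : 0 ≤ ∑ i, dd d (b k i) (Gk k) x ^ 2 := Finset.sum_nonneg fun i _ => sq_nonneg _
    have h3 : Gk k x ^ 2 = 0 := le_antisymm (by linarith) (sq_nonneg _)
    simpa using h3
  have hzF : ∀ k, ζ k x * F x = 0 := by
    intro k
    rw [← he k x, Lap_eq _ (hG k), hG0 k]
    simp [pd_const]
  have : F x = ∑ k, ζ k x * (ζ k x * F x) := by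
    have := h1 x
    calc F x = (∑ k, ζ k x ^ 2) * F x := by rw [this, one_mul]
      _ = _ := by rw [Finset.sum_mul]; exact Finset.sum_congr rfl fun k _ => by ring
  rw [this]
  simp [hzF]

lemma Lap_add {f g : (Fin d → ℝ) → ℝ} (b : Fin d → Fin d → ℝ) (hf : ContDiff ℝ 2 f) (hg : ContDiff ℝ 2 g) (x : Fin d → ℝ) :
    Lap b (fun x => f x + g x) x = Lap b f x + Lap b g x := by
  rw [Lap_eq b (hf.add hg), Lap_eq b hf, Lap_eq b hg, ← Finset.sum_add_distrib]
  refine Finset.sum_congr rfl fun j _ => ?_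
  rw [← Finset.sum_add_distrib]
  refine Finset.sum_congr rfl fun l _ => ?_
  rw [pd_add' hf.of21 hg.of21, pd_add' (c1_pd hf l) (c1_pd hg l)]
  ring

lemma KH.comb {α R : ℝ} {f g : (Fin d → ℝ) → ℝ} (hf : KH d α R f) (hg : KH d α R g) {t : ℝ} (t0 : 0 ≤ t) (t1 : t ≤ 1) :
    KH d α R (fun x => (1 - t) * f x + t * g x) := by
  refine ⟨fun x k => by simp only [hf.per x k, hg.per x k], (contDiff_const.mul hf.c2).add (contDiff_const.mul hg.c2), fun i j => ?_⟩
  rw [pd_add (contDiff_const.mul hf.c2).dif2 (contDiff_const.mul hg.c2).dif2, pd_const_mul hf.c2.dif2, pd_const_mul hg.c2.dif2,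
    pd_add (contDiff_const.mul (c1_pd hf.c2 j)).dif1 (contDiff_const.mul (c1_pd hg.c2 j)).dif1, pd_const_mul (c1_pd hf.c2 j).dif1, pd_const_mul (c1_pd hg.c2 j).dif1]
  intro x y
  have e : (1 - t) * pd d i (pd d j f) x + t * pd d i (pd d j g) x - ((1 - t) * pd d i (pd d j f) y + t * pd d i (pd d j g) y)
    = (1 - t) * (pd d i (pd d j f) x - pd d i (pd d j f) y) + t * (pd d i (pd d j g) x - pd d i (pd d j g) y) := by ring
  simp only
  rw [e]
  refine (abs_add_le _ _).trans ?_
  rw [abs_mul, abs_mul, abs_of_nonneg t0, abs_of_nonneg (sub_nonneg.2 t1)]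
  have k1 := mul_le_mul_of_nonneg_left (hf.hol i j x y) (sub_nonneg.2 t1)
  have k2 := mul_le_mul_of_nonneg_left (hg.hol i j x y) t0
  linarith

lemma Bd.comb {ρ : ℝ} {f g : (Fin d → ℝ) → ℝ} (hf : Bd ρ f) (hg : Bd ρ g) {t : ℝ} (t0 : 0 ≤ t) (t1 : t ≤ 1) :
    Bd ρ (fun x => (1 - t) * f x + t * g x) := by
  intro x
  refine (abs_add_le _ _).trans ?_
  rw [abs_mul, abs_mul, abs_of_nonneg t0, abs_of_nonneg (sub_nonneg.2 t1)]
  have k1 := mul_le_mul_of_nonneg_left (hf x) (sub_nonneg.2 t1)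
  have k2 := mul_le_mul_of_nonneg_left (hg x) t0
  linarith

end

open MeasureTheory Set Filter Topology

section
variable {d : ℕ} {α L ε μ : ℝ} {G G' : ℝ → ℝ} {V u : (Fin d → ℝ) → ℝ}

lemma aco_per (hV : ZPer d V) (hu : ZPer d u) (i j : Fin d) : ZPer d (aco d G G' ε μ V u i j) := fun x k => by
  simp only [aco, Wf_per hV hu x k, hu.pd _ x k]

lemma KH.zero {R : ℝ} (hR : 0 ≤ R) : KH d α R (fun _ => 0) := by
  refine ⟨fun x k => rfl, contDiff_const, fun i j x y => ?_⟩
  rw [pd_const, pd_const]; simp; positivity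

lemma core (h0 : 0 < α) (h1 : α < 1) (hG : GG α L G G') {Φ : ℝ → ℝ} (hΦ : ∀ y, HasDerivAt Φ (G y) y)
    (hVp : ZPer d V) (hV : ContDiff ℝ 1 V) {CV : ℝ} (hVh : ∀ i, Hol α CV (pd d i V))
    (hup : ZPer d u) (hu : ContDiff ℝ 2 u) {CU : ℝ} (huh : ∀ i j, Hol α CU (pd d i (pd d j u)))
    (hμ : |μ| ≤ 1) (hF0 : ∀ x, Ff d G ε μ V u x = 0) {s0 S : ℝ} (hs0 : 0 < s0) (hm : ∀ x, s0 ≤ G (Wf d ε μ V u x) ∧ G (Wf d ε μ V u x) ≤ S) :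
    ∃ R : ℝ, 0 ≤ R ∧ ∀ (μn : ℕ → ℝ) (vn : ℕ → (Fin d → ℝ) → ℝ), Tendsto μn atTop (𝓝 μ) → (∀ n, |μn n| ≤ 1) →
      (∀ n, KH d α R (vn n)) → (∀ n, Bd 1 (vn n)) →
      (∀ n v', KH d α R v' → Bd 1 v' → Jf d Φ ε (μn n) V (fun x => u x + vn n x) ≤ Jf d Φ ε (μn n) V (fun x => u x + v' x)) →
      UC vn (fun _ => 0) → ∀ᶠ n in atTop, ∀ x, Ff d G ε (μn n) V (fun x => u x + vn n x) x = 0 := by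
  obtain ⟨B, hB, hBu⟩ : ∃ B : ℝ, 0 ≤ B ∧ ∀ i x, |pd d i u x| ≤ B := by
    choose B hB hb using fun i => (hup.pd i).bounded (c0_pd hu.of21 i)
    exact ⟨∑ i, B i, Finset.sum_nonneg fun i _ => hB i, fun i x => (hb i x).trans
      (Finset.single_le_sum (f := B) (fun i _ => hB i) (Finset.mem_univ i))⟩
  obtain ⟨C0, hC0, hfr⟩ := frame_at d (S := S) hs0 hG.L0 hB
  obtain ⟨K, hK, hres⟩ := resolventK d h0 h1 hC0
  obtain ⟨C1, hC1, hco⟩ := coef_bound (ε := ε) h0 h1 hG hVp hV hVh hup hu huh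
  set b : ℝ := 2 ^ d with hb
  have hb0 : 0 ≤ b := by positivity
  set D : ℝ := b * K * (d * d) with hD
  have hD0 : 0 ≤ D := by positivity
  set η : ℝ := 1 / (2 * (D + 1)) with hη
  have hη0 : 0 < η := by positivity
  have hDη : D * η ≤ 1 / 2 := by
    rw [hη, mul_one_div, div_le_div_iff₀ (by positivity) (by norm_num)]; linarith
  set σ : ℝ := 1 / (2 * (b * K + 1)) with hσ
  have hσ0 : 0 < σ := by positivity
  have hbσ : b * K * σ ≤ 1 / 2 := by
    rw [hσ, mul_one_div, div_le_div_iff₀ (by positivity) (by norm_num)]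
    have : 0 ≤ b * K := by positivity
    linarith
  set R : ℝ := 2 * (b * K * C1) + 2 with hR
  have hR0 : 0 ≤ R := by positivity
  set H : ℝ := C1 + d * (d * (η * R)) + σ with hH
  have hH0 : 0 ≤ H := by positivity
  have hbH : b * (K * H) + 1 / 2 ≤ R := by
    have e : b * (K * H) = b * K * C1 + (D * η) * R + b * K * σ := by rw [hH, hD]; ring
    have := mul_le_mul_of_nonneg_right hDη hR0
    rw [e]; linarith
  refine ⟨R, hR0, fun μn vn hμn hμ1 hvK hv1 hmin hvu => ?_⟩
  obtain ⟨d1, d2⟩ := uc_deriv h0 h1 hR0 hvK hvu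
  -- coefficients at the base point
  have hu0 : (fun x => u x + (fun _ => (0:ℝ)) x) = u := by ext x; simp
  set a0 : Fin d → Fin d → (Fin d → ℝ) → ℝ := aco d G G' ε μ V u with ha0
  have ha0h : ∀ i j, Hol α C1 (a0 i j) := by
    have := (hco (fun _ => 0) μ ⟨contDiff_const, fun x => by simp, fun i x => by simp [pd_const], fun i j x => by simp [pd_const], hμ⟩).1
    rwa [hu0] at this
  have cv : Cv d V u vn (fun _ => 0) μn μ := ⟨hVp, hV, hup, hu, fun n => (hvK n).per, fun n => (hvK n).c2, fun x k => rfl, contDiff_const,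
    hvu, fun i => by rw [pd_const]; exact d1 i, hμn⟩
  set an : ℕ → Fin d → Fin d → (Fin d → ℝ) → ℝ := fun n => aco d G G' ε (μn n) V (fun x => u x + vn n x) with han
  set cn : ℕ → (Fin d → ℝ) → ℝ := fun n x => cco d G G' ε (μn n) V (fun x => u x + vn n x) x - ∑ i, ∑ j, an n i j x * pd d i (pd d j u) x with hcn
  have hau : ∀ i j, UCB (fun n => an n i j) (a0 i j) := fun i j => by
    have := cv.a (ε := ε) hG h0 i j
    rwa [hu0] at this
  have hcu : UC cn (fun _ => 0) := by
    have k1 := cv.c (ε := ε) hG h0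
    rw [hu0] at k1
    have k2 := (k1.sub (UCB.sum Finset.univ fun i => UCB.sum Finset.univ fun j => (hau i j).mul (((hup.pd j).pd i).ucb (c0_pd (c1_pd hu j) i)))).1
    have e : (fun x => cco d G G' ε μ V u x - ∑ i, ∑ j, a0 i j x * pd d i (pd d j u) x) = fun _ => 0 := by
      ext x
      rw [← hF0 x, Ff_expand hG h0 hV hu]
    rw [e] at k2
    exact k2
  have hadm : ∀ᶠ n in atTop, Adm d (vn n) (μn n) := by
    filter_upwards [eventually_all.2 fun i => d1 i 1 one_pos, eventually_all.2 fun i => eventually_all.2 fun j => d2 i j 1 one_pos] with n k1 k2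
    exact ⟨(hvK n).c2, hv1 n, fun i => by simpa using k1 i, fun i j => by simpa using k2 i j, hμ1 n⟩
  have hch : ∀ᶠ n in atTop, Hol α C1 (cn n) := hadm.mono fun n hn => (hco _ _ hn).2
  have hah : ∀ᶠ n in atTop, ∀ i j, Hol α C1 (an n i j) := hadm.mono fun n hn => (hco _ _ hn).1
  have hFn : ∀ n x, Ff d G ε (μn n) V (fun x => u x + vn n x) x = cn n x - ∑ i, ∑ j, an n i j x * pd d i (pd d j (vn n)) x := by
    intro n x
    rw [Ff_expand hG h0 hV (hu.add (hvK n).c2), hcn, sub_sub, ← Finset.sum_add_distrib]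
    congr 1
    refine Finset.sum_congr rfl fun i _ => ?_
    rw [← Finset.sum_add_distrib]
    refine Finset.sum_congr rfl fun j _ => ?_
    rw [pd_add' hu.of21 (hvK n).c2.of21, pd_add' (c1_pd hu j) (c1_pd (hvK n).c2 j), mul_add]
  -- partition
  obtain ⟨r, hr, hrs⟩ := exists_small (A := C1) h0 (half_pos hη0)
  obtain ⟨N0, hN0⟩ := exists_nat_one_div_lt hr
  obtain ⟨ζ, hζ, hζ1, hζb, hζs⟩ := partition d (N0 + 2) (by omega)
  have hζ1' : ∀ k, Bd 1 (ζ k) := by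
    intro k x
    have := (Finset.single_le_sum (f := fun k => ζ k x ^ 2) (fun k _ => sq_nonneg _) (Finset.mem_univ k)).trans_eq (hζ1 x)
    exact abs_le_one_iff_mul_self_le_one.2 (by simpa [sq] using this)
  set X : (Fin d → Fin (N0 + 2)) → Fin d → ℝ := fun k i => ((k i : ℕ) : ℝ) / ((N0 + 2 : ℕ) : ℝ) with hX
  have hloc : ∀ k i j x, |ζ k x * (a0 i j (X k) - a0 i j x)| ≤ η / 2 := by
    intro k i j x
    by_cases hz : ζ k x = 0
    · rw [hz]; simp; positivity
    obtain ⟨n, hn⟩ := hζs k x hz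
    have e := aco_per (G := G) (G' := G') (ε := ε) (μ := μ) hVp hup i j (X k) n
    have k1 := ha0h i j x (X k + fun i => (n i : ℝ))
    have k2 : a0 i j (X k + fun i => (n i : ℝ)) = a0 i j (X k) := e
    rw [k2] at k1
    have k3 : dist x (X k + fun i => (n i : ℝ)) ≤ r := by
      refine hn.trans (le_trans ?_ hN0.le)
      push_cast
      gcongr
      linarith
    have k4 : C1 * dist x (X k + fun i => (n i : ℝ)) ^ α ≤ C1 * r ^ α := by gcongr
    rw [abs_mul, abs_sub_comm]
    have k5 := hζ1' k x
    have k6 : |a0 i j x - a0 i j (X k)| ≤ η / 2 := by linarith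
    calc _ ≤ 1 * (η / 2) := mul_le_mul k5 k6 (abs_nonneg _) zero_le_one
      _ = _ := one_mul _
  choose bk qk hfk hbk using fun k => hfr (G (Wf d ε μ V u (X k))) (G' (Wf d ε μ V u (X k))) (fun i => pd d i u (X k))
    (hm _).1 (hm _).2 (hG.pos _).le (hG.bd _) (fun i => hBu i _)
  have hbk' : ∀ k j l, ∑ i, bk k i j * bk k i l = a0 j l (X k) := fun k j l => hbk k j l
  have hloc' : ∀ k, ∀ᶠ n in atTop, ∀ i j x, |ζ k x * (a0 i j (X k) - an n i j x)| ≤ η := by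
    intro k
    filter_upwards [eventually_all.2 fun i => eventually_all.2 fun j => (hau i j).1 (η / 2) (half_pos hη0)] with n hn i j x
    have e : ζ k x * (a0 i j (X k) - an n i j x) = ζ k x * (a0 i j (X k) - a0 i j x) - ζ k x * (an n i j x - a0 i j x) := by ring
    rw [e]
    refine (abs_sub _ _).trans ?_
    have k1 := hloc k i j x
    have k2 : |ζ k x * (an n i j x - a0 i j x)| ≤ 1 * (η / 2) := by
      rw [abs_mul]
      exact mul_le_mul (hζ1' k x) (hn i j x) (abs_nonneg _) zero_le_one
    linarith
  have hE := fun k => err_bound h0 h1 hC1 hη0.le hR0 (hζ k) (hζ1' k) hvK hvu hcu hch hah hau (hloc' k)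
  set E : (Fin d → Fin (N0 + 2)) → ℕ → (Fin d → ℝ) → ℝ := fun k n => errf (ζ k) (cn n) (vn n) (fun i j => a0 i j (X k)) (an n) with hEdef
  have hEeq : ∀ k n x, E k n x = ζ k x * Ff d G ε (μn n) V (fun x => u x + vn n x) x - ζ k x * vn n x + Lap (bk k) (fun x => ζ k x * vn n x) x :=
    fun k n x => err_eq (hζ k).c2 (hvK n).c2 (hFn n) (hbk' k) x
  have hup' : ∀ n, ZPer d (fun x => u x + vn n x) := fun n x k => by simp only [hup x k, (hvK n).per x k]
  have hEp : ∀ k n, ZPer d (E k n) := by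
    intro k n x j
    have hp : ZPer d (fun x => ζ k x * vn n x) := fun x j => by simp only [(hζ k).1 x j, (hvK n).per x j]
    rw [hEeq, hEeq, (hζ k).1 x j, Ff_per hVp (hup' n) x j, (hvK n).per x j]
    congr 1
    unfold Lap
    exact Finset.sum_congr rfl fun i _ => dd_per _ (dd_per _ hp) x j
  -- correctors
  have hg : ∀ k n, ∃ g, KH d α (K * H) g ∧ (∀ M, Bd M (E k n) → Hol α H (E k n) → Bd M g) ∧ (Hol α H (E k n) → ∀ x, g x - Lap (bk k) g x = E k n x) := by
    intro k n
    by_cases hc : Hol α H (E k n)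
    · have hbb : ∃ M, Bd M (E k n) ∧ ∀ M', Bd M' (E k n) → M ≤ M' := by
        refine ⟨⨆ x, |E k n x|, fun x => ?_, fun M' hM' => ciSup_le hM'⟩
        obtain ⟨C, -, hC⟩ := (hEp k n).bounded (hc.continuous h0)
        exact le_ciSup (f := fun x => |E k n x|) ⟨C, by rintro _ ⟨y, rfl⟩; exact hC y⟩ x
      obtain ⟨M, hM, hM'⟩ := hbb
      obtain ⟨g, g1, g2, g3⟩ := hres (bk k) (qk k) (hfk k) (E k n) (hEp k n) H M hH0 hc hM
      exact ⟨g, g1, fun M' h _ => g3.mono (hM' M' h), fun _ => g2⟩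
    · exact ⟨fun _ => 0, KH.zero (by positivity), fun M _ h => absurd h hc, fun h => absurd h hc⟩
  choose g hgK hgB hgE using hg
  have hEH : ∀ᶠ n in atTop, ∀ k, Hol α H (E k n) := eventually_all.2 fun k => (hE k).2 σ hσ0
  have hgu : ∀ k, UC (g k) (fun _ => 0) := by
    intro k η hη
    filter_upwards [hEH, (hE k).1 η hη] with n k1 k2
    simpa using hgB k n η (by simpa using k2) (k1 k)
  have hw := fun i j => w_hol h0 h1 (mul_nonneg hK hH0) hb0 hζ hζb hgK hgu i j
  have hwu := (UCB.sum_z Finset.univ fun k => UCB.mul_z (hζ k).ucb (hgu k).z).1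
  filter_upwards [hEH, eventually_all.2 fun i => eventually_all.2 fun j => hw i j (1 / 2) (by norm_num), hwu 1 one_pos] with n k1 k2 k3
  have ws : ContDiff ℝ 2 (fun x => ∑ k, ζ k x * g k n x) := ContDiff.sum fun k _ => (hζ k).c2.mul (hgK k n).c2
  have hwK : KH d α R (fun x => - ∑ k, ζ k x * g k n x) := by
    refine ⟨fun x j => ?_, ws.neg, fun i j => ?_⟩
    · simp only [(hζ _).1 x j, (hgK _ n).per x j]
    · rw [pd_neg, pd_neg]
      exact ((k2 i j).mono hbH).neg
  have hwB : Bd 1 (fun x => - ∑ k, ζ k x * g k n x) := fun x => by simpa using k3 x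
  set Gk : (Fin d → Fin (N0 + 2)) → (Fin d → ℝ) → ℝ := fun k x => ζ k x * vn n x + g k n x with hGk
  have zv : ∀ k, ContDiff ℝ 2 (fun x => ζ k x * vn n x) := fun k => (hζ k).c2.mul (hvK n).c2
  have hGc : ∀ k, ContDiff ℝ 2 (Gk k) := fun k => (zv k).add (hgK k n).c2
  have hGp : ∀ k, ZPer d (Gk k) := fun k x j => by simp only [hGk, (hζ k).1 x j, (hgK k n).per x j, (hvK n).per x j]
  have hzz : ∀ x, - ∑ k, ζ k x * Gk k x = - vn n x - ∑ k, ζ k x * g k n x := by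
    intro x
    have : ∑ k, ζ k x * Gk k x = (∑ k, ζ k x ^ 2) * vn n x + ∑ k, ζ k x * g k n x := by
      rw [Finset.sum_mul, ← Finset.sum_add_distrib]
      exact Finset.sum_congr rfl fun k _ => by simp only [hGk]; ring
    rw [this, hζ1 x]; ring
  refine energy hζ hζ1 (Ff_cont hG h0 hV (hu.add (hvK n).c2)) hGp hGc (b := bk) (fun k x => ?_) ?_
  · have e1 := hgE k n (k1 k) x
    rw [hEeq] at e1
    have e2 := Lap_add (bk k) (zv k) (hgK k n).c2 x
    simp only [hGk]
    rw [e2]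
    linear_combination e1
  · refine var_ineq hG h0 hΦ hVp hV (hup' n) (hu.add (hvK n).c2) (z := fun x => - ∑ k, ζ k x * Gk k x) (fun x j => ?_) ?_ fun t t0 t1 => ?_
    · simp only [(hζ _).1 x j, hGp _ x j]
    · exact (ContDiff.sum fun k _ => (hζ k).c2.mul (hGc k)).neg
    · have := hmin n _ ((hvK n).comb hwK t0.le t1) ((hv1 n).comb hwB t0.le t1)
      refine this.trans_eq ?_
      congr 1
      ext x
      rw [hzz x]
      ring

end

open MeasureTheory Set Filter Topology

lemma HolderSemi.unif {d : ℕ} {α : ℝ} {κ : Type*} [Fintype κ] {f : κ → (Fin d → ℝ) → ℝ} (h : ∀ k, HolderSemi α (f k)) :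
    ∃ C : ℝ, ∀ k, Hol α C (f k) := by
  choose C hC hc using h
  refine ⟨∑ k, C k, fun k => Hol.mono (hc k) ?_⟩
  exact Finset.single_le_sum (f := C) (fun k _ => hC k) (Finset.mem_univ k)

lemma Hol.semi {d : ℕ} {α C : ℝ} {f : (Fin d → ℝ) → ℝ} (h : Hol α C f) : HolderSemi α f :=
  ⟨|C|, abs_nonneg _, Hol.mono h (le_abs_self C)⟩

lemma mass_c1 {d : ℕ} {α L ε μ CV CU : ℝ} (h0 : 0 < α) (h1 : α < 1) {G G' : ℝ → ℝ} (hG : GG α L G G') {V u : (Fin d → ℝ) → ℝ}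
    (hVp : ZPer d V) (hV : ContDiff ℝ 1 V) (hVh : ∀ i, Hol α CV (pd d i V)) (hup : ZPer d u) (hu : ContDiff ℝ 2 u)
    (huh : ∀ i j, Hol α CU (pd d i (pd d j u))) : C1Hold d α (fun x => G (Wf d ε μ V u x)) := by
  have hW := Wf_c1 (ε := ε) (μ := μ) hV hu
  have hWp := Wf_per (ε := ε) (μ := μ) hVp hup
  refine ⟨mf_c1 hG h0 hW, fun i => ?_⟩
  have e : pd d i (fun x => G (Wf d ε μ V u x)) = fun x => G' (Wf d ε μ V u x) * (ε * pd d i u x + ∑ j, pd d j u x * pd d i (pd d j u) x + μ * pd d i V x) := by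
    ext x
    rw [pd_G hG hW, pd_Wf hV hu]
  rw [e]
  have nu : ∀ c : ℝ, UB (ι := Unit) (d := d) α (fun _ _ => c) := fun c => UB.num (abs_nonneg c) fun _ => le_rfl
  have u1 : ∀ i, UB (ι := Unit) α (fun _ => pd d i u) := fun i => UB.of_per_c1 h0 h1 (hup.pd i) (c1_pd hu i)
  have uG : UB (ι := Unit) α (fun _ x => G' (Wf d ε μ V u x)) := by
    choose C hC hc using fun i => (hWp.pd i).bounded (c0_pd hW i)
    have hs : 0 ≤ ∑ i, C i := Finset.sum_nonneg fun i _ => hC i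
    have hl := lip_of_pd hW.dif1 (M := ∑ i, C i) fun i => (hc i).mono (Finset.single_le_sum (f := C) (fun i _ => hC i) (Finset.mem_univ i))
    have hL := hG.L0
    have hol : Hol α (L * (d * ∑ i, C i) ^ α) (fun x => G' (Wf d ε μ V u x)) := by
      intro x y
      refine (hG.hol _ _).trans ?_
      calc _ ≤ L * ((d * ∑ i, C i) * dist x y) ^ α := by
            have := hl x y
            gcongr
        _ = _ := by rw [Real.mul_rpow (by positivity) dist_nonneg]; ring
    exact UB.of_hol h0 (fun x k => by simp only [hWp x k]) hol
  obtain ⟨C, -, hC⟩ := uG.mul ((((nu ε).mul (u1 i)).add (UB.sum Finset.univ fun j => (u1 j).mul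
    (UB.of_hol h0 ((hup.pd j).pd i) (huh i j)))).add ((nu μ).mul (UB.of_hol h0 (hVp.pd i) (hVh i))))
  exact (hC ()).2.semi

lemma per_range {d : ℕ} {m : (Fin d → ℝ) → ℝ} (hp : ZPer d m) (hc : Continuous m) : ∃ p q, ∀ x, m x ∈ Icc (m p) (m q) := by
  have hne : (Icc (0 : Fin d → ℝ) 1).Nonempty := ⟨0, by simp⟩
  obtain ⟨p, -, hp'⟩ := (isCompact_Icc (a := (0 : Fin d → ℝ)) (b := 1)).exists_isMinOn hne hc.continuousOn
  obtain ⟨q, -, hq'⟩ := (isCompact_Icc (a := (0 : Fin d → ℝ)) (b := 1)).exists_isMaxOn hne hc.continuousOn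
  refine ⟨p, q, fun x => ?_⟩
  obtain ⟨k, hk⟩ := exists_cube x
  rw [← hp x k]
  exact ⟨hp' hk, hq' hk⟩

theorem main_open (d : ℕ) (α : ℝ) (h0 : 0 < α) (h1 : α < 1)
    (g : ℝ → ℝ) (V : (Fin d → ℝ) → ℝ) (hg : Ghyp α g) (hV : Vhyp d α V)
    (hA2 : A2 g) (ε : ℝ) (hε : 0 < ε)
    (lam : ℝ) (hlam : lam ∈ Icc (0 : ℝ) 1) (hmem : InLambda d α g V ε lam) :
    ∃ δ : ℝ, 0 < δ ∧ ∀ lam' : ℝ, lam' ∈ Icc (0 : ℝ) 1 → |lam' - lam| < δ →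
      InLambda d α g V ε lam' := by
  obtain ⟨u, m, hs, hpos⟩ := hmem
  obtain ⟨hVp, hVc, hVs⟩ := hV
  obtain ⟨CV, hVh⟩ := HolderSemi.unif hVs
  have huc := hs.reg_u.1
  obtain ⟨CU, huh'⟩ := HolderSemi.unif (κ := Fin d × Fin d) (f := fun p => pd d p.1 (pd d p.2 u)) fun p => hs.reg_u.2 p.1 p.2
  have huh : ∀ i j, Hol α CU (pd d i (pd d j u)) := fun i j => huh' (i, j)
  obtain ⟨xp, xq, hr⟩ := per_range hs.per_m hs.reg_m.1.continuous
  obtain ⟨G, G', L, p, q, hG, hGi, hGg⟩ := exists_G h0 h1 hg hA2 (hpos xp) ((hr xp).2)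
  have hW : ∀ x, Wf d ε lam V u x = g (m x) := fun x => hs.hj x
  have hGm : ∀ x, G (Wf d ε lam V u x) = m x := fun x => by rw [hW]; exact (hGg _ (hr x)).2
  have hGm' : (fun x => G (Wf d ε lam V u x)) = m := funext hGm
  have hF0 : ∀ x, Ff d G ε lam V u x = 0 := fun x => by
    have := hs.fp x
    unfold Ff
    rw [hGm', hGm]; linarith
  set Φ : ℝ → ℝ := fun y => ∫ t in (0:ℝ)..y, G t with hΦd
  have hΦ : ∀ y, HasDerivAt Φ (G y) y := fun y => intervalIntegral.integral_hasDerivAt_right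
    (hG.cont.intervalIntegrable _ _) (hG.cont.stronglyMeasurableAtFilter _ _) hG.cont.continuousAt
  have hΦc : Continuous Φ := continuous_iff_continuousAt.2 fun z => (hΦ z).continuousAt
  have habs : ∀ t ∈ Icc (0:ℝ) 1, |t| ≤ 1 := fun t ht => by rw [abs_of_nonneg ht.1]; exact ht.2
  obtain ⟨R, hR, hcore⟩ := core (μ := lam) h0 h1 hG hΦ hVp hVc hVh hs.per_u huc huh (habs _ hlam) hF0 (hpos xp)
    (fun x => by rw [hGm]; exact hr x)
  by_contra hcon
  push Not at hcon
  choose l hl hld hln using fun n : ℕ => hcon (1 / ((n:ℝ) + 1)) (by positivity)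
  have hlt : Tendsto l atTop (𝓝 lam) := by
    rw [tendsto_iff_dist_tendsto_zero]
    exact squeeze_zero (fun _ => dist_nonneg) (fun n => by rw [Real.dist_eq]; exact (hld n).le) tendsto_one_div_add_atTop_nhds_zero_nat
  choose v hvK hvB hvm using fun n => exists_min (ε := ε) (μ := l n) h0 h1 hR zero_le_one hG hΦ hVp hVc hs.per_u huc
  obtain ⟨φ, hφ, w, hwK, hwB, c0, c1, c2⟩ := kh_compact h0 h1 hR hvK hvB
  have hlφ : Tendsto (fun n => l (φ n)) atTop (𝓝 lam) := hlt.comp hφ.tendsto_atTop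
  have cv : Cv d V u (fun n => v (φ n)) w (fun n => l (φ n)) lam := ⟨hVp, hVc, hs.per_u, huc, fun n => (hvK _).per, fun n => (hvK _).c2,
    hwK.per, hwK.c2, c0, c1, hlφ⟩
  have zK : KH d α R (fun _ => 0) := KH.zero hR
  have ucz : ∀ f : (Fin d → ℝ) → ℝ, UC (fun _ => f) f := fun f η hη => Eventually.of_forall fun _ x => by simpa using hη.le
  have cz : Cv d V u (fun _ _ => 0) (fun _ => 0) (fun n => l (φ n)) lam := ⟨hVp, hVc, hs.per_u, huc, fun n => zK.per, fun n => zK.c2,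
    zK.per, zK.c2, ucz _, fun i => ucz _, hlφ⟩
  have hJ := le_of_tendsto_of_tendsto' (cv.J (ε := ε) hΦc) (cz.J (ε := ε) hΦc) (fun n => hvm (φ n) _ zK (fun x => by simp))
  have hu0 : (fun x => u x + (fun _ => (0:ℝ)) x) = u := by ext x; simp
  rw [hu0] at hJ
  have hw0 : w = fun _ => 0 := funext fun x => unique_min hε hG h0 hΦ hVp hVc hs.per_u huc hF0 (fun x => by rw [hGm]; exact hpos x) hwK.per hwK.c2 hJ x
  subst hw0
  have hFev := hcore (fun n => l (φ n)) (fun n => v (φ n)) hlφ (fun n => habs _ (hl _)) (fun n => hvK _) (fun n => hvB _) (fun n => hvm _) c0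
  have hWu := cv.W (ε := ε)
  rw [hu0] at hWu
  -- range of W
  have hI1 := (hGg _ (hr xp)).1
  have hI2 := (hGg _ (hr xq)).1
  have hmono : ∀ x, g (m xp) ≤ Wf d ε lam V u x ∧ Wf d ε lam V u x ≤ g (m xq) := fun x => by
    rw [hW]
    exact ⟨hg.1.monotoneOn (hpos _).le (hpos _).le (hr x).1, hg.1.monotoneOn (hpos _).le (hpos _).le (hr x).2⟩
  set σ := min (g (m xp) - p) (q - g (m xq)) with hσ
  have hσ0 : 0 < σ := lt_min (by linarith [hI1.1]) (by linarith [hI2.2])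
  obtain ⟨n, hn1, hn2⟩ := (hFev.and (hWu.1 σ hσ0)).exists
  have hmemW : ∀ x, Wf d ε (l (φ n)) V (fun x => u x + v (φ n) x) x ∈ Icc p q := fun x => by
    have k1 := abs_le.1 (hn2 x)
    have k2 := hmono x
    have k3 := min_le_left (g (m xp) - p) (q - g (m xq))
    have k4 := min_le_right (g (m xp) - p) (q - g (m xq))
    constructor <;> linarith [k1.1, k1.2, k2.1, k2.2]
  have hup' : ZPer d (fun x => u x + v (φ n) x) := fun x k => by simp only [hs.per_u x k, (hvK (φ n)).per x k]
  have huc' : ContDiff ℝ 2 (fun x => u x + v (φ n) x) := huc.add (hvK (φ n)).c2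
  have huh2 : ∀ i j, Hol α (CU + R) (pd d i (pd d j (fun x => u x + v (φ n) x))) := fun i j => by
    rw [pd_add' huc.of21 (hvK (φ n)).c2.of21, pd_add' (c1_pd huc j) (c1_pd (hvK (φ n)).c2 j)]
    exact (huh i j).add ((hvK (φ n)).hol i j)
  refine hln (φ n) ⟨fun x => u x + v (φ n) x, fun x => G (Wf d ε (l (φ n)) V (fun x => u x + v (φ n) x) x), ?_, fun x => (hGi _ (hmemW x)).1⟩
  refine ⟨hup', fun x k => by simp only [Wf_per hVp hup' x k], ⟨huc', fun i j => (huh2 i j).semi⟩,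
    mass_c1 h0 h1 hG hVp hVc hVh hup' huc' huh2, fun x => (hGi _ (hmemW x)).1.le, fun x => (hGi _ (hmemW x)).2.symm, fun x => ?_⟩
  have := hn1 x
  unfold Ff at this
  linarith

theorem stmt15 (d : ℕ) (α : ℝ) (hα0 : 0 < α) (hα1 : α < 1)
    (g : ℝ → ℝ) (V : (Fin d → ℝ) → ℝ) (hg : Ghyp α g) (hV : Vhyp d α V)
    (hA1 : A1 d g V) (hA2 : A2 g) (ε : ℝ) (hε : 0 < ε)
    (lam : ℝ) (hlam : lam ∈ Icc (0 : ℝ) 1) (hmemΛ : InLambda d α g V ε lam) :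
    ∃ δ : ℝ, 0 < δ ∧ ∀ lam' : ℝ, lam' ∈ Icc (0 : ℝ) 1 → |lam' - lam| < δ →
      InLambda d α g V ε lam' := by
  exact main_open d α hα0 hα1 g V hg hV hA2 ε hε lam hlam hmemΛ
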